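/- Let δ > −1, Λ_n^{T,δ} := sup_{x∈T^d} a_κ^T ∫_{T^d} |K_n^δ(W_κ^T;x,y)| W_κ^T(y) dy and Π_n^T := sup_{x∈T^d} a_κ^T ∫_{T^d} |P_n(W_κ^T;x,y)| W_κ^T(y) dy (the operator norms of the Cesàro (C,δ) mean and of the orthogonal projection on L^∞(W_κ^T;T^d) and on L¹(W_κ^T;T^d)). Then there exist constants c₁, c₂ > 0, depending only on d, κ and δ, such that c₁ n^{σ_κ} ≤ Π_n^T ≤ c₂ n^{σ_κ} for all n ≥ 1, and for all n ≥ 2: if δ > σ_κ then c₁ ≤ Λ_n^{T,δ} ≤ c₂; if δ = σ_κ then c₁ log n ≤ Λ_n^{T,δ} ≤ c₂ log n; and if −1 < δ < σ_κ then c₁ n^{σ_κ−δ} ≤ Λ_n^{T,δ} ≤ c₂ n^{σ_κ−δ}. -/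

import Mathlib

open MeasureTheory Finset Real intervalIntegral

/-- Generalized binomial coefficient `C(x, k) = x (x-1) ⋯ (x-k+1) / k!`. -/
noncomputable def genBinom (x : ℝ) (k : ℕ) : ℝ :=
  (∏ i ∈ Finset.range k, (x - i)) / (Nat.factorial k)

/-- Cesàro coefficient `A_m^δ = C(m+δ, m)`. -/
noncomputable def cesA (δ : ℝ) (m : ℕ) : ℝ := genBinom (m + δ) m

/-- The cube `[-1,1]^m`. -/
def cube (m : ℕ) : Set (Fin m → ℝ) := Set.univ.pi fun _ => Set.Icc (-1) 1

/-- The simplex `T^d = {x : x_i ≥ 0, Σ x_i ≤ 1}`. -/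
def simplexT (d : ℕ) : Set (Fin d → ℝ) := {x | (∀ i, 0 ≤ x i) ∧ ∑ i, x i ≤ 1}

/-- The Jacobi weight `w^{(α,β)}(t) = (1-t)^α (1+t)^β`. -/
noncomputable def wJac (a b t : ℝ) : ℝ := (1 - t) ^ a * (1 + t) ^ b

/-- Extended coordinates: `(x_1, …, x_d, 1 - |x|)`. -/
noncomputable def xext (d : ℕ) (x : Fin d → ℝ) : Fin (d + 1) → ℝ := fun i =>
  if h : (i : ℕ) < d then x ⟨i, h⟩ else 1 - ∑ j, x j

/-- `z(x,y,t) = Σ_j √(x_j y_j) t_j` with the extended coordinates. -/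
noncomputable def zST (d : ℕ) (x y : Fin d → ℝ) (t : Fin (d + 1) → ℝ) : ℝ :=
  ∑ j, Real.sqrt (xext d x j * xext d y j) * t j

/-- The Euclidean distance `‖ξ - ζ‖` between `ξ = (√x_1,…,√x_{d+1})` and
`ζ = (√y_1,…,√y_{d+1})`. -/
noncomputable def distXi (d : ℕ) (x y : Fin d → ℝ) : ℝ :=
  Real.sqrt (∑ j, (Real.sqrt (xext d x j) - Real.sqrt (xext d y j)) ^ 2)

/-- The weight `∏ (1-t_i²)^{κ_i-1}` on the cube `[-1,1]^{d+1}`. -/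
noncomputable def wcube {m : ℕ} (κ : Fin m → ℝ) (t : Fin m → ℝ) : ℝ :=
  ∏ i, (1 - t i ^ 2) ^ (κ i - 1)

/-- The Cesàro `(C,δ)` kernel `K_n^δ(W_κ^T; x, y)` on the simplex, built from the
orthonormal Jacobi family `q = (q_k^{(|κ|+(d-2)/2, -1/2)})`. -/
noncomputable def simpK (d : ℕ) (κ : Fin (d + 1) → ℝ) (q : ℕ → Polynomial ℝ) (δ : ℝ)
    (n : ℕ) (x y : Fin d → ℝ) : ℝ :=
  (∫ t in cube (d + 1), wcube κ t)⁻¹ *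
    ∫ t in cube (d + 1),
      ((cesA δ n)⁻¹ * ∑ k ∈ Finset.range (n + 1),
        cesA δ (n - k) * (q k).eval 1 * (q k).eval (2 * zST d x y t ^ 2 - 1)) * wcube κ t

/-- The projection kernel `P_n(W_κ^T; x, y)` on the simplex. -/
noncomputable def simpP (d : ℕ) (κ : Fin (d + 1) → ℝ) (q : ℕ → Polynomial ℝ)
    (n : ℕ) (x y : Fin d → ℝ) : ℝ :=
  (∫ t in cube (d + 1), wcube κ t)⁻¹ *
    ∫ t in cube (d + 1),
      ((q n).eval 1 * (q n).eval (2 * zST d x y t ^ 2 - 1)) * wcube κ t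

/-- The weight `W_κ^T(x) = ∏ x_i^{κ_i-1/2} (1-|x|)^{κ_{d+1}-1/2}` on the simplex. -/
noncomputable def WT (d : ℕ) (κ : Fin (d + 1) → ℝ) (x : Fin d → ℝ) : ℝ :=
  (∏ i : Fin d, x i ^ (κ i.castSucc - 1 / 2)) * (1 - ∑ i, x i) ^ (κ (Fin.last d) - 1 / 2)

/-- `σ_κ = (d-1)/2 + |κ| - min_i κ_i`. -/
noncomputable def sigmaK (d : ℕ) (κ : Fin (d + 1) → ℝ) : ℝ :=
  ((d : ℝ) - 1) / 2 + (∑ i, κ i) - Finset.univ.inf' (Finset.univ_nonempty) κ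

/-- The operator norm `Λ_n^{T,δ} = sup_{x∈T^d} a_κ^T ∫_{T^d} |K_n^δ(W_κ^T;x,y)| W_κ^T(y) dy`. -/
noncomputable def cesaroNormT (d : ℕ) (κ : Fin (d + 1) → ℝ) (q : ℕ → Polynomial ℝ)
    (δ : ℝ) (n : ℕ) : ℝ :=
  ⨆ x : simplexT d,
    (∫ y in simplexT d, WT d κ y)⁻¹ * ∫ y in simplexT d, |simpK d κ q δ n x y| * WT d κ y

/-- The operator norm `Π_n^T = sup_{x∈T^d} a_κ^T ∫_{T^d} |P_n(W_κ^T;x,y)| W_κ^T(y) dy`. -/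
noncomputable def projNormT (d : ℕ) (κ : Fin (d + 1) → ℝ) (q : ℕ → Polynomial ℝ)
    (n : ℕ) : ℝ :=
  ⨆ x : simplexT d,
    (∫ y in simplexT d, WT d κ y)⁻¹ * ∫ y in simplexT d, |simpP d κ q n x y| * WT d κ y

/-- The coefficient of `z ^ n` in `(1 - z) ^ (-c)`. -/
noncomputable def rc (c : ℝ) (n : ℕ) : ℝ := (∏ j ∈ Finset.range n, (c + j)) / n.factorial

@[simp] lemma rc_zero (c : ℝ) : rc c 0 = 1 := by simp [rc]

lemma rc_succ (c : ℝ) (n : ℕ) : rc c (n + 1) = rc c n * (c + n) / (n + 1) := by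
  unfold rc
  rw [Finset.prod_range_succ, Nat.factorial_succ]
  push_cast
  have : (n.factorial : ℝ) ≠ 0 := by positivity
  field_simp

lemma cesA_eq_rc (δ : ℝ) (n : ℕ) : cesA δ n = rc (δ + 1) n := by
  unfold cesA genBinom rc
  congr 1
  rw [← Finset.prod_range_reflect]
  refine Finset.prod_congr rfl fun j hj => ?_
  have hj' : j + 1 ≤ n := Finset.mem_range.1 hj
  have : ((n - 1 - j : ℕ) : ℝ) = n - 1 - j := by
    rw [Nat.sub_sub, Nat.cast_sub (by omega)]; push_cast; ring
  rw [this]; ring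

lemma rc_pos {c : ℝ} (hc : 0 < c) (n : ℕ) : 0 < rc c n := by
  unfold rc
  have : 0 < ∏ j ∈ Finset.range n, (c + j) := Finset.prod_pos fun j _ => by positivity
  positivity

lemma rc_add_one_sub (c : ℝ) (n : ℕ) : rc (c + 1) (n + 1) = rc (c + 1) n + rc c (n + 1) := by
  induction n with
  | zero => simp [rc_succ]; ring
  | succ n ih =>
    have h1 := rc_succ (c + 1) (n + 1)
    have h2 := rc_succ c (n + 1)
    have h3 := rc_succ (c + 1) n
    have h4 : rc c (n + 1) = rc (c + 1) (n + 1) - rc (c + 1) n := by linarith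
    have n1 : (n : ℝ) + 1 ≠ 0 := by positivity
    have n2 : (n : ℝ) + 1 + 1 ≠ 0 := by positivity
    rw [h2, h4, h1]
    rw [h3]
    push_cast
    field_simp
    ring

lemma rc_add_one_eq_sum (c : ℝ) (n : ℕ) : rc (c + 1) n = ∑ k ∈ Finset.range (n + 1), rc c k := by
  induction n with
  | zero => simp
  | succ n ih => rw [rc_add_one_sub, ih, Finset.sum_range_succ _ (n + 1)]

lemma rc_eq_multichoose (c : ℝ) (n : ℕ) : ((rc c n : ℝ) : ℂ) = Ring.multichoose (c : ℂ) n := by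
  have h := Ring.factorial_nsmul_multichoose_eq_ascPochhammer (c : ℂ) n
  rw [Polynomial.ascPochhammer_smeval_eq_eval] at h
  have h2 : ∀ m : ℕ, (ascPochhammer ℂ m).eval (c : ℂ) = ((∏ j ∈ Finset.range m, (c + j) : ℝ) : ℂ) := by
    intro m
    induction m with
    | zero => simp
    | succ m ih => rw [ascPochhammer_succ_eval, ih, Finset.prod_range_succ]; push_cast; ring
  rw [h2] at h
  have : (n.factorial : ℂ) ≠ 0 := by exact_mod_cast n.factorial_ne_zero
  unfold rc
  push_cast at h ⊢
  rw [div_eq_iff this, ← h, nsmul_eq_mul]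
  ring

/-- The binomial series. -/
lemma hasSum_rc (c : ℝ) {z : ℂ} (hz : ‖z‖ < 1) :
    HasSum (fun n => (rc c n : ℂ) * z ^ n) ((1 - z) ^ (-c : ℂ)) := by
  have h := Complex.one_div_one_sub_cpow_hasFPowerSeriesOnBall_zero (c : ℂ)
  have h2 := h.hasSum (y := z) (by
    rw [Metric.mem_eball, edist_zero_right, ← ofReal_norm]
    exact ENNReal.ofReal_lt_one.2 hz)
  simp only [FormalMultilinearSeries.ofScalars_apply_eq, zero_add] at h2
  rw [Complex.cpow_neg, ← one_div]
  have h3 : (fun n => (rc c n : ℂ) * z ^ n) = fun n : ℕ => Ring.choose ((c : ℂ) + n - 1) n • z ^ n := by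
    funext n
    rw [rc_eq_multichoose, Ring.multichoose_eq, smul_eq_mul]
  rw [h3]
  exact h2

lemma summable_norm_rc (c : ℝ) {z : ℂ} (hz : ‖z‖ < 1) :
    Summable (fun n => ‖(rc c n : ℂ) * z ^ n‖) :=
  (hasSum_rc c hz).summable.norm

/-- Gegenbauer polynomials, by their three-term recurrence. -/
noncomputable def geg (c : ℝ) : ℕ → Polynomial ℝ
  | 0 => 1
  | 1 => Polynomial.C (2 * c) * Polynomial.X
  | (n + 2) => Polynomial.C (2 * (n + 1 + c) / (n + 2)) * Polynomial.X * geg c (n + 1) -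
      Polynomial.C ((n + 2 * c) / (n + 2)) * geg c n

lemma geg_rec (c : ℝ) (n : ℕ) (u : ℝ) : ((n : ℝ) + 2) * (geg c (n + 2)).eval u =
    2 * (n + 1 + c) * u * (geg c (n + 1)).eval u - (n + 2 * c) * (geg c n).eval u := by
  have : (n : ℝ) + 2 ≠ 0 := by positivity
  simp only [geg, Polynomial.eval_sub, Polynomial.eval_mul, Polynomial.eval_C, Polynomial.eval_X]
  field_simp

@[simp] lemma geg_zero (c : ℝ) : geg c 0 = 1 := by simp [geg]
lemma geg_one (c : ℝ) : geg c 1 = Polynomial.C (2 * c) * Polynomial.X := by simp [geg]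

lemma geg_degree_coeff (c : ℝ) (n : ℕ) :
    (geg c n).natDegree ≤ n ∧ (geg c n).coeff n = 2 ^ n * rc c n := by
  induction n using Nat.strong_induction_on with
  | _ n ih =>
    match n with
    | 0 => simp
    | 1 =>
      refine ⟨?_, ?_⟩
      · rw [geg_one]; exact (Polynomial.natDegree_C_mul_le _ _).trans Polynomial.natDegree_X_le
      · rw [geg_one]; simp [rc_succ]
    | n + 2 =>
      obtain ⟨h1, h1'⟩ := ih (n + 1) (by omega)
      obtain ⟨h0, h0'⟩ := ih n (by omega)
      constructor
      · rw [geg]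
        refine (Polynomial.natDegree_sub_le _ _).trans (max_le ?_ ?_)
        · refine Polynomial.natDegree_mul_le.trans ?_
          have := (Polynomial.natDegree_C_mul_le (2 * ((n : ℝ) + 1 + c) / (n + 2)) Polynomial.X).trans Polynomial.natDegree_X_le
          omega
        · refine (Polynomial.natDegree_C_mul_le _ _).trans (by omega)
      · rw [geg, Polynomial.coeff_sub, mul_assoc, Polynomial.coeff_C_mul, Polynomial.coeff_X_mul,
          h1', Polynomial.coeff_C_mul, Polynomial.coeff_eq_zero_of_natDegree_lt (p := geg c n) (by omega),
          rc_succ c (n + 1)]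
        push_cast
        have : (n : ℝ) + 2 ≠ 0 := by positivity
        have : (n : ℝ) + 1 + 1 ≠ 0 := by positivity
        field_simp
        ring

lemma geg_neg (c : ℝ) (n : ℕ) (u : ℝ) : (geg c n).eval (-u) = (-1) ^ n * (geg c n).eval u := by
  induction n using Nat.strong_induction_on with
  | _ n ih =>
    match n with
    | 0 => simp
    | 1 => simp [geg_one]
    | n + 2 =>
      have h1 := ih (n + 1) (by omega)
      have h0 := ih n (by omega)
      have hr := geg_rec c n u
      have hr' := geg_rec c n (-u)
      have : (n : ℝ) + 2 ≠ 0 := by positivity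
      apply mul_left_cancel₀ this
      rw [hr', h1, h0, mul_left_comm _ ((-1 : ℝ) ^ (n + 2)), hr]
      ring

/-- `(N + c) C_N^c = c (C_N^{c+1} - C_{N-2}^{c+1})`. -/
lemma geg_sub {c : ℝ} (hc : 0 < c) (u : ℝ) (n : ℕ) :
    ((n : ℝ) + 2 + c) * (geg c (n + 2)).eval u =
      c * ((geg (c + 1) (n + 2)).eval u - (geg (c + 1) n).eval u) := by
  induction n using Nat.strong_induction_on with
  | _ n ih =>
    match n with
    | 0 =>
      have h1 := geg_rec c 0 u
      have h2 := geg_rec (c + 1) 0 u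
      simp [geg_one] at h1 h2 ⊢
      linear_combination (2 + c) / 2 * h1 - c / 2 * h2
    | 1 =>
      have h1 := geg_rec c 0 u
      have h2 := geg_rec (c + 1) 0 u
      have h3 := geg_rec c 1 u
      have h4 := geg_rec (c + 1) 1 u
      simp [geg_one] at h1 h2 h3 h4 ⊢
      linear_combination (3 + c) / 3 * h3 - c / 3 * h4 + (3 + c) / 3 * (2 + c) * u * h1
        - c * (3 + c) / 3 * u * h2
    | n + 2 =>
      have i1 := ih (n + 1) (by omega)
      have i0 := ih n (by omega)
      have p4 := geg_rec c (n + 2) u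
      have q4 := geg_rec (c + 1) (n + 2) u
      have q2 := geg_rec (c + 1) n u
      push_cast at *
      have e : ((n : ℝ) + 2) * (geg c (n + 2)).eval u =
          2 * c * (u * (geg (c + 1) (n + 1)).eval u - (geg (c + 1) n).eval u) := by
        have : (n : ℝ) + 2 + c ≠ 0 := by positivity
        apply mul_left_cancel₀ this
        linear_combination ((n : ℝ) + 2) * i0 + c * q2
      have : (n : ℝ) + 2 + 2 ≠ 0 := by positivity
      apply mul_left_cancel₀ this
      linear_combination ((n : ℝ) + 2 + 2 + c) * p4 - c * q4 + ((n : ℝ) + 2 + 2 + c) * (2 * u * i1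
        - 2 * i0 + e)

/-- The explicit trigonometric form of the Gegenbauer polynomials. -/
lemma geg_eval_eq_sum (c : ℝ) (u : ℝ) {z w : ℂ} (hzw : z * w = 1) (hs : z + w = 2 * u) (n : ℕ) :
    (((geg c n).eval u : ℝ) : ℂ) =
      ∑ p ∈ HasAntidiagonal.antidiagonal n,
        ((rc c p.1 : ℂ) * z ^ p.1) * ((rc c p.2 : ℂ) * w ^ p.2) := by
  set A : ℂ → PowerSeries ℂ := fun z => PowerSeries.mk fun n => (rc c n : ℂ) * z ^ n with hA
  have hd : ∀ z, PowerSeries.derivative ℂ (A z) * (1 - PowerSeries.C z * PowerSeries.X) =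
      PowerSeries.C (c * z) * A z := by
    intro z
    ext n
    have h1 : ∀ n : ℕ, (rc c (n + 1) : ℂ) * (n + 1) = rc c n * (c + n) := by
      intro n
      rw [rc_succ]
      push_cast
      have : (n : ℂ) + 1 ≠ 0 := by exact_mod_cast n.succ_ne_zero
      field_simp
    rw [mul_sub, mul_one, mul_left_comm, PowerSeries.coeff_C_mul, map_sub, PowerSeries.coeff_C_mul]
    cases n with
    | zero =>
      have := h1 0
      simp only [PowerSeries.coeff_derivative, hA, PowerSeries.coeff_mk,
        PowerSeries.coeff_zero_mul_X, rc_zero] at *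
      push_cast at *
      linear_combination z * this
    | succ n =>
      rw [PowerSeries.coeff_succ_mul_X]
      have := h1 n
      have h3 := h1 (n + 1)
      simp only [PowerSeries.coeff_derivative, hA, PowerSeries.coeff_mk]
      push_cast at *
      linear_combination z ^ (n + 2) * h3 - z ^ (n + 2) * this + z ^ (n + 2) * this
  have hF : PowerSeries.derivative ℂ (A z * A w) *
      (1 - PowerSeries.C (2 * u : ℂ) * PowerSeries.X + PowerSeries.X ^ 2) =
      PowerSeries.C (2 * c : ℂ) * (PowerSeries.C (u : ℂ) - PowerSeries.X) * (A z * A w) := by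
    have e1 : (1 - PowerSeries.C (2 * u : ℂ) * PowerSeries.X + PowerSeries.X ^ 2 : PowerSeries ℂ) =
        (1 - PowerSeries.C z * PowerSeries.X) * (1 - PowerSeries.C w * PowerSeries.X) := by
      have h2 : (PowerSeries.C z * PowerSeries.C w : PowerSeries ℂ) = 1 := by
        rw [← map_mul, hzw, map_one]
      rw [← hs, map_add]
      linear_combination - PowerSeries.X ^ 2 * h2
    have h3 : (PowerSeries.C (2 * c : ℂ) : PowerSeries ℂ) * (PowerSeries.C (u : ℂ) - PowerSeries.X) =
        PowerSeries.C (c * z) * (1 - PowerSeries.C w * PowerSeries.X) +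
        PowerSeries.C (c * w) * (1 - PowerSeries.C z * PowerSeries.X) := by
      have h2 : (PowerSeries.C z * PowerSeries.C w : PowerSeries ℂ) = 1 := by
        rw [← map_mul, hzw, map_one]
      have h4 : (PowerSeries.C z + PowerSeries.C w : PowerSeries ℂ) =
          PowerSeries.C 2 * PowerSeries.C (u : ℂ) := by
        rw [← map_mul, ← hs, map_add]
      have h5 : (PowerSeries.C 2 : PowerSeries ℂ) = 2 := by
        rw [show (2 : ℂ) = 1 + 1 by norm_num, map_add, map_one]; norm_num
      simp only [map_mul, h5] at h4 ⊢
      linear_combination 2 * PowerSeries.C (c : ℂ) * PowerSeries.X * h2 - PowerSeries.C (c : ℂ) * h4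
    rw [e1, h3, Derivation.leibniz, smul_eq_mul, smul_eq_mul]
    linear_combination A z * (1 - PowerSeries.C z * PowerSeries.X) * hd w +
      A w * (1 - PowerSeries.C w * PowerSeries.X) * hd z
  have key : ∀ n, ∑ p ∈ HasAntidiagonal.antidiagonal n,
        ((rc c p.1 : ℂ) * z ^ p.1) * ((rc c p.2 : ℂ) * w ^ p.2) =
      PowerSeries.coeff n (A z * A w) := by
    intro n
    rw [PowerSeries.coeff_mul]
    simp [hA]
  rw [key]
  set F := A z * A w with hFdef
  have hrec : ∀ n : ℕ, ((n : ℂ) + 2) * PowerSeries.coeff (n + 2) F =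
      2 * (n + 1 + c) * u * PowerSeries.coeff (n + 1) F - (n + 2 * c) * PowerSeries.coeff n F := by
    intro n
    have hF' : PowerSeries.derivative ℂ F * (1 - PowerSeries.C (2 * u : ℂ) * PowerSeries.X +
        PowerSeries.X ^ 2) = PowerSeries.C (2 * c : ℂ) * (PowerSeries.C (u : ℂ) * F) -
        PowerSeries.C (2 * c : ℂ) * (PowerSeries.X * F) := by rw [hF]; ring
    have h := congrArg (PowerSeries.coeff (n + 1)) hF'
    rw [mul_add, mul_sub, mul_one, mul_left_comm, map_add, map_sub, PowerSeries.coeff_C_mul,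
      PowerSeries.coeff_succ_mul_X, map_sub, PowerSeries.coeff_C_mul, PowerSeries.coeff_C_mul,
      PowerSeries.coeff_C_mul, PowerSeries.coeff_succ_X_mul] at h
    cases n with
    | zero =>
      rw [PowerSeries.coeff_mul_X_pow'] at h
      simp only [PowerSeries.coeff_derivative] at h
      norm_num at h ⊢
      linear_combination h
    | succ n =>
      rw [show n + 1 + 1 = n + 2 from rfl, PowerSeries.coeff_mul_X_pow] at h
      simp only [PowerSeries.coeff_derivative] at h
      push_cast at h ⊢
      linear_combination h
  induction n using Nat.strong_induction_on with
  | _ n ih =>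
    match n with
    | 0 =>
      rw [← key]; simp
    | 1 =>
      rw [← key, geg_one]
      simp [rc_succ, Finset.Nat.antidiagonal_succ]
      linear_combination - c * hs
    | n + 2 =>
      have i1 := ih (n + 1) (by omega)
      have i0 := ih n (by omega)
      have h := hrec n
      have : (n : ℂ) + 2 ≠ 0 := by exact_mod_cast (n + 1).succ_ne_zero
      apply mul_left_cancel₀ this
      rw [h, ← i1, ← i0]
      exact_mod_cast geg_rec c n u

open Filter Topology in
lemma exists_bounds_of_tendsto_pos {f : ℕ → ℝ} {L : ℝ} (hL : 0 < L) (hf : Tendsto f atTop (𝓝 L))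
    (hpos : ∀ n, 0 < f n) : ∃ c C : ℝ, 0 < c ∧ 0 < C ∧ ∀ n, c ≤ f n ∧ f n ≤ C := by
  obtain ⟨C, hC⟩ := hf.bddAbove_range
  obtain ⟨D, hD⟩ := (hf.inv₀ hL.ne').bddAbove_range
  have hC' : ∀ n, f n ≤ C := fun n => hC ⟨n, rfl⟩
  have hD' : ∀ n, (f n)⁻¹ ≤ D := fun n => hD ⟨n, rfl⟩
  have hDpos : 0 < D := (inv_pos.2 (hpos 0)).trans_le (hD' 0)
  refine ⟨D⁻¹, C, inv_pos.2 hDpos, (hpos 0).trans_le (hC' 0), fun n => ⟨?_, hC' n⟩⟩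
  exact inv_le_of_inv_le₀ (hpos n) (hD' n)

open Filter Topology in
lemma rc_bounds {a : ℝ} (ha : 0 < a) : ∃ c C : ℝ, 0 < c ∧ 0 < C ∧
    ∀ n : ℕ, 1 ≤ n → c * (n : ℝ) ^ (a - 1) ≤ rc a n ∧ rc a n ≤ C * (n : ℝ) ^ (a - 1) := by
  have hprod : ∀ n : ℕ, 0 < ∏ j ∈ Finset.range n, (a + j) :=
    fun n => Finset.prod_pos fun j _ => by positivity
  have e : ∀ n : ℕ, 1 ≤ n → rc a n / (n : ℝ) ^ (a - 1) = (n / (a + n)) * (GammaSeq a n)⁻¹ := by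
    intro n hn
    have hn' : (0 : ℝ) < n := by exact_mod_cast hn
    have h1 := hprod n
    have h2 : (0 : ℝ) < n.factorial := by positivity
    unfold rc GammaSeq
    rw [Finset.prod_range_succ, Real.rpow_sub_one hn'.ne']
    have := Real.rpow_pos_of_pos hn' a
    have : (0 : ℝ) < a + n := by positivity
    field_simp
  have hlim : Tendsto (fun n : ℕ => ((n : ℝ) / (a + n)) * (GammaSeq a n)⁻¹) atTop
      (𝓝 (1 * (Gamma a)⁻¹)) := by
    refine Tendsto.mul ?_ ((GammaSeq_tendsto_Gamma a).inv₀ (Gamma_pos_of_pos ha).ne')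
    have := tendsto_natCast_div_add_atTop (𝕜 := ℝ) a
    simpa [add_comm] using this
  have hlim' : Tendsto (fun n : ℕ => rc a (n + 1) / ((n + 1 : ℕ) : ℝ) ^ (a - 1)) atTop
      (𝓝 (1 * (Gamma a)⁻¹)) := by
    refine ((tendsto_add_atTop_iff_nat 1).2 hlim).congr fun n => ?_
    rw [e (n + 1) (by omega)]
  obtain ⟨c, C, hc, hC, h⟩ := exists_bounds_of_tendsto_pos
    (by have := Gamma_pos_of_pos ha; positivity) hlim'
    (fun n => by have := rc_pos ha (n + 1); positivity)
  refine ⟨c, C, hc, hC, fun n hn => ?_⟩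
  obtain ⟨m, rfl⟩ : ∃ m, n = m + 1 := ⟨n - 1, by omega⟩
  have hp : (0 : ℝ) < ((m + 1 : ℕ) : ℝ) ^ (a - 1) := by positivity
  exact ⟨(le_div_iff₀ hp).1 (h m).1, (div_le_iff₀ hp).1 (h m).2⟩

open Complex in
/-- Powers of numbers in the right half plane are multiplicative. -/
lemma mul_cpow_of_re_pos {x y : ℂ} (hx : 0 < x.re) (hy : 0 < y.re) (c : ℂ) :
    (x * y) ^ c = x ^ c * y ^ c := by
  have hx0 : x ≠ 0 := fun h => by simp [h] at hx
  have hy0 : y ≠ 0 := fun h => by simp [h] at hy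
  have h1 := abs_lt.1 (abs_arg_lt_pi_div_two_iff.2 (Or.inl hx))
  have h2 := abs_lt.1 (abs_arg_lt_pi_div_two_iff.2 (Or.inl hy))
  rw [cpow_def_of_ne_zero (mul_ne_zero hx0 hy0), cpow_def_of_ne_zero hx0, cpow_def_of_ne_zero hy0,
    Complex.log_mul hx0 hy0 ⟨by linarith [h1.1, h2.1], by linarith [h1.2, h2.2]⟩, add_mul,
    Complex.exp_add]

open Complex in
lemma one_sub_re_pos {z : ℂ} (hz : ‖z‖ < 1) : 0 < (1 - z).re := by
  have := (abs_le.1 (abs_re_le_norm z)).2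
  simp; linarith

open Complex in
lemma exists_unit_pair {u : ℝ} (hu : u ∈ Set.Icc (-1 : ℝ) 1) : ∃ z w : ℂ, z * w = 1 ∧ z + w = 2 * u ∧
    ‖z‖ = 1 ∧ ‖w‖ = 1 := by
  refine ⟨exp (Real.arccos u * I), exp (-(Real.arccos u) * I), ?_, ?_, ?_, ?_⟩
  · rw [← Complex.exp_add]; simp
  · rw [← Complex.two_cos, ← Complex.ofReal_cos, Real.cos_arccos hu.1 hu.2]
  · exact norm_exp_ofReal_mul_I _
  · have := norm_exp_ofReal_mul_I (-(Real.arccos u)); simpa using this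

lemma gen_factor {u : ℝ} {z w : ℂ} (hzw : z * w = 1) (hs : z + w = 2 * u) (r : ℂ) :
    1 + r ^ 2 - 2 * r * u = (1 - z * r) * (1 - w * r) := by
  linear_combination (-r ^ 2) * hzw + r * hs

/-- The generating function of the Gegenbauer polynomials. -/
lemma hasSum_geg (c : ℝ) {u : ℝ} (hu : u ∈ Set.Icc (-1 : ℝ) 1) {r : ℂ} (hr : ‖r‖ < 1) :
    HasSum (fun n => (((geg c n).eval u : ℝ) : ℂ) * r ^ n) ((1 + r ^ 2 - 2 * r * u) ^ (-c : ℂ)) := by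
  obtain ⟨z, w, hzw, hs, hz, hw⟩ := exists_unit_pair hu
  have hzr : ‖z * r‖ < 1 := by rwa [norm_mul, hz, one_mul]
  have hwr : ‖w * r‖ < 1 := by rwa [norm_mul, hw, one_mul]
  rw [gen_factor hzw hs, mul_cpow_of_re_pos (one_sub_re_pos hzr) (one_sub_re_pos hwr),
    ← (hasSum_rc c hzr).tsum_eq, ← (hasSum_rc c hwr).tsum_eq,
    tsum_mul_tsum_eq_tsum_sum_antidiagonal_of_summable_norm (summable_norm_rc c hzr)
      (summable_norm_rc c hwr)]
  have e : (fun n => (((geg c n).eval u : ℝ) : ℂ) * r ^ n) = fun n => 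
      ∑ p ∈ HasAntidiagonal.antidiagonal n,
        (rc c p.1 : ℂ) * (z * r) ^ p.1 * ((rc c p.2 : ℂ) * (w * r) ^ p.2) := by
    funext n
    rw [geg_eval_eq_sum c u hzw hs, Finset.sum_mul]
    refine Finset.sum_congr rfl fun p hp => ?_
    rw [← HasAntidiagonal.mem_antidiagonal.1 hp, mul_pow, mul_pow, pow_add]; ring
  rw [e]
  exact (summable_norm_sum_mul_antidiagonal_of_summable_norm (summable_norm_rc c hzr)
      (summable_norm_rc c hwr)).of_norm.hasSum

/-- A uniform bound for Gegenbauer polynomials on `[-1, 1]`. -/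
noncomputable def gegBound (c : ℝ) (n : ℕ) : ℝ :=
  ∑ p ∈ HasAntidiagonal.antidiagonal n, |rc c p.1| * |rc c p.2|

lemma abs_geg_le (c : ℝ) {u : ℝ} (hu : u ∈ Set.Icc (-1 : ℝ) 1) (n : ℕ) :
    |(geg c n).eval u| ≤ gegBound c n := by
  obtain ⟨z, w, hzw, hs, hz, hw⟩ := exists_unit_pair hu
  rw [← Real.norm_eq_abs, ← Complex.norm_real, geg_eval_eq_sum c u hzw hs]
  refine (norm_sum_le _ _).trans (le_of_eq ?_)
  refine Finset.sum_congr rfl fun p _ => ?_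
  simp [hz, hw]

lemma summable_gegBound (c : ℝ) {ρ : ℝ} (h0 : 0 ≤ ρ) (h1 : ρ < 1) :
    Summable fun n => gegBound c n * ρ ^ n := by
  have hz : ‖(ρ : ℂ)‖ < 1 := by rwa [Complex.norm_real, Real.norm_of_nonneg h0]
  have h := summable_norm_rc c hz
  have h2 := (summable_norm_sum_mul_antidiagonal_of_summable_norm (f := fun n => ‖(rc c n : ℂ) * (ρ : ℂ) ^ n‖)
    (g := fun n => ‖(rc c n : ℂ) * (ρ : ℂ) ^ n‖) (by simpa using h) (by simpa using h)).of_norm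
  refine h2.congr fun n => ?_
  unfold gegBound
  rw [Finset.sum_mul]
  refine Finset.sum_congr rfl fun p hp => ?_
  rw [← HasAntidiagonal.mem_antidiagonal.1 hp]
  simp [abs_of_nonneg h0, pow_add]; ring

section
variable {X : Type*} [MeasurableSpace X] {μ : Measure X} [IsFiniteMeasure μ] {U : X → ℝ}

lemma integrable_geg_comp (hU : Measurable U) (hU1 : ∀ᵐ x ∂μ, U x ∈ Set.Icc (-1 : ℝ) 1)
    (c : ℝ) (n : ℕ) : Integrable (fun x => (geg c n).eval (U x)) μ := by
  refine Integrable.of_bound (C := gegBound c n) ?_ ?_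
  · exact ((geg c n).continuous.measurable.comp hU).aestronglyMeasurable
  · filter_upwards [hU1] with x hx using abs_geg_le c hx n

/-- Integrated generating function. -/
lemma hasSum_integral_geg (hU : Measurable U) (hU1 : ∀ᵐ x ∂μ, U x ∈ Set.Icc (-1 : ℝ) 1)
    (c : ℝ) {r : ℂ} (hr : ‖r‖ < 1) :
    HasSum (fun n => ((∫ x, (geg c n).eval (U x) ∂μ : ℝ) : ℂ) * r ^ n)
      (∫ x, (1 + r ^ 2 - 2 * r * (U x : ℂ)) ^ (-c : ℂ) ∂μ) := by
  have hm : ∀ n, AEStronglyMeasurable (fun x => (((geg c n).eval (U x) : ℝ) : ℂ) * r ^ n) μ := by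
    intro n
    have : Measurable fun x => (geg c n).eval (U x) := (geg c n).continuous.measurable.comp hU
    exact ((Complex.measurable_ofReal.comp this).mul_const _).aestronglyMeasurable
  have h := hasSum_integral_of_dominated_convergence (μ := μ)
    (F := fun n x => (((geg c n).eval (U x) : ℝ) : ℂ) * r ^ n)
    (f := fun x => (1 + r ^ 2 - 2 * r * (U x : ℂ)) ^ (-c : ℂ))
    (fun n _ => gegBound c n * ‖r‖ ^ n) hm ?_ ?_ ?_ ?_
  · simpa [MeasureTheory.integral_mul_const, integral_complex_ofReal] using h
  · intro n
    filter_upwards [hU1] with x hx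
    rw [norm_mul, norm_pow, Complex.norm_real]
    exact mul_le_mul_of_nonneg_right (abs_geg_le c hx n) (by positivity)
  · exact Filter.Eventually.of_forall fun _ => summable_gegBound c (norm_nonneg r) hr
  · exact integrable_const _
  · filter_upwards [hU1] with x hx using hasSum_geg c hx hr

end

open Complex in
/-- Fourier extraction of Taylor coefficients. -/
lemma integral_circleMap_coeff {b : ℕ → ℂ} {f : ℂ → ℂ} {R : ℝ} (hR : 0 ≤ R)
    (hs : Summable fun n => ‖b n‖ * R ^ n)
    (hf : ∀ z : ℂ, ‖z‖ = R → HasSum (fun n => b n * z ^ n) (f z)) (N : ℕ) :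
    ∫ α in (0 : ℝ)..2 * π, f (circleMap 0 R α) * exp (-(N * α * I)) = 2 * π * b N * R ^ N := by
  have h := intervalIntegral.hasSum_integral_of_dominated_convergence (μ := volume)
    (a := 0) (b := 2 * π)
    (F := fun n (α : ℝ) => b n * (circleMap 0 R α) ^ n * exp (-(N * α * I)))
    (f := fun α => f (circleMap 0 R α) * exp (-(N * α * I)))
    (fun n _ => ‖b n‖ * R ^ n) ?_ ?_ ?_ ?_ ?_
  · have e : ∀ n, ∫ α in (0 : ℝ)..2 * π, b n * (circleMap 0 R α) ^ n * exp (-(N * α * I)) =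
        if n = N then 2 * π * b N * R ^ N else 0 := by
      intro n
      have e1 : ∀ α : ℝ, b n * (circleMap 0 R α) ^ n * exp (-(N * α * I)) =
          (b n * R ^ n) * exp (((n : ℂ) - N) * I * α) := by
        intro α
        rw [circleMap, zero_add, mul_pow, ← Complex.exp_nat_mul]
        rw [show ((n : ℂ) - N) * I * α = n * (α * I) + -(N * α * I) by ring, Complex.exp_add]
        ring
      simp_rw [e1]
      rw [intervalIntegral.integral_const_mul]
      split_ifs with hn
      · subst hn; simp; ring
      · have h0 : ((n : ℂ) - N) * I ≠ 0 := by
          refine mul_ne_zero (sub_ne_zero.2 ?_) I_ne_zero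
          exact_mod_cast hn
        rw [integral_exp_mul_complex h0]
        have : exp (((n : ℂ) - N) * I * (2 * π : ℝ)) = 1 := by
          rw [Complex.exp_eq_one_iff]
          exact ⟨(n : ℤ) - N, by push_cast; ring⟩
        rw [this]; simp
    simp_rw [e] at h
    exact h.unique (hasSum_ite_eq N _)
  · intro n
    refine Continuous.aestronglyMeasurable ?_
    fun_prop
  · intro n
    refine Filter.Eventually.of_forall fun α _ => ?_
    rw [norm_mul, norm_mul, norm_pow, norm_circleMap_zero, abs_of_nonneg hR,
      show -((N : ℂ) * α * I) = ((-(N * α) : ℝ) : ℂ) * I by push_cast; ring, norm_exp_ofReal_mul_I,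
      mul_one]
  · exact Filter.Eventually.of_forall fun α _ => hs
  · simp
  · refine Filter.Eventually.of_forall fun α _ => ?_
    exact (hf _ (by simp [abs_of_nonneg hR])).mul_right _

/-- The unnormalized Cesàro kernel at an endpoint. -/
noncomputable def cesPoly (δ l : ℝ) (n : ℕ) : Polynomial ℝ :=
  ∑ k ∈ Finset.range (n + 1), Polynomial.C (rc δ (n - k)) * geg (l + 1) (2 * k)

lemma cesPoly_eval (δ l : ℝ) (n : ℕ) (u : ℝ) : (cesPoly δ l n).eval u =
    ∑ k ∈ Finset.range (n + 1), rc δ (n - k) * (geg (l + 1) (2 * k)).eval u := by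
  simp [cesPoly, Polynomial.eval_finsetSum]

/-- Coefficients of `(1 - r ^ 2) ^ (-δ)` in powers of `r`. -/
noncomputable def evenRc (δ : ℝ) (m : ℕ) : ℝ := if Even m then rc δ (m / 2) else 0

lemma hasSum_evenRc (δ : ℝ) {r : ℂ} (hr : ‖r‖ < 1) :
    HasSum (fun m => (evenRc δ m : ℂ) * r ^ m) ((1 - r ^ 2) ^ (-δ : ℂ)) := by
  have hr2 : ‖r ^ 2‖ < 1 := by rw [norm_pow]; exact pow_lt_one₀ (norm_nonneg _) hr (by norm_num)
  have h := hasSum_rc δ hr2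
  have hi : Function.Injective fun n : ℕ => 2 * n := fun a b h => by simpa using h
  rw [← hi.hasSum_iff]
  · convert h using 1
    funext n
    simp [evenRc, pow_mul]
  · intro m hm
    have : ¬ Even m := fun ⟨k, hk⟩ => hm ⟨k, by simp; omega⟩
    simp [evenRc, this]

lemma sum_antidiagonal_evenRc (δ : ℝ) (n : ℕ) (e : ℕ → ℝ) :
    ∑ p ∈ HasAntidiagonal.antidiagonal (2 * n), evenRc δ p.1 * e p.2 =
      ∑ k ∈ Finset.range (n + 1), rc δ (n - k) * e (2 * k) := by
  symm
  have h : ∀ k ∈ Finset.range (n + 1), rc δ (n - k) * e (2 * k) =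
      evenRc δ (2 * (n - k)) * e (2 * k) := by
    intro k _; simp [evenRc]
  rw [Finset.sum_congr rfl h]
  rw [← Finset.sum_image (s := Finset.range (n + 1)) (g := fun k => (2 * (n - k), 2 * k))
    (f := fun p : ℕ × ℕ => evenRc δ p.1 * e p.2) (by intro a _ b _ h; simp at h; omega)]
  refine Finset.sum_subset ?_ ?_
  · intro p hp
    obtain ⟨k, hk, rfl⟩ := Finset.mem_image.1 hp
    have := Finset.mem_range.1 hk
    rw [HasAntidiagonal.mem_antidiagonal]; dsimp only; omega
  · intro p hp hp'
    have hp2 := HasAntidiagonal.mem_antidiagonal.1 hp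
    have : ¬ Even p.1 := by
      rintro ⟨k, hk⟩
      refine hp' (Finset.mem_image.2 ⟨n - k, Finset.mem_range.2 (by omega), ?_⟩)
      ext <;> dsimp only <;> omega
    simp [evenRc, this]

section
variable {X : Type*} [MeasurableSpace X] {μ : Measure X} [IsFiniteMeasure μ] {U : X → ℝ}

/-- Cauchy's formula for integrated Cesàro kernels. -/
lemma integral_circle_cesPoly (hU : Measurable U) (hU1 : ∀ᵐ x ∂μ, U x ∈ Set.Icc (-1 : ℝ) 1)
    (δ l : ℝ) (n : ℕ) {R : ℝ} (hR0 : 0 ≤ R) (hR1 : R < 1) :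
    ∫ α in (0 : ℝ)..2 * π, ((1 - circleMap 0 R α ^ 2) ^ (-δ : ℂ) *
        ∫ x, (1 + circleMap 0 R α ^ 2 - 2 * circleMap 0 R α * (U x : ℂ)) ^ (-(l + 1 : ℝ) : ℂ) ∂μ) *
        Complex.exp (-((2 * n : ℕ) * α * Complex.I)) =
      2 * π * ((∫ x, (cesPoly δ l n).eval (U x) ∂μ : ℝ) : ℂ) * R ^ (2 * n) := by
  set e : ℕ → ℝ := fun N => ∫ x, (geg (l + 1) N).eval (U x) ∂μ with he
  have hsum : ∀ r : ℂ, ‖r‖ < 1 → Summable (fun N => ‖(∑ p ∈ HasAntidiagonal.antidiagonal N,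
      ((evenRc δ p.1 : ℂ) * r ^ p.1) * ((e p.2 : ℂ) * r ^ p.2))‖) := fun r hr =>
    summable_norm_sum_mul_antidiagonal_of_summable_norm
      (f := fun N => (evenRc δ N : ℂ) * r ^ N) (g := fun N => (e N : ℂ) * r ^ N)
      (hasSum_evenRc δ hr).summable.norm (hasSum_integral_geg hU hU1 (l + 1) hr).summable.norm
  have hterm : ∀ (r : ℂ) N, ∑ p ∈ HasAntidiagonal.antidiagonal N,
      ((evenRc δ p.1 : ℂ) * r ^ p.1) * ((e p.2 : ℂ) * r ^ p.2) =
      ((∑ p ∈ HasAntidiagonal.antidiagonal N, evenRc δ p.1 * e p.2 : ℝ) : ℂ) * r ^ N := by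
    intro r N
    push_cast
    rw [Finset.sum_mul]
    refine Finset.sum_congr rfl fun p hp => ?_
    rw [← HasAntidiagonal.mem_antidiagonal.1 hp, pow_add]; ring
  have h := integral_circleMap_coeff
    (b := fun N => ((∑ p ∈ HasAntidiagonal.antidiagonal N, evenRc δ p.1 * e p.2 : ℝ) : ℂ))
    (f := fun r => (1 - r ^ 2) ^ (-δ : ℂ) *
        ∫ x, (1 + r ^ 2 - 2 * r * (U x : ℂ)) ^ (-(l + 1 : ℝ) : ℂ) ∂μ) hR0 ?_ ?_ (2 * n)
  · rw [h, sum_antidiagonal_evenRc]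
    congr 4
    simp_rw [cesPoly_eval]
    rw [integral_finsetSum _ fun k _ => (integrable_geg_comp hU hU1 _ _).const_mul _]
    simp_rw [MeasureTheory.integral_const_mul]
    rfl
  · have hR : ‖(R : ℂ)‖ < 1 := by rwa [Complex.norm_real, Real.norm_of_nonneg hR0]
    refine (hsum R hR).congr fun N => ?_
    rw [hterm, norm_mul, norm_pow, Complex.norm_real R, Real.norm_of_nonneg hR0]
  · intro r hr
    have hr1 : ‖r‖ < 1 := hr ▸ hR1
    simp_rw [← hterm r]
    rw [← (hasSum_evenRc δ hr1).tsum_eq, ← (hasSum_integral_geg hU hU1 (l + 1) hr1).tsum_eq,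
      tsum_mul_tsum_eq_tsum_sum_antidiagonal_of_summable_norm (hasSum_evenRc δ hr1).summable.norm
      (hasSum_integral_geg hU hU1 (l + 1) hr1).summable.norm]
    exact (hsum r hr1).of_norm.hasSum

end

/-- The density `(1 - t ^ 2) ^ (κ - 1)` on `(-1, 1)`. -/
noncomputable def bmDens (κ : ℝ) : ℝ → ℝ :=
  Set.indicator (Set.Ioo (-1) 1) fun t => (1 - t ^ 2) ^ (κ - 1)

/-- The measure `(1 - t ^ 2) ^ (κ - 1) dt` on `[-1, 1]`, with its limiting case at `κ = 0`. -/
noncomputable def bm (κ : ℝ) : Measure ℝ :=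
  if κ = 0 then Measure.dirac 1 + Measure.dirac (-1)
  else if 0 < κ then volume.withDensity fun t => ENNReal.ofReal (bmDens κ t) else 0

lemma bmDens_nonneg (κ t : ℝ) : 0 ≤ bmDens κ t := by
  refine Set.indicator_nonneg (fun t ht => ?_) t
  exact rpow_nonneg (by nlinarith [ht.1, ht.2]) _

lemma measurable_bmDens (κ : ℝ) : Measurable (bmDens κ) :=
  Measurable.indicator (by fun_prop) measurableSet_Ioo

lemma bmDens_neg (κ t : ℝ) : bmDens κ (-t) = bmDens κ t := by
  unfold bmDens
  by_cases h : t ∈ Set.Ioo (-1 : ℝ) 1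
  · rw [Set.indicator_of_mem h, Set.indicator_of_mem (by constructor <;> linarith [h.1, h.2])]
    simp
  · rw [Set.indicator_of_notMem h, Set.indicator_of_notMem]
    intro h'; exact h (by constructor <;> linarith [h'.1, h'.2])

lemma bmDens_abs (κ t : ℝ) : bmDens κ |t| = bmDens κ t := by
  rcases abs_choice t with h | h <;> rw [h]
  exact bmDens_neg κ t

section
variable {E : Type*} [NormedAddCommGroup E] [NormedSpace ℝ E]

lemma integral_bm {κ : ℝ} (hκ : 0 < κ) (f : ℝ → E) :
    ∫ t, f t ∂bm κ = ∫ t, bmDens κ t • f t := by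
  rw [bm, if_neg hκ.ne', if_pos hκ, integral_withDensity_eq_integral_toReal_smul
    (measurable_bmDens κ).ennreal_ofReal (by simp)]
  simp [ENNReal.toReal_ofReal (bmDens_nonneg _ _)]

lemma integrable_bm_iff {κ : ℝ} (hκ : 0 < κ) (f : ℝ → E) :
    Integrable f (bm κ) ↔ Integrable fun t => bmDens κ t • f t := by
  rw [bm, if_neg hκ.ne', if_pos hκ, integrable_withDensity_iff_integrable_smul'
    (measurable_bmDens κ).ennreal_ofReal (by simp)]
  simp [ENNReal.toReal_ofReal (bmDens_nonneg _ _)]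

lemma integrable_bm_zero (f : ℝ → ℝ) : Integrable f (bm 0) := by
  rw [bm, if_pos rfl]
  exact Integrable.add_measure (integrable_dirac (by simp)) (integrable_dirac (by simp))

lemma integral_bm_zero (f : ℝ → ℝ) : ∫ t, f t ∂bm 0 = f 1 + f (-1) := by
  rw [bm, if_pos rfl, integral_add_measure (integrable_dirac (by simp)) (integrable_dirac (by simp))]
  simp
end

/-- Normalizing constant of the moments. -/
noncomputable def bmC (κ : ℝ) : ℝ := if κ = 0 then 2 else Gamma κ

lemma bmC_pos {κ : ℝ} (hκ : 0 ≤ κ) : 0 < bmC κ := by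
  unfold bmC
  split_ifs with h
  · norm_num
  · exact Gamma_pos_of_pos (lt_of_le_of_ne hκ (Ne.symm h))

lemma integrable_comp_abs {f : ℝ → ℝ} (hf : IntegrableOn f (Set.Ioi 0)) :
    Integrable fun x => f |x| := by
  have h : IntegrableOn (fun x => f |x|) (Set.Ioi 0) :=
    (integrableOn_congr_fun (fun x hx => by rw [abs_of_pos hx]) measurableSet_Ioi).2 hf
  have h2 : IntegrableOn (fun x ↦ f |x|) (Set.Iic 0) := by
    rw [← Measure.map_neg_eq_self (volume : Measure ℝ)]
    let m : MeasurableEmbedding fun x : ℝ => -x := (Homeomorph.neg ℝ).measurableEmbedding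
    rw [m.integrableOn_map_iff]
    simp_rw [Function.comp_def, abs_neg, Set.neg_preimage, Set.neg_Iic, neg_zero]
    exact Iff.mpr integrableOn_Ici_iff_integrableOn_Ioi h
  rw [← integrableOn_univ, ← Set.Iic_union_Ioi (a := (0 : ℝ))]
  exact h2.union h

lemma integrable_betaPDFReal {a b : ℝ} (ha : 0 < a) (hb : 0 < b) :
    Integrable (ProbabilityTheory.betaPDFReal a b) ∧ ∫ x, ProbabilityTheory.betaPDFReal a b x = 1 := by
  have h0 : ∀ x, 0 ≤ ProbabilityTheory.betaPDFReal a b x := by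
    intro x
    by_cases hx : 0 < x ∧ x < 1
    · exact (ProbabilityTheory.betaPDFReal_pos hx.1 hx.2 ha hb).le
    · simp [ProbabilityTheory.betaPDFReal, hx]
  have h1 := ProbabilityTheory.lintegral_betaPDF_eq_one ha hb
  refine ⟨⟨(ProbabilityTheory.stronglyMeasurable_betaPDFReal a b).aestronglyMeasurable, ?_⟩, ?_⟩
  · rw [hasFiniteIntegral_iff_ofReal (Filter.Eventually.of_forall h0)]
    exact lt_of_eq_of_lt h1 (by simp)
  · rw [integral_eq_lintegral_of_nonneg_ae (Filter.Eventually.of_forall h0)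
      (ProbabilityTheory.stronglyMeasurable_betaPDFReal a b).aestronglyMeasurable]
    exact (congrArg ENNReal.toReal h1).trans (by simp)

lemma bm_moment_aux {κ s : ℝ} (hκ : 0 < κ) (hs : 0 ≤ s) :
    Integrable (fun t => bmDens κ t * |t| ^ (2 * s)) ∧
      ∫ t, bmDens κ t * |t| ^ (2 * s) = Gamma κ * Gamma (s + 1 / 2) / Gamma (s + κ + 1 / 2) := by
  have ha : 0 < s + 1 / 2 := by linarith
  obtain ⟨hi, he⟩ := integrable_betaPDFReal ha hκ
  have hB := ProbabilityTheory.beta_pos ha hκ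
  set B := ProbabilityTheory.beta (s + 1 / 2) κ with hBdef
  set g := ProbabilityTheory.betaPDFReal (s + 1 / 2) κ with hg
  have hcong : ∀ x ∈ Set.Ioi (0 : ℝ), bmDens κ x * x ^ (2 * s) = B / 2 * ((|(2:ℝ)| * x ^ ((2:ℝ) - 1)) • g (x ^ (2:ℝ))) := by
    intro x hx
    have hx0 : 0 < x := hx
    rw [hg]; unfold ProbabilityTheory.betaPDFReal bmDens
    by_cases h1 : x < 1
    · have hx2 : x ^ 2 < 1 := by nlinarith
      rw [Set.indicator_of_mem (show x ∈ Set.Ioo (-1 : ℝ) 1 from ⟨by linarith, h1⟩), if_pos ⟨by positivity, by simpa using hx2⟩]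
      rw [← rpow_mul hx0.le, show 2 * (s + 1 / 2 - 1) = 2 * s - 1 by ring, ← hBdef, rpow_two,
        show 2 * s = (2 * s - 1) + 1 by ring, rpow_add hx0, smul_eq_mul]
      norm_num
      field_simp
    · have hx2 : ¬ x ^ 2 < 1 := by push Not at h1 ⊢; nlinarith
      rw [Set.indicator_of_notMem (fun h => h1 h.2), if_neg (fun h => hx2 (by simpa using h.2))]
      simp
  have hcong' : ∀ x : ℝ, bmDens κ x * |x| ^ (2 * s) = (fun y => bmDens κ y * y ^ (2 * s)) |x| := by
    intro x; simp only [bmDens_abs]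
  have hgI : IntegrableOn (fun x => bmDens κ x * x ^ (2 * s)) (Set.Ioi 0) := by
    rw [integrableOn_congr_fun hcong measurableSet_Ioi]
    exact ((integrableOn_Ioi_comp_rpow_iff g (p := 2) (by norm_num)).2 hi.integrableOn).const_mul _
  constructor
  · rw [funext hcong']
    exact integrable_comp_abs hgI
  · rw [funext hcong', integral_comp_abs (f := fun y => bmDens κ y * y ^ (2 * s)), setIntegral_congr_fun measurableSet_Ioi hcong,
      MeasureTheory.integral_const_mul, integral_comp_rpow_Ioi g (by norm_num)]
    have : ∫ y in Set.Ioi 0, g y = 1 := by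
      rw [← he]
      refine setIntegral_eq_integral_of_forall_compl_eq_zero fun x hx => ?_
      rw [hg]; unfold ProbabilityTheory.betaPDFReal
      exact if_neg fun h => hx h.1
    rw [this, hBdef, ProbabilityTheory.beta]
    rw [show s + 1 / 2 + κ = s + κ + 1 / 2 by ring]
    ring

lemma bm_moment {κ s : ℝ} (hκ : 0 ≤ κ) (hs : 0 ≤ s) :
    Integrable (fun t => |t| ^ (2 * s)) (bm κ) ∧
      ∫ t, |t| ^ (2 * s) ∂bm κ = bmC κ * Gamma (s + 1 / 2) / Gamma (s + κ + 1 / 2) := by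
  rcases hκ.eq_or_lt with rfl | h
  · refine ⟨integrable_bm_zero _, ?_⟩
    have : Gamma (s + 1 / 2) ≠ 0 := (Gamma_pos_of_pos (by linarith)).ne'
    rw [integral_bm_zero, bmC, if_pos rfl]
    simp only [add_zero]
    field_simp
    simp; norm_num
  · rw [integrable_bm_iff h, integral_bm h, bmC, if_neg h.ne']
    exact bm_moment_aux h hs

instance (κ : ℝ) : IsFiniteMeasure (bm κ) := by
  by_cases h : 0 ≤ κ
  · have := (bm_moment h le_rfl).1
    simp only [mul_zero, rpow_zero] at this
    exact (integrable_const_iff_isFiniteMeasure (by norm_num)).1 this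
  · push Not at h
    rw [bm, if_neg h.ne, if_neg (not_lt.2 h.le)]
    infer_instance

lemma bm_ae (κ : ℝ) : ∀ᵐ t ∂bm κ, t ∈ Set.Icc (-1 : ℝ) 1 := by
  unfold bm
  split_ifs with h1 h2
  · rw [ae_add_measure_iff]
    constructor <;> refine (ae_dirac_iff (measurableSet_Icc (a := (-1 : ℝ)) (b := 1))).2 ?_
    all_goals norm_num
  · rw [ae_withDensity_iff (measurable_bmDens κ).ennreal_ofReal]
    refine Filter.Eventually.of_forall fun t ht => ?_
    by_contra h
    apply ht
    rw [bmDens, Set.indicator_of_notMem fun h' => h (Set.Ioo_subset_Icc_self h')]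
    simp
  · simp

lemma integral_bm_neg (κ : ℝ) (f : ℝ → ℝ) : ∫ t, f (-t) ∂bm κ = ∫ t, f t ∂bm κ := by
  rcases lt_trichotomy κ 0 with h | rfl | h
  · rw [bm, if_neg h.ne, if_neg (not_lt.2 h.le)]; simp
  · rw [integral_bm_zero, integral_bm_zero, neg_neg, add_comm]
  · rw [integral_bm h, integral_bm h, ← integral_neg_eq_self]
    simp [bmDens_neg]

lemma bm_moment_nat {κ : ℝ} (hκ : 0 ≤ κ) (p : ℕ) :
    ∫ t, t ^ (2 * p) ∂bm κ = bmC κ * Gamma (p + 1 / 2) / Gamma (p + κ + 1 / 2) := by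
  rw [← (bm_moment hκ (Nat.cast_nonneg p)).2]
  congr 1; funext t
  rw [show 2 * (p : ℝ) = ((2 * p : ℕ) : ℝ) by push_cast; ring, rpow_natCast, Even.pow_abs (by simp)]

lemma bm_moment_odd {κ : ℝ} {p : ℕ} (hp : Odd p) : ∫ t, t ^ p ∂bm κ = 0 := by
  have := integral_bm_neg κ fun t => t ^ p
  simp only [hp.neg_pow, MeasureTheory.integral_neg] at this
  linarith

lemma differentiableOn_of_hasSum {b : ℕ → ℂ} {f : ℂ → ℂ}
    (h : ∀ r : ℂ, ‖r‖ < 1 → HasSum (fun n => b n * r ^ n) (f r)) :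
    DifferentiableOn ℂ f (Metric.ball 0 1) := by
  intro r hr
  rw [mem_ball_zero_iff] at hr
  obtain ⟨ρ, h1, h2⟩ := exists_between hr
  have h0 : 0 ≤ ρ := (norm_nonneg r).trans h1.le
  have hρ : ‖(ρ : ℂ)‖ < 1 := by rwa [Complex.norm_real, Real.norm_of_nonneg h0]
  have hd : DifferentiableOn ℂ (fun z : ℂ => ∑' n, b n * z ^ n) (Metric.ball 0 ρ) := by
    refine Complex.differentiableOn_tsum_of_summable_norm (u := fun n => ‖b n * (ρ : ℂ) ^ n‖)
      (h _ hρ).summable.norm (fun n => by fun_prop) Metric.isOpen_ball fun n w hw => ?_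
    rw [mem_ball_zero_iff] at hw
    rw [norm_mul, norm_mul, norm_pow, norm_pow, Complex.norm_real, Real.norm_of_nonneg h0]
    gcongr
  have hm : Metric.ball (0 : ℂ) ρ ∈ nhds r := Metric.isOpen_ball.mem_nhds (mem_ball_zero_iff.2 h1)
  refine ((hd.differentiableAt hm).congr_of_eventuallyEq ?_).differentiableWithinAt
  filter_upwards [hm] with z hz
  rw [mem_ball_zero_iff] at hz
  exact (h z (hz.trans h2)).tsum_eq.symm

lemma eq_of_eq_on_reals {f g : ℂ → ℂ} (hf : DifferentiableOn ℂ f (Metric.ball 0 1))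
    (hg : DifferentiableOn ℂ g (Metric.ball 0 1))
    (h : ∀ r : ℝ, |r| < 1 → f r = g r) {r : ℂ} (hr : ‖r‖ < 1) : f r = g r := by
  refine (hf.analyticOnNhd Metric.isOpen_ball).eqOn_of_preconnected_of_frequently_eq
    (hg.analyticOnNhd Metric.isOpen_ball) (convex_ball 0 1).isPreconnected
    (z₀ := 0) (by simp) ?_ (mem_ball_zero_iff.2 hr)
  have ht : Filter.Tendsto (fun x : ℝ => (x : ℂ)) (nhdsWithin 0 {0}ᶜ) (nhdsWithin 0 {0}ᶜ) := by
    refine tendsto_nhdsWithin_of_tendsto_nhds_of_eventually_within _ ?_ ?_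
    · exact (Complex.continuous_ofReal.tendsto' 0 0 (by simp)).mono_left nhdsWithin_le_nhds
    · filter_upwards [self_mem_nhdsWithin] with x hx
      simpa using hx
  refine ht.frequently (Filter.Eventually.frequently ?_)
  have : ∀ᶠ x : ℝ in nhds 0, |x| < 1 := by
    have := Metric.ball_mem_nhds (0 : ℝ) one_pos
    filter_upwards [this] with x hx
    simpa using hx
  filter_upwards [nhdsWithin_le_nhds this] with x hx using h x hx

/-- Euler's transformation, in real form. -/
lemma euler_real {k m A B : ℝ} (hk : 0 < k) (hAB : |B| < A) :
    ∫ t, (A - B * t) ^ (-(m + k + 1)) ∂bm k =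
      (A ^ 2 - B ^ 2) ^ (-(m + 1)) * ∫ t, (A - B * t) ^ (m + 1 - k) ∂bm k := by
  have hA : 0 < A := (abs_nonneg B).trans_lt hAB
  obtain ⟨g, rfl⟩ : ∃ g, B = A * g := ⟨B / A, by field_simp⟩
  rw [abs_mul, abs_of_pos hA, mul_lt_iff_lt_one_right hA] at hAB
  obtain ⟨hg1, hg2⟩ := abs_lt.1 hAB
  have hg : 0 < 1 - g ^ 2 := by nlinarith
  rw [integral_bm hk, integral_bm hk, ← MeasureTheory.integral_const_mul]
  have hS : MeasurableSet (Set.Ioo (-1 : ℝ) 1) := measurableSet_Ioo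
  have e1 : ∀ f : ℝ → ℝ, ∫ t, bmDens k t • f t = ∫ t in Set.Ioo (-1 : ℝ) 1, (1 - t ^ 2) ^ (k - 1) * f t := by
    intro f
    rw [← MeasureTheory.integral_indicator hS]
    congr 1; funext t
    unfold bmDens
    by_cases h : t ∈ Set.Ioo (-1 : ℝ) 1 <;> simp [h]
  have e2 : ∀ f : ℝ → ℝ, (∫ t, (A ^ 2 - (A * g) ^ 2) ^ (-(m + 1)) * (bmDens k t • f t)) =
      ∫ t in Set.Ioo (-1 : ℝ) 1, (A ^ 2 - (A * g) ^ 2) ^ (-(m + 1)) * ((1 - t ^ 2) ^ (k - 1) * f t) := by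
    intro f
    rw [← MeasureTheory.integral_indicator hS]
    congr 1; funext t
    unfold bmDens
    by_cases h : t ∈ Set.Ioo (-1 : ℝ) 1 <;> simp [h]
  rw [e1, e2]
  have hpos : ∀ t ∈ Set.Ioo (-1 : ℝ) 1, 0 < 1 - g * t := by
    intro t ht
    have : |g * t| < 1 := by
      rw [abs_mul]
      have := abs_lt.2 ht
      nlinarith [abs_nonneg g, abs_nonneg t]
    linarith [(abs_lt.1 this).2]
  set φ : ℝ → ℝ := fun t => (g - t) / (1 - g * t) with hφ
  have hmaps : ∀ t ∈ Set.Ioo (-1 : ℝ) 1, φ t ∈ Set.Ioo (-1 : ℝ) 1 := by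
    intro t ht
    have h := hpos t ht
    constructor
    · rw [hφ]; simp only; rw [lt_div_iff₀ h]; nlinarith [ht.1, ht.2]
    · rw [hφ]; simp only; rw [div_lt_iff₀ h]; nlinarith [ht.1, ht.2]
  have hinv : ∀ t ∈ Set.Ioo (-1 : ℝ) 1, φ (φ t) = t := by
    intro t ht
    have h := (hpos t ht).ne'
    have h2 := (hpos _ (hmaps t ht)).ne'
    simp only [hφ] at h2 ⊢
    rw [div_eq_iff h2]
    field_simp
    ring
  have himg : φ '' Set.Ioo (-1 : ℝ) 1 = Set.Ioo (-1 : ℝ) 1 := by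
    refine Set.Subset.antisymm (Set.image_subset_iff.2 hmaps) fun t ht => ⟨φ t, hmaps t ht, hinv t ht⟩
  have hder : ∀ t ∈ Set.Ioo (-1 : ℝ) 1, HasDerivWithinAt φ (-(1 - g ^ 2) / (1 - g * t) ^ 2) (Set.Ioo (-1 : ℝ) 1) t := by
    intro t ht
    have h := (hpos t ht).ne'
    have h1 : HasDerivAt (fun t : ℝ => g - t) (-1) t := by simpa using (hasDerivAt_id t).const_sub g
    have h2 : HasDerivAt (fun t : ℝ => 1 - g * t) (-g) t := by
      simpa using ((hasDerivAt_id t).const_mul g).const_sub 1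
    refine ((h1.div h2 h).congr_deriv ?_).hasDerivWithinAt
    ring
  have hinj : Set.InjOn φ (Set.Ioo (-1 : ℝ) 1) := by
    intro a ha b hb hab
    rw [← hinv a ha, ← hinv b hb, hab]
  have := integral_image_eq_integral_abs_deriv_smul hS hder hinj
    fun t => (1 - t ^ 2) ^ (k - 1) * (A - A * g * t) ^ (-(m + k + 1))
  rw [himg] at this
  rw [this]
  refine setIntegral_congr_fun hS fun t ht => ?_
  have h := hpos t ht
  have ht2 : 0 < 1 - t ^ 2 := by nlinarith [ht.1, ht.2]
  simp only [smul_eq_mul]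
  have a1 : 1 - φ t ^ 2 = (1 - g ^ 2) * (1 - t ^ 2) / (1 - g * t) ^ 2 := by
    rw [hφ]; simp only; field_simp; ring
  have a2 : A - A * g * φ t = A * (1 - g ^ 2) / (1 - g * t) := by
    rw [hφ]; simp only; field_simp; ring
  have a3 : A ^ 2 - (A * g) ^ 2 = A ^ 2 * (1 - g ^ 2) := by ring
  have a4 : A - A * g * t = A * (1 - g * t) := by ring
  rw [a1, a2, a3, a4, abs_div, abs_neg, abs_of_pos hg, abs_of_pos (by positivity : 0 < (1 - g * t) ^ 2)]
  rw [← rpow_natCast (1 - g * t) 2, ← rpow_natCast A 2]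
  rw [div_rpow (by positivity) (by positivity), div_rpow (by positivity) (by positivity),
    mul_rpow hg.le ht2.le, mul_rpow hA.le hg.le, mul_rpow (by positivity) hg.le, mul_rpow hA.le h.le,
    ← rpow_mul h.le, ← rpow_mul hA.le]
  have b1 : (1 - g ^ 2) ^ (-(m + 1)) = (1 - g ^ 2) * (1 - g ^ 2) ^ (k - 1) * (1 - g ^ 2) ^ (-(m + k + 1)) := by
    rw [← rpow_one_add' hg.le (by linarith), ← rpow_add hg]; congr 1; ring
  have b2 : (1 - g * t) ^ (m + 1 - k) = ((1 - g * t) ^ ((2 : ℕ) : ℝ))⁻¹ * ((1 - g * t) ^ (((2 : ℕ) : ℝ) * (k - 1)))⁻¹ *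
      ((1 - g * t) ^ (-(m + k + 1)))⁻¹ := by
    rw [← rpow_neg h.le, ← rpow_neg h.le, ← rpow_neg h.le, ← rpow_add h, ← rpow_add h]; congr 1; push_cast; ring
  have b3 : A ^ (-(m + k + 1)) = A ^ (((2 : ℕ) : ℝ) * (-(m + 1))) * A ^ (m + 1 - k) := by
    rw [← rpow_add hA]; congr 1; push_cast; ring
  rw [b1, b2, b3]
  field_simp

lemma gen_ne_zero {u : ℝ} (hu : u ∈ Set.Icc (-1 : ℝ) 1) {r : ℂ} (hr : ‖r‖ < 1) :
    1 + r ^ 2 - 2 * r * (u : ℂ) ≠ 0 := by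
  obtain ⟨z, w, hzw, hs, hz, hw⟩ := exists_unit_pair hu
  have h1 := one_sub_re_pos (z := z * r) (by rwa [norm_mul, hz, one_mul])
  have h2 := one_sub_re_pos (z := w * r) (by rwa [norm_mul, hw, one_mul])
  rw [gen_factor hzw hs]
  refine mul_ne_zero ?_ ?_
  · intro h; rw [h] at h1; simp at h1
  · intro h; rw [h] at h2; simp at h2

lemma mem_Icc_of_abs_add_le {a b t : ℝ} (h : |a| + |b| ≤ 1) (ht : t ∈ Set.Icc (-1 : ℝ) 1) :
    a * t + b ∈ Set.Icc (-1 : ℝ) 1 := by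
  rw [Set.mem_Icc, ← abs_le] at ht ⊢
  calc |a * t + b| ≤ |a| * |t| + |b| := by rw [← abs_mul]; exact abs_add_le _ _
    _ ≤ |a| * 1 + |b| := by gcongr
    _ ≤ 1 := by linarith

lemma cpow_ofReal_gen {u r : ℝ} (hu : u ∈ Set.Icc (-1 : ℝ) 1) (c : ℝ) :
    (1 + (r : ℂ) ^ 2 - 2 * r * (u : ℂ)) ^ (c : ℂ) = ((1 + r ^ 2 - 2 * r * u) ^ c : ℝ) := by
  have : 0 ≤ 1 + r ^ 2 - 2 * r * u := by
    nlinarith [sq_nonneg (r - u), hu.1, hu.2]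
  rw [Complex.ofReal_cpow this]
  push_cast; rfl

lemma euler_complex {k m a b : ℝ} (hk : 0 < k) (hab : |a| + |b| ≤ 1) {r : ℂ} (hr : ‖r‖ < 1) :
    ∫ t, (1 + r ^ 2 - 2 * r * ((a * t + b : ℝ) : ℂ)) ^ (-(m + k + 1 : ℝ) : ℂ) ∂bm k =
      (1 + r ^ 2 - 2 * r * ((a + b : ℝ) : ℂ)) ^ (-(m + 1 : ℝ) : ℂ) *
      (1 + r ^ 2 - 2 * r * ((-a + b : ℝ) : ℂ)) ^ (-(m + 1 : ℝ) : ℂ) *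
      ∫ t, (1 + r ^ 2 - 2 * r * ((a * t + b : ℝ) : ℂ)) ^ (-(-(m + 1 - k) : ℝ) : ℂ) ∂bm k := by
  have hU : Measurable fun t : ℝ => a * t + b := by fun_prop
  have hU1 : ∀ᵐ t ∂bm k, a * t + b ∈ Set.Icc (-1 : ℝ) 1 := by
    filter_upwards [bm_ae k] with t ht using mem_Icc_of_abs_add_le hab ht
  have hp : a + b ∈ Set.Icc (-1 : ℝ) 1 := by
    simpa using mem_Icc_of_abs_add_le hab (t := 1) (by simp)
  have hm : -a + b ∈ Set.Icc (-1 : ℝ) 1 := by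
    simpa using mem_Icc_of_abs_add_le hab (t := -1) (by simp)
  have h0 := differentiableOn_of_hasSum fun r hr => hasSum_integral_geg hU hU1 (m + k + 1) (r := r) hr
  have h1 := differentiableOn_of_hasSum fun r hr => hasSum_geg (m + 1) hp (r := r) hr
  have h2 := differentiableOn_of_hasSum fun r hr => hasSum_geg (m + 1) hm (r := r) hr
  have h3 := differentiableOn_of_hasSum fun r hr => hasSum_integral_geg hU hU1 (-(m + 1 - k)) (r := r) hr
  refine eq_of_eq_on_reals (f := fun r => ∫ t, (1 + r ^ 2 - 2 * r * ((a * t + b : ℝ) : ℂ)) ^ (-(m + k + 1 : ℝ) : ℂ) ∂bm k)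
    (g := fun r => (1 + r ^ 2 - 2 * r * ((a + b : ℝ) : ℂ)) ^ (-(m + 1 : ℝ) : ℂ) *
      (1 + r ^ 2 - 2 * r * ((-a + b : ℝ) : ℂ)) ^ (-(m + 1 : ℝ) : ℂ) *
      ∫ t, (1 + r ^ 2 - 2 * r * ((a * t + b : ℝ) : ℂ)) ^ (-(-(m + 1 - k) : ℝ) : ℂ) ∂bm k)
    h0 ((h1.mul h2).mul h3) ?_ hr
  intro r hr
  have hAB : |2 * r * a| < 1 + r ^ 2 - 2 * r * b := by
    rw [abs_mul, abs_mul, abs_two]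
    have : r * b ≤ |r| * |b| := by rw [← abs_mul]; exact le_abs_self _
    have : r ^ 2 = |r| ^ 2 := (sq_abs r).symm
    nlinarith [abs_nonneg r, abs_nonneg a, abs_nonneg b, mul_le_mul_of_nonneg_left hab (abs_nonneg r)]
  have e := euler_real (m := m) hk hAB
  have c1 : ∀ c : ℝ, ∫ t, (1 + (r : ℂ) ^ 2 - 2 * r * ((a * t + b : ℝ) : ℂ)) ^ (-c : ℂ) ∂bm k =
      ((∫ t, (1 + r ^ 2 - 2 * r * b - 2 * r * a * t) ^ (-c) ∂bm k : ℝ) : ℂ) := by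
    intro c
    rw [← integral_complex_ofReal]
    refine integral_congr_ae ?_
    filter_upwards [hU1] with t ht
    rw [← Complex.ofReal_neg, cpow_ofReal_gen ht]
    rw [show 1 + r ^ 2 - 2 * r * (a * t + b) = 1 + r ^ 2 - 2 * r * b - 2 * r * a * t by ring]
  rw [c1, c1, ← Complex.ofReal_neg, cpow_ofReal_gen hp, cpow_ofReal_gen hm, e, neg_neg,
    ← Complex.ofReal_mul, ← Complex.ofReal_mul]
  have q : ∀ u ∈ Set.Icc (-1 : ℝ) 1, 0 ≤ 1 + r ^ 2 - 2 * r * u := by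
    intro u hu
    nlinarith [sq_nonneg (r - u), hu.1, hu.2]
  rw [← mul_rpow (q _ hp) (q _ hm)]
  congr 3; ring

lemma norm_cpow_ofReal {z : ℂ} (hz : z ≠ 0) (c : ℝ) : ‖z ^ (c : ℂ)‖ = ‖z‖ ^ c := by
  rw [Complex.norm_cpow_of_ne_zero hz]; simp

lemma rpow_min_max_bound {x y M k m w : ℝ} (hx : 0 < x) (hy : 0 < y) (hk : 0 < k)
    (hw : 0 ≤ w) (hM : M = max x y) (hwM : w ≤ M) :
    w ^ k * (x ^ (-(m + 1)) * y ^ (-(m + 1)) * M ^ (m + 1 - k)) ≤ x ^ (-(m + 1)) + y ^ (-(m + 1)) := by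
  have hM0 : 0 < M := hM ▸ lt_max_of_lt_left hx
  have h1 : w ^ k ≤ M ^ k := rpow_le_rpow hw hwM hk.le
  have h2 : M ^ k * M ^ (m + 1 - k) * M ^ (-(m + 1)) = 1 := by
    rw [← rpow_add hM0, ← rpow_add hM0]; ring_nf; simp
  have hx' := rpow_pos_of_pos hx (-(m + 1))
  have hy' := rpow_pos_of_pos hy (-(m + 1))
  have h3 := rpow_pos_of_pos hM0 (m + 1 - k)
  have h4 : w ^ k * (x ^ (-(m + 1)) * y ^ (-(m + 1)) * M ^ (m + 1 - k)) ≤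
      M ^ k * (x ^ (-(m + 1)) * y ^ (-(m + 1)) * M ^ (m + 1 - k)) := by gcongr
  refine h4.trans ?_
  rcases le_total x y with h | h
  · rw [max_eq_right h] at hM
    subst hM
    nlinarith
  · rw [max_eq_left h] at hM
    subst hM
    nlinarith

lemma norm_euler_le {k m a b : ℝ} (hk : 0 < k) (hkm : k ≤ m + 1)
    (hab : |a| + |b| ≤ 1) {r : ℂ} (hr : ‖r‖ < 1) (hr2 : 1 / 2 ≤ ‖r‖) :
    |a| ^ k * ‖∫ t, (1 + r ^ 2 - 2 * r * ((a * t + b : ℝ) : ℂ)) ^ (-(m + k + 1 : ℝ) : ℂ) ∂bm k‖ ≤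
      (bm k).real Set.univ * (‖1 + r ^ 2 - 2 * r * ((a + b : ℝ) : ℂ)‖ ^ (-(m + 1)) +
        ‖1 + r ^ 2 - 2 * r * ((-a + b : ℝ) : ℂ)‖ ^ (-(m + 1))) := by
  have hp : a + b ∈ Set.Icc (-1 : ℝ) 1 := by
    simpa using mem_Icc_of_abs_add_le hab (t := 1) (by simp)
  have hm' : -a + b ∈ Set.Icc (-1 : ℝ) 1 := by
    simpa using mem_Icc_of_abs_add_le hab (t := -1) (by simp)
  rw [euler_complex hk hab hr]
  set P := 1 + r ^ 2 - 2 * r * ((a + b : ℝ) : ℂ) with hP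
  set Q := 1 + r ^ 2 - 2 * r * ((-a + b : ℝ) : ℂ) with hQ
  have hP0 : P ≠ 0 := gen_ne_zero hp hr
  have hQ0 : Q ≠ 0 := gen_ne_zero hm' hr
  set M := max ‖P‖ ‖Q‖ with hM
  have hintg : ‖∫ t, (1 + r ^ 2 - 2 * r * ((a * t + b : ℝ) : ℂ)) ^ (-(-(m + 1 - k) : ℝ) : ℂ) ∂bm k‖ ≤
      M ^ (m + 1 - k) * (bm k).real Set.univ := by
    refine norm_integral_le_of_norm_le_const ?_
    filter_upwards [bm_ae k] with t ht
    rw [← Complex.ofReal_neg, neg_neg, norm_cpow_ofReal (gen_ne_zero (mem_Icc_of_abs_add_le hab ht) hr)]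
    refine rpow_le_rpow (norm_nonneg _) ?_ (by linarith)
    have : 1 + r ^ 2 - 2 * r * ((a * t + b : ℝ) : ℂ) =
        (((1 + t) / 2 : ℝ) : ℂ) * P + (((1 - t) / 2 : ℝ) : ℂ) * Q := by
      rw [hP, hQ]; push_cast; ring
    rw [this]
    refine (norm_add_le _ _).trans ?_
    rw [norm_mul, norm_mul, Complex.norm_real, Complex.norm_real,
      Real.norm_of_nonneg (by linarith [ht.1]), Real.norm_of_nonneg (by linarith [ht.2])]
    have h1 := le_max_left ‖P‖ ‖Q‖
    have h2 := le_max_right ‖P‖ ‖Q‖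
    nlinarith [ht.1, ht.2]
  have ha : |a| ≤ M := by
    have h1 := le_max_left ‖P‖ ‖Q‖
    have h2 := le_max_right ‖P‖ ‖Q‖
    have h3 : ‖Q - P‖ = 4 * ‖r‖ * |a| := by
      rw [show Q - P = 4 * r * (a : ℂ) by rw [hP, hQ]; push_cast; ring]
      simp
    have h4 := norm_sub_le Q P
    rw [h3] at h4
    nlinarith [abs_nonneg a]
  rw [norm_mul, norm_mul, ← Complex.ofReal_neg, norm_cpow_ofReal hP0, norm_cpow_ofReal hQ0]
  have key := rpow_min_max_bound (m := m) (norm_pos_iff.2 hP0) (norm_pos_iff.2 hQ0) hk (abs_nonneg a) hM ha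
  calc _ ≤ |a| ^ k * (‖P‖ ^ (-(m + 1)) * ‖Q‖ ^ (-(m + 1)) * (M ^ (m + 1 - k) * (bm k).real Set.univ)) := by gcongr
    _ = (bm k).real Set.univ * (|a| ^ k * (‖P‖ ^ (-(m + 1)) * ‖Q‖ ^ (-(m + 1)) * M ^ (m + 1 - k))) := by ring
    _ ≤ _ := by gcongr

/-- The majorant of the Cesàro kernels. -/
noncomputable def majB (δ m R u : ℝ) : ℝ := ∫ α in (0 : ℝ)..2 * π,
  ‖1 - circleMap 0 R α ^ 2‖ ^ (-δ) * ‖1 + circleMap 0 R α ^ 2 - 2 * circleMap 0 R α * (u : ℂ)‖ ^ (-(m + 1))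

lemma one_sub_sq_ne_zero {r : ℂ} (hr : ‖r‖ < 1) : 1 - r ^ 2 ≠ 0 := by
  intro h
  have : r ^ 2 = 1 := by linear_combination -h
  have h2 : ‖r‖ ^ 2 = 1 := by rw [← norm_pow, this, norm_one]
  nlinarith [norm_nonneg r]

lemma continuousOn_majB_integrand (δ m : ℝ) {R : ℝ} (hR0 : 0 ≤ R) (hR1 : R < 1) :
    ContinuousOn (fun p : ℝ × ℝ => ‖1 - circleMap 0 R p.2 ^ 2‖ ^ (-δ) *
      ‖1 + circleMap 0 R p.2 ^ 2 - 2 * circleMap 0 R p.2 * (p.1 : ℂ)‖ ^ (-(m + 1)))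
      (Set.Icc (-1) 1 ×ˢ Set.univ) := by
  have hc : ∀ α, ‖circleMap 0 R α‖ < 1 := fun α => by simpa [abs_of_nonneg hR0] using hR1
  refine ContinuousOn.mul ?_ ?_
  · refine ContinuousOn.rpow_const (Continuous.continuousOn (by fun_prop)) fun p hp => Or.inl ?_
    exact norm_ne_zero_iff.2 (one_sub_sq_ne_zero (hc _))
  · refine ContinuousOn.rpow_const (Continuous.continuousOn (by fun_prop)) fun p hp => Or.inl ?_
    exact norm_ne_zero_iff.2 (gen_ne_zero hp.1 (hc _))

lemma continuous_majB_integrand_right (δ m : ℝ) {R u : ℝ} (hR0 : 0 ≤ R) (hR1 : R < 1)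
    (hu : u ∈ Set.Icc (-1 : ℝ) 1) :
    Continuous (fun α : ℝ => ‖1 - circleMap 0 R α ^ 2‖ ^ (-δ) *
      ‖1 + circleMap 0 R α ^ 2 - 2 * circleMap 0 R α * (u : ℂ)‖ ^ (-(m + 1))) := by
  have := (continuousOn_majB_integrand δ m hR0 hR1).comp (f := fun α : ℝ => (u, α)) (s := Set.univ)
    (by fun_prop) (fun α _ => ⟨hu, Set.mem_univ _⟩)
  exact continuousOn_univ.1 this

lemma majB_nonneg (δ m R u : ℝ) : 0 ≤ majB δ m R u :=
  intervalIntegral.integral_nonneg (by positivity) fun _ _ => by positivity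

lemma abs_integral_cesPoly_le {k m a b : ℝ} (hk : 0 < k) (hkm : k ≤ m + 1)
    (hab : |a| + |b| ≤ 1) (δ : ℝ) (n : ℕ) {R : ℝ} (hR0 : 1 / 2 ≤ R) (hR1 : R < 1) :
    2 * π * R ^ (2 * n) * (|a| ^ k * |∫ t, (cesPoly δ (m + k) n).eval (a * t + b) ∂bm k|) ≤
      (bm k).real Set.univ * (majB δ m R (a + b) + majB δ m R (-a + b)) := by
  have hU : Measurable fun t : ℝ => a * t + b := by fun_prop
  have hU1 : ∀ᵐ t ∂bm k, a * t + b ∈ Set.Icc (-1 : ℝ) 1 := by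
    filter_upwards [bm_ae k] with t ht using mem_Icc_of_abs_add_le hab ht
  have hp : a + b ∈ Set.Icc (-1 : ℝ) 1 := by
    simpa using mem_Icc_of_abs_add_le hab (t := 1) (by simp)
  have hm' : -a + b ∈ Set.Icc (-1 : ℝ) 1 := by
    simpa using mem_Icc_of_abs_add_le hab (t := -1) (by simp)
  have hR : 0 ≤ R := by linarith
  have hc : ∀ α, ‖circleMap 0 R α‖ = R := fun α => by simp [abs_of_nonneg hR]
  have h := congrArg (fun z => |a| ^ k * ‖z‖) (integral_circle_cesPoly hU hU1 δ (m + k) n hR hR1)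
  simp only [norm_mul, norm_pow, Complex.norm_real, Real.norm_of_nonneg hR, Complex.norm_ofNat,
    Real.norm_of_nonneg pi_pos.le, Real.norm_eq_abs (∫ t, _ ∂bm k)] at h
  rw [show 2 * π * R ^ (2 * n) * (|a| ^ k * |∫ t, (cesPoly δ (m + k) n).eval (a * t + b) ∂bm k|) =
    |a| ^ k * (2 * π * |∫ t, (cesPoly δ (m + k) n).eval (a * t + b) ∂bm k| * R ^ (2 * n)) by ring, ← h]
  have hak : 0 ≤ |a| ^ k := by positivity
  rw [← abs_of_nonneg hak, ← Real.norm_eq_abs (|a| ^ k), ← Complex.norm_real, ← norm_mul,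
    ← intervalIntegral.integral_const_mul]
  have hi1 := (continuous_majB_integrand_right δ m hR hR1 hp).intervalIntegrable (μ := volume) 0 (2 * π)
  have hi2 := (continuous_majB_integrand_right δ m hR hR1 hm').intervalIntegrable (μ := volume) 0 (2 * π)
  have hintg := (hi1.add hi2).const_mul ((bm k).real Set.univ)
  refine (intervalIntegral.norm_integral_le_of_norm_le (by positivity) ?_ hintg).trans (le_of_eq ?_)
  · refine Filter.Eventually.of_forall fun α _ => ?_
    have h1 : ‖circleMap 0 R α‖ < 1 := by rw [hc]; exact hR1
    have h2 := norm_euler_le hk hkm hab h1 (by rw [hc]; exact hR0)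
    rw [norm_mul, norm_mul, norm_mul,
      show -(((2 * n : ℕ) : ℂ) * α * Complex.I) = ((-((2 * n : ℕ) * α) : ℝ) : ℂ) * Complex.I by push_cast; ring,
      Complex.norm_exp_ofReal_mul_I, ← Complex.ofReal_neg, norm_cpow_ofReal (one_sub_sq_ne_zero h1),
      Complex.norm_real, Real.norm_of_nonneg hak]
    have h3 : 0 ≤ ‖1 - circleMap 0 R α ^ 2‖ ^ (-δ) := by positivity
    calc _ = ‖1 - circleMap 0 R α ^ 2‖ ^ (-δ) * (|a| ^ k * ‖∫ t, (1 + circleMap 0 R α ^ 2 -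
        2 * circleMap 0 R α * ((a * t + b : ℝ) : ℂ)) ^ (-(m + k + 1 : ℝ) : ℂ) ∂bm k‖) := by ring
      _ ≤ _ := mul_le_mul_of_nonneg_left h2 h3
      _ = _ := by ring
  · rw [intervalIntegral.integral_const_mul, intervalIntegral.integral_add hi1 hi2]
    rfl

lemma norm_one_sub_circleMap_sq (R α : ℝ) :
    ‖1 - circleMap 0 R α‖ ^ 2 = (1 - R) ^ 2 + 4 * R * Real.sin (α / 2) ^ 2 := by
  have h : circleMap 0 R α = ((R * Real.cos α : ℝ) : ℂ) + ((R * Real.sin α : ℝ) : ℂ) * Complex.I := by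
    rw [circleMap, zero_add, Complex.exp_mul_I, ← Complex.ofReal_cos, ← Complex.ofReal_sin]
    push_cast; ring
  rw [← Complex.normSq_eq_norm_sq, Complex.normSq_apply, h]
  simp [Complex.cos_ofReal_re, Complex.sin_ofReal_re]
  have h1 := Real.sin_sq_add_cos_sq α
  have h2 : Real.cos α = 1 - 2 * Real.sin (α / 2) ^ 2 := by
    have := Real.cos_two_mul (α / 2)
    rw [show 2 * (α / 2) = α by ring] at this
    have h3 := Real.sin_sq_add_cos_sq (α / 2)
    linarith
  linear_combination R ^ 2 * h1 - 2 * R * h2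

lemma one_sub_le_norm_one_sub_circleMap {R : ℝ} (hR0 : 0 ≤ R) (α : ℝ) :
    1 - R ≤ ‖1 - circleMap 0 R α‖ := by
  have := norm_sub_norm_le (1 : ℂ) (circleMap 0 R α)
  simpa [abs_of_nonneg hR0] using this

lemma norm_one_sub_circleMap_le {R : ℝ} (hR0 : 0 ≤ R) (hR1 : R < 1) (α : ℝ) :
    ‖1 - circleMap 0 R α‖ ≤ 2 := by
  have := norm_sub_le (1 : ℂ) (circleMap 0 R α)
  simp [abs_of_nonneg hR0] at this
  linarith

lemma norm_one_sub_circleMap_pos {R : ℝ} (hR0 : 0 ≤ R) (hR1 : R < 1) (α : ℝ) :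
    0 < ‖1 - circleMap 0 R α‖ :=
  (sub_pos.2 hR1).trans_le (one_sub_le_norm_one_sub_circleMap hR0 α)

lemma norm_one_sub_circleMap_ge {R α : ℝ} (hR0 : 1 / 4 ≤ R) (hR1 : R < 1) (hα : |α| ≤ π) :
    (1 - R + |α|) / (2 * π) ≤ ‖1 - circleMap 0 R α‖ := by
  have hp := pi_gt_three
  refine le_of_sq_le_sq ?_ (norm_nonneg _) |> fun h => h
  rw [norm_one_sub_circleMap_sq]
  have h1 : (|α| / π) ^ 2 ≤ Real.sin (α / 2) ^ 2 := by
    rw [← sq_abs (Real.sin (α / 2)), ]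
    have h2 := Real.mul_abs_le_abs_sin (x := α / 2) (by rw [abs_div, abs_two]; linarith)
    rw [abs_div, abs_two] at h2
    have : |α| / π = 2 / π * (|α| / 2) := by field_simp
    rw [this]
    gcongr
  rw [div_pow] at h1 ⊢
  rw [div_le_iff₀ (by positivity)]
  rw [div_le_iff₀ (by positivity)] at h1
  have h4 : 0 ≤ Real.sin (α / 2) ^ 2 := sq_nonneg _
  have hp2 : 9 ≤ π ^ 2 := by nlinarith
  nlinarith [sq_nonneg (1 - R - |α|), mul_nonneg (sub_nonneg.2 hR0) (mul_nonneg (sq_nonneg π) h4),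
    mul_nonneg (sub_nonneg.2 hp2) (sq_nonneg (1 - R))]

lemma continuous_norm_one_sub_circleMap_rpow {R : ℝ} (hR0 : 0 ≤ R) (hR1 : R < 1) (p : ℝ) :
    Continuous fun α => ‖1 - circleMap 0 R α‖ ^ p := by
  refine Continuous.rpow_const (by fun_prop) fun α => Or.inl ?_
  exact (norm_one_sub_circleMap_pos hR0 hR1 α).ne'

/-- Integral means of `|1 - z| ^ p`. -/
noncomputable def pI (p R : ℝ) : ℝ := ∫ α in (0 : ℝ)..2 * π, ‖1 - circleMap 0 R α‖ ^ p

lemma pI_nonneg (p R : ℝ) : 0 ≤ pI p R :=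
  intervalIntegral.integral_nonneg (by positivity) fun _ _ => by positivity

lemma periodic_norm_rpow (p R : ℝ) : Function.Periodic (fun α => ‖1 - circleMap 0 R α‖ ^ p) (2 * π) := by
  intro α
  simp only [periodic_circleMap 0 R α]

lemma integral_shift_le_pI {R : ℝ} (hR0 : 0 ≤ R) (hR1 : R < 1) (p α : ℝ) :
    ∫ ψ in (0 : ℝ)..π, ‖1 - circleMap 0 R (α + ψ)‖ ^ p ≤ pI p R := by
  have hc := continuous_norm_one_sub_circleMap_rpow hR0 hR1 p
  have hc' : Continuous fun ψ => ‖1 - circleMap 0 R (α + ψ)‖ ^ p := hc.comp (by fun_prop)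
  calc _ ≤ ∫ ψ in (0 : ℝ)..2 * π, ‖1 - circleMap 0 R (α + ψ)‖ ^ p := by
        refine intervalIntegral.integral_mono_interval le_rfl pi_pos.le (by linarith [pi_pos]) ?_
          (hc'.intervalIntegrable _ _)
        exact Filter.Eventually.of_forall fun _ => by positivity
    _ = _ := by
        rw [intervalIntegral.integral_comp_add_left fun ψ => ‖1 - circleMap 0 R ψ‖ ^ p]
        have := (periodic_norm_rpow p R).intervalIntegral_add_eq α 0
        simpa [pI] using this

lemma integral_shift_sub_le_pI {R : ℝ} (hR0 : 0 ≤ R) (hR1 : R < 1) (p α : ℝ) :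
    ∫ ψ in (0 : ℝ)..π, ‖1 - circleMap 0 R (α - ψ)‖ ^ p ≤ pI p R := by
  have h := integral_shift_le_pI hR0 hR1 p (α - π)
  refine le_of_eq_of_le ?_ h
  rw [intervalIntegral.integral_comp_add_left fun ψ => ‖1 - circleMap 0 R ψ‖ ^ p,
    intervalIntegral.integral_comp_sub_left fun ψ => ‖1 - circleMap 0 R ψ‖ ^ p]
  simp

lemma integral_sq_eq_pI (p R : ℝ) :
    ∫ α in (0 : ℝ)..2 * π, ‖1 - circleMap 0 R α ^ 2‖ ^ p = pI p (R ^ 2) := by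
  have e : ∀ α, circleMap 0 R α ^ 2 = circleMap 0 (R ^ 2) (2 * α) := by
    intro α
    rw [circleMap, circleMap, zero_add, zero_add, mul_pow, ← Complex.exp_nat_mul]
    push_cast; ring_nf
  simp_rw [e]
  rw [intervalIntegral.integral_comp_mul_left (fun ψ => ‖1 - circleMap 0 (R ^ 2) ψ‖ ^ p) two_ne_zero]
  have h1 := (periodic_norm_rpow p (R ^ 2)).intervalIntegral_add_eq (2 * π) 0
  by_cases hI : IntervalIntegrable (fun ψ => ‖1 - circleMap 0 (R ^ 2) ψ‖ ^ p) volume 0 (2 * π)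
  · have h2 : IntervalIntegrable (fun ψ => ‖1 - circleMap 0 (R ^ 2) ψ‖ ^ p) volume (2 * π) (2 * (2 * π)) := by
      have := (periodic_norm_rpow p (R ^ 2)).intervalIntegrable (t := 0) (by positivity) (by simpa using hI) (2 * π) (2 * (2 * π))
      exact this
    rw [mul_zero, ← intervalIntegral.integral_add_adjacent_intervals hI h2]
    rw [show 2 * (2 * π) = 2 * π + 2 * π by ring, h1, zero_add, smul_eq_mul]
    unfold pI; ring
  · have h2 : ¬ IntervalIntegrable (fun ψ => ‖1 - circleMap 0 (R ^ 2) ψ‖ ^ p) volume 0 (2 * (2 * π)) := by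
      intro h; apply hI
      exact h.mono_set (by rw [Set.uIcc_of_le (by positivity), Set.uIcc_of_le (by positivity)]; exact Set.Icc_subset_Icc le_rfl (by linarith [pi_pos]))
    rw [mul_zero, pI, intervalIntegral.integral_undef hI, intervalIntegral.integral_undef h2, smul_zero]

lemma pI_eq_symm {R : ℝ} (p : ℝ) : pI p R = ∫ α in (-π)..π, ‖1 - circleMap 0 R α‖ ^ p := by
  have := (periodic_norm_rpow p R).intervalIntegral_add_eq 0 (-π)
  rw [zero_add, show -π + 2 * π = π by ring] at this
  exact this

lemma pI_le_of_nonneg {p R : ℝ} (hp : 0 ≤ p) (hR0 : 0 ≤ R) (hR1 : R < 1) : pI p R ≤ 2 ^ p * (2 * π) := by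
  have hc := continuous_norm_one_sub_circleMap_rpow hR0 hR1 p
  calc _ ≤ ∫ α in (0 : ℝ)..2 * π, (2 : ℝ) ^ p := by
        refine intervalIntegral.integral_mono_on (by positivity) (hc.intervalIntegrable _ _) (by simp) ?_
        intro α _
        exact rpow_le_rpow (norm_nonneg _) (norm_one_sub_circleMap_le hR0 hR1 α) hp
    _ = _ := by simp; ring

lemma pI_le_of_neg {p R : ℝ} (hp : p < 0) (hR0 : 1 / 4 ≤ R) (hR1 : R < 1) :
    pI p R ≤ 2 * (2 * π) ^ (-p) * ∫ α in (1 - R)..(1 - R + π), α ^ p := by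
  have hR : 0 ≤ R := by linarith
  have hc := continuous_norm_one_sub_circleMap_rpow hR hR1 p
  have hb : Continuous fun α : ℝ => (2 * π) ^ (-p) * (1 - R + |α|) ^ p := by
    refine Continuous.mul continuous_const (Continuous.rpow_const (by fun_prop) fun α => Or.inl ?_)
    have := abs_nonneg α
    linarith
  have h0 : ∀ α ∈ Set.Icc (-π) π, ‖1 - circleMap 0 R α‖ ^ p ≤ (2 * π) ^ (-p) * (1 - R + |α|) ^ p := by
    intro α hα
    have h1 := norm_one_sub_circleMap_ge hR0 hR1 (abs_le.2 hα)
    have h2 : 0 < 1 - R + |α| := by have := abs_nonneg α; linarith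
    refine (rpow_le_rpow_of_nonpos (by positivity) h1 hp.le).trans (le_of_eq ?_)
    rw [div_rpow h2.le (by positivity), rpow_neg (by positivity)]
    field_simp
  rw [pI_eq_symm]
  refine (intervalIntegral.integral_mono_on (by linarith [pi_pos]) (hc.intervalIntegrable _ _)
    (hb.intervalIntegrable _ _) h0).trans (le_of_eq ?_)
  rw [intervalIntegral.integral_const_mul]
  have hb2 : Continuous fun α : ℝ => (1 - R + |α|) ^ p := by
    refine Continuous.rpow_const (by fun_prop) fun α => Or.inl ?_
    have := abs_nonneg α
    linarith
  have h3 : ∫ α in (0 : ℝ)..π, (1 - R + |α|) ^ p = ∫ α in (1 - R)..(1 - R + π), α ^ p := by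
    have := intervalIntegral.integral_comp_add_left (a := 0) (b := π) (fun α : ℝ => α ^ p) (1 - R)
    rw [add_zero] at this
    rw [← this]
    refine intervalIntegral.integral_congr fun α hα => ?_
    rw [Set.uIcc_of_le pi_pos.le] at hα
    simp only [abs_of_nonneg hα.1]
  have h4 : ∫ α in (-π)..0, (1 - R + |α|) ^ p = ∫ α in (0 : ℝ)..π, (1 - R + |α|) ^ p := by
    have := intervalIntegral.integral_comp_neg (a := 0) (b := π) (fun α : ℝ => (1 - R + |α|) ^ p)
    simp only [abs_neg, neg_zero] at this
    exact this.symm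
  rw [← intervalIntegral.integral_add_adjacent_intervals (hb2.intervalIntegrable _ 0) (hb2.intervalIntegrable _ _),
    h4, h3]
  ring

lemma pI_le_of_gt {p : ℝ} (hp : -1 < p) : ∃ C, 0 < C ∧ ∀ R, 1 / 4 ≤ R → R < 1 → pI p R ≤ C := by
  by_cases h0 : 0 ≤ p
  · exact ⟨2 ^ p * (2 * π), by positivity, fun R h1 h2 => pI_le_of_nonneg h0 (by linarith) h2⟩
  · push Not at h0
    refine ⟨2 * (2 * π) ^ (-p) * ((1 + π) ^ (p + 1) / (p + 1)), ?_, fun R h1 h2 => ?_⟩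
    · have : 0 < p + 1 := by linarith
      positivity
    · refine (pI_le_of_neg h0 h1 h2).trans ?_
      rw [integral_rpow (Or.inl hp)]
      have hp1 : 0 < p + 1 := by linarith
      have : 0 ≤ (1 - R) ^ (p + 1) := rpow_nonneg (by linarith) _
      gcongr
      have : (1 - R + π) ^ (p + 1) ≤ (1 + π) ^ (p + 1) :=
        rpow_le_rpow (by linarith [pi_pos]) (by linarith) hp1.le
      linarith

lemma pI_le_of_lt {p : ℝ} (hp : p < -1) : ∃ C, 0 < C ∧ ∀ R, 1 / 4 ≤ R → R < 1 →
    pI p R ≤ C * (1 - R) ^ (p + 1) := by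
  have hp1 : 0 < -(p + 1) := by linarith
  refine ⟨2 * (2 * π) ^ (-p) * (1 / -(p + 1)), by positivity, fun R h1 h2 => ?_⟩
  refine (pI_le_of_neg (by linarith) h1 h2).trans ?_
  rw [integral_rpow (Or.inr ⟨hp.ne, ?_⟩), mul_assoc _ (1 / -(p + 1))]
  · have : 0 ≤ (1 - R + π) ^ (p + 1) := rpow_nonneg (by linarith [pi_pos]) _
    refine mul_le_mul_of_nonneg_left ?_ (by positivity)
    rw [one_div_mul_eq_div, div_neg, ← neg_div, div_le_div_right_of_neg (by linarith)]
    linarith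
  · rw [Set.uIcc_of_le (by linarith [pi_pos])]
    intro h
    linarith [h.1]

lemma pI_le_of_eq : ∃ C, 0 < C ∧ ∀ R, 1 / 4 ≤ R → R < 1 →
    pI (-1) R ≤ C * (1 + Real.log (1 / (1 - R))) := by
  have hl : 0 < Real.log (1 + π) := Real.log_pos (by linarith [pi_pos])
  refine ⟨2 * (2 * π) ^ (-(-1) : ℝ) * (1 + Real.log (1 + π)), by positivity, fun R h1 h2 => ?_⟩
  refine (pI_le_of_neg (by norm_num) h1 h2).trans ?_
  have e : ∫ α in (1 - R)..(1 - R + π), α ^ (-1 : ℝ) = Real.log ((1 - R + π) / (1 - R)) := by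
    simp_rw [rpow_neg_one]
    rw [integral_inv]
    rw [Set.uIcc_of_le (by linarith [pi_pos])]
    intro h
    linarith [h.1]
  rw [e, mul_assoc _ (1 + Real.log (1 + π))]
  have hR : 0 < 1 - R := by linarith
  have h3 : 0 ≤ Real.log (1 / (1 - R)) := Real.log_nonneg (by rw [le_div_iff₀ hR]; linarith)
  refine mul_le_mul_of_nonneg_left ?_ (by positivity)
  rw [div_eq_mul_one_div, Real.log_mul (by linarith [pi_pos]) (by positivity)]
  have : Real.log (1 - R + π) ≤ Real.log (1 + π) := Real.log_le_log (by linarith [pi_pos]) (by linarith)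
  nlinarith

lemma rpow_le_of_comparable {x y K : ℝ} (hx : 0 < x) (hy : 0 < y) (hK : 1 ≤ K) (h1 : x ≤ K * y)
    (h2 : y ≤ K * x) (q : ℝ) : x ^ q ≤ K ^ |q| * y ^ q := by
  have hK0 : 0 < K := by linarith
  rcases le_total 0 q with h | h
  · rw [abs_of_nonneg h, ← mul_rpow hK0.le hy.le]
    exact rpow_le_rpow hx.le h1 h
  · rw [abs_of_nonpos h]
    have h3 : (K * x) ^ q ≤ y ^ q := rpow_le_rpow_of_nonpos hy h2 h
    rw [mul_rpow hK0.le hx.le] at h3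
    calc x ^ q = K ^ (-q) * (K ^ q * x ^ q) := by
          rw [← mul_assoc, ← rpow_add hK0]; simp
      _ ≤ _ := by gcongr

lemma distance_bound_aux {m : ℝ} (hm : 0 < m) {x y z s e : ℝ} (hx : 0 < x) (hs : 0 ≤ s)
    (he : 0 < e) (hez : e ≤ z) (hsxy : s ≤ x + y) (hz : z ≤ x + y) (hy : y ≤ z + x) (hxy : x ≤ y) :
    s ^ (2 * m) * (x * y) ^ (-(m + 1)) ≤ 3 ^ (2 * m) * 3 ^ |m - 1| *
      (z ^ (m - 1) * (x ^ (-(m + 1)) + e ^ (1 - m) * x ^ (-2 : ℝ))) := by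
  have hy0 : 0 < y := by linarith
  have hz0 : 0 < z := by linarith
  rw [mul_rpow hx.le hy0.le]
  have hxp : 0 < x ^ (-(m + 1)) := rpow_pos_of_pos hx _
  have hyp : 0 < y ^ (-(m + 1)) := rpow_pos_of_pos hy0 _
  have hzp : 0 < z ^ (m - 1) := rpow_pos_of_pos hz0 _
  have hep : 0 < e ^ (1 - m) := rpow_pos_of_pos he _
  have hx2 : 0 < x ^ (-2 : ℝ) := rpow_pos_of_pos hx _
  have h3 : (1 : ℝ) ≤ 3 ^ |m - 1| := one_le_rpow (by norm_num) (abs_nonneg _)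
  by_cases hc : y ≤ 2 * x
  · have h1 : s ^ (2 * m) ≤ 3 ^ (2 * m) * x ^ (2 * m) := by
      rw [← mul_rpow (by norm_num) hx.le]
      exact rpow_le_rpow hs (by linarith) (by linarith)
    have h2 : y ^ (-(m + 1)) ≤ x ^ (-(m + 1)) := rpow_le_rpow_of_nonpos hx hxy (by linarith)
    have h4 : x ^ (2 * m) * (x ^ (-(m + 1)) * x ^ (-(m + 1))) = x ^ (-2 : ℝ) := by
      rw [← rpow_add hx, ← rpow_add hx]; congr 1; ring
    have h5 : x ^ (-2 : ℝ) ≤ 3 ^ |m - 1| * (z ^ (m - 1) * (x ^ (-(m + 1)) + e ^ (1 - m) * x ^ (-2 : ℝ))) := by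
      rcases le_total m 1 with h | h
      · have h6 : x ^ (m - 1) ≤ 3 ^ |m - 1| * z ^ (m - 1) := by
          rw [abs_of_nonpos (by linarith)]
          have h7 : (3 * x) ^ (m - 1) ≤ z ^ (m - 1) := rpow_le_rpow_of_nonpos hz0 (by linarith) (by linarith)
          rw [mul_rpow (by norm_num) hx.le] at h7
          calc x ^ (m - 1) = 3 ^ (-(m - 1)) * (3 ^ (m - 1) * x ^ (m - 1)) := by
                rw [← mul_assoc, ← rpow_add (by norm_num)]; simp
            _ ≤ _ := by gcongr
        calc x ^ (-2 : ℝ) = x ^ (m - 1) * x ^ (-(m + 1)) := by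
              rw [← rpow_add hx]; congr 1; ring
          _ ≤ 3 ^ |m - 1| * z ^ (m - 1) * x ^ (-(m + 1)) := by gcongr
          _ = 3 ^ |m - 1| * (z ^ (m - 1) * (x ^ (-(m + 1)) + 0)) := by ring
          _ ≤ _ := by gcongr; positivity
      · have h6 : 1 ≤ z ^ (m - 1) * e ^ (1 - m) := by
          have : e ^ (m - 1) ≤ z ^ (m - 1) := rpow_le_rpow he.le hez (by linarith)
          calc (1 : ℝ) = e ^ (m - 1) * e ^ (1 - m) := by rw [← rpow_add he]; simp
            _ ≤ _ := by gcongr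
        have h8 : x ^ (-2 : ℝ) ≤ z ^ (m - 1) * e ^ (1 - m) * x ^ (-2 : ℝ) := le_mul_of_one_le_left hx2.le h6
        have h9 : z ^ (m - 1) * e ^ (1 - m) * x ^ (-2 : ℝ) ≤ z ^ (m - 1) * (x ^ (-(m + 1)) + e ^ (1 - m) * x ^ (-2 : ℝ)) := by
          rw [mul_assoc]; gcongr; linarith
        exact (h8.trans h9).trans (le_mul_of_one_le_left (by positivity) h3)
    calc s ^ (2 * m) * (x ^ (-(m + 1)) * y ^ (-(m + 1))) ≤
        3 ^ (2 * m) * x ^ (2 * m) * (x ^ (-(m + 1)) * x ^ (-(m + 1))) := by gcongr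
      _ = 3 ^ (2 * m) * x ^ (-2 : ℝ) := by rw [mul_assoc, h4]
      _ ≤ _ := by rw [mul_assoc]; gcongr
  · push Not at hc
    have h1 : s ^ (2 * m) ≤ 3 ^ (2 * m) * y ^ (2 * m) := by
      rw [← mul_rpow (by norm_num) hy0.le]
      exact rpow_le_rpow hs (by linarith) (by linarith)
    have h6 : y ^ (m - 1) ≤ 3 ^ |m - 1| * z ^ (m - 1) :=
      rpow_le_of_comparable hy0 hz0 (by norm_num) (by linarith) (by linarith) _
    calc s ^ (2 * m) * (x ^ (-(m + 1)) * y ^ (-(m + 1))) ≤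
        3 ^ (2 * m) * y ^ (2 * m) * (x ^ (-(m + 1)) * y ^ (-(m + 1))) := by gcongr
      _ = 3 ^ (2 * m) * (y ^ (m - 1) * x ^ (-(m + 1))) := by
        rw [show m - 1 = 2 * m + -(m + 1) by ring, rpow_add hy0]; ring
      _ ≤ 3 ^ (2 * m) * (3 ^ |m - 1| * z ^ (m - 1) * x ^ (-(m + 1))) := by gcongr
      _ = 3 ^ (2 * m) * 3 ^ |m - 1| * (z ^ (m - 1) * (x ^ (-(m + 1)) + 0)) := by ring
      _ ≤ _ := by gcongr; positivity

lemma distance_bound {m : ℝ} (hm : 0 < m) {x y z s e : ℝ} (hx : 0 < x) (hy0 : 0 < y) (hs : 0 ≤ s)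
    (he : 0 < e) (hez : e ≤ z) (hsxy : s ≤ x + y) (hz : z ≤ x + y) (hy : y ≤ z + x) (hx' : x ≤ z + y) :
    s ^ (2 * m) * (x * y) ^ (-(m + 1)) ≤ 3 ^ (2 * m) * 3 ^ |m - 1| *
      (z ^ (m - 1) * ((x ^ (-(m + 1)) + y ^ (-(m + 1))) + e ^ (1 - m) * (x ^ (-2 : ℝ) + y ^ (-2 : ℝ)))) := by
  have hxp : 0 < x ^ (-(m + 1)) := rpow_pos_of_pos hx _
  have hyp : 0 < y ^ (-(m + 1)) := rpow_pos_of_pos hy0 _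
  have hz0 : 0 < z := by linarith
  have hzp : 0 < z ^ (m - 1) := rpow_pos_of_pos hz0 _
  have hep : 0 < e ^ (1 - m) := rpow_pos_of_pos he _
  have hx2 : 0 < x ^ (-2 : ℝ) := rpow_pos_of_pos hx _
  have hy2 : 0 < y ^ (-2 : ℝ) := rpow_pos_of_pos hy0 _
  rcases le_total x y with h | h
  · refine (distance_bound_aux hm hx hs he hez hsxy hz hy h).trans ?_
    gcongr <;> linarith
  · rw [mul_comm x y]
    refine (distance_bound_aux hm hy0 hs he hez (by linarith) (by linarith) hx' h).trans ?_
    gcongr <;> linarith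

lemma circleMap_mul_exp (R α ψ : ℝ) :
    circleMap 0 R α * Complex.exp (ψ * Complex.I) = circleMap 0 R (α + ψ) := by
  rw [circleMap, circleMap, zero_add, zero_add, mul_assoc, ← Complex.exp_add]
  push_cast; ring_nf

lemma circleMap_gen (R α ψ : ℝ) :
    1 + circleMap 0 R α ^ 2 - 2 * circleMap 0 R α * ((Real.cos ψ : ℝ) : ℂ) =
      (1 - circleMap 0 R (α + ψ)) * (1 - circleMap 0 R (α - ψ)) := by
  have h1 := circleMap_mul_exp R α ψ
  have h2 := circleMap_mul_exp R α (-ψ)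
  rw [← sub_eq_add_neg] at h2
  rw [← h1, ← h2, Complex.ofReal_cos, Complex.cos]
  have h3 : Complex.exp (ψ * Complex.I) * Complex.exp (((-ψ : ℝ) : ℂ) * Complex.I) = 1 := by
    rw [← Complex.exp_add]; simp
  push_cast at h3 ⊢
  linear_combination (-circleMap 0 R α ^ 2) * h3

lemma majB_integrand_bound {m : ℝ} (hm : 0 < m) {R : ℝ} (hR0 : 1 / 2 ≤ R) (hR1 : R < 1) (α : ℝ) {ψ : ℝ}
    (hψ : 0 ≤ Real.sin ψ) :
    Real.sin ψ ^ (2 * m) * ‖1 + circleMap 0 R α ^ 2 - 2 * circleMap 0 R α * ((Real.cos ψ : ℝ) : ℂ)‖ ^ (-(m + 1)) ≤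
      3 ^ (2 * m) * 3 ^ |m - 1| * (‖1 - circleMap 0 R α ^ 2‖ ^ (m - 1) *
      ((‖1 - circleMap 0 R (α + ψ)‖ ^ (-(m + 1)) + ‖1 - circleMap 0 R (α - ψ)‖ ^ (-(m + 1))) +
      (1 - R) ^ (1 - m) * (‖1 - circleMap 0 R (α + ψ)‖ ^ (-2 : ℝ) + ‖1 - circleMap 0 R (α - ψ)‖ ^ (-2 : ℝ)))) := by
  have hR : 0 ≤ R := by linarith
  rw [circleMap_gen, norm_mul]
  have hn : ∀ α, ‖circleMap 0 R α‖ = R := fun α => by simp [abs_of_nonneg hR]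
  set a := circleMap 0 R (α + ψ) with ha
  set b := circleMap 0 R (α - ψ) with hb
  have hab : circleMap 0 R α ^ 2 = a * b := by
    rw [ha, hb, circleMap, circleMap, circleMap]
    simp only [zero_add]
    rw [mul_mul_mul_comm, ← Complex.exp_add, mul_pow, ← Complex.exp_nat_mul]
    push_cast; ring_nf
  rw [hab]
  have hna : ‖a‖ = R := hn _
  have hnb : ‖b‖ = R := hn _
  refine distance_bound hm (norm_one_sub_circleMap_pos hR hR1 _) (norm_one_sub_circleMap_pos hR hR1 _)
    hψ (by linarith) ?_ ?_ ?_ ?_ ?_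
  · have := norm_sub_norm_le (1 : ℂ) (a * b)
    rw [norm_one, norm_mul, hna, hnb] at this
    nlinarith
  · have h1 : a - b = 2 * circleMap 0 R α * Complex.I * ((Real.sin ψ : ℝ) : ℂ) := by
      rw [ha, hb, sub_eq_add_neg α ψ, ← circleMap_mul_exp, ← circleMap_mul_exp, Complex.ofReal_sin, Complex.sin]
      push_cast
      linear_combination circleMap 0 R α * (Complex.exp (ψ * Complex.I) - Complex.exp (-ψ * Complex.I)) * Complex.I_sq
    have h2 : ‖a - b‖ = 2 * R * Real.sin ψ := by
      rw [h1, norm_mul, norm_mul, norm_mul, hn, Complex.norm_real, Real.norm_of_nonneg hψ]; simp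
    have h3 : ‖a - b‖ ≤ ‖1 - a‖ + ‖1 - b‖ := by
      rw [show a - b = (1 - b) - (1 - a) by ring]
      exact (norm_sub_le _ _).trans (by linarith)
    nlinarith
  · rw [show 1 - a * b = (1 - a) + a * (1 - b) by ring]
    refine (norm_add_le _ _).trans ?_
    rw [norm_mul, hna]
    nlinarith [norm_nonneg (1 - b)]
  · rw [show 1 - b = (1 - a * b) - b * (1 - a) by ring]
    refine (norm_sub_le _ _).trans ?_
    rw [norm_mul, hnb]
    nlinarith [norm_nonneg (1 - a)]
  · rw [show 1 - a = (1 - a * b) - a * (1 - b) by ring]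
    refine (norm_sub_le _ _).trans ?_
    rw [norm_mul, hna]
    nlinarith [norm_nonneg (1 - b)]

lemma continuousOn_majB_cos (δ m : ℝ) {R : ℝ} (hR0 : 0 ≤ R) (hR1 : R < 1) :
    Continuous (fun p : ℝ × ℝ => ‖1 - circleMap 0 R p.2 ^ 2‖ ^ (-δ) *
      ‖1 + circleMap 0 R p.2 ^ 2 - 2 * circleMap 0 R p.2 * ((Real.cos p.1 : ℝ) : ℂ)‖ ^ (-(m + 1))) := by
  have := (continuousOn_majB_integrand δ m hR0 hR1).comp (f := fun p : ℝ × ℝ => (Real.cos p.1, p.2))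
    (s := Set.univ) (by fun_prop) (fun p _ => ⟨⟨Real.neg_one_le_cos _, Real.cos_le_one _⟩, Set.mem_univ _⟩)
  exact continuousOn_univ.1 this

lemma integral_nested_combination {f₁ f₂ f₃ f₄ : ℝ → ℝ} (h₁ : Continuous f₁) (h₂ : Continuous f₂)
    (h₃ : Continuous f₃) (h₄ : Continuous f₄) (a b c d : ℝ) :
    ∫ x in (0 : ℝ)..π, a * (b * (c * ((f₁ x + f₂ x) + d * (f₃ x + f₄ x)))) =
      a * (b * (c * (((∫ x in (0 : ℝ)..π, f₁ x) + ∫ x in (0 : ℝ)..π, f₂ x) +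
        d * ((∫ x in (0 : ℝ)..π, f₃ x) + ∫ x in (0 : ℝ)..π, f₄ x)))) := by
  have i1 := h₁.intervalIntegrable (μ := volume) 0 π
  have i2 := h₂.intervalIntegrable (μ := volume) 0 π
  have i3 := h₃.intervalIntegrable (μ := volume) 0 π
  have i4 := h₄.intervalIntegrable (μ := volume) 0 π
  rw [intervalIntegral.integral_const_mul, intervalIntegral.integral_const_mul, intervalIntegral.integral_const_mul,
    intervalIntegral.integral_add (i1.add i2) ((i3.add i4).const_mul _), intervalIntegral.integral_add i1 i2,
    intervalIntegral.integral_const_mul, intervalIntegral.integral_add i3 i4]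

set_option maxHeartbeats 600000 in
lemma integral_majB_le (m : ℝ) (hm : 0 < m) : ∃ C, 0 < C ∧ ∀ δ R, 1 / 2 ≤ R → R < 1 →
    ∫ ψ in (0 : ℝ)..π, majB δ m R (Real.cos ψ) * Real.sin ψ ^ (2 * m) ≤
      C * (1 - R) ^ (-m) * pI (m - 1 - δ) (R ^ 2) := by
  obtain ⟨C1, hC1, h1⟩ := pI_le_of_lt (p := -(m + 1)) (by linarith)
  obtain ⟨C2, hC2, h2⟩ := pI_le_of_lt (p := -2) (by norm_num)
  set K : ℝ := 3 ^ (2 * m) * 3 ^ |m - 1| with hK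
  have hK0 : 0 < K := by positivity
  refine ⟨K * (2 * C1 + 2 * C2), by positivity, fun δ R hR0 hR1 => ?_⟩
  have hR : 0 ≤ R := by linarith
  have he : 0 < 1 - R := by linarith
  have hF := continuousOn_majB_cos δ m hR hR1
  have hs : Continuous fun ψ : ℝ => Real.sin ψ ^ (2 * m) :=
    Real.continuous_sin.rpow_const fun _ => Or.inr (by linarith)
  set G : ℝ → ℝ → ℝ := fun ψ α => ‖1 - circleMap 0 R α ^ 2‖ ^ (-δ) *
      ‖1 + circleMap 0 R α ^ 2 - 2 * circleMap 0 R α * ((Real.cos ψ : ℝ) : ℂ)‖ ^ (-(m + 1)) * Real.sin ψ ^ (2 * m) with hG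
  have hGc : Continuous (Function.uncurry G) := hF.mul (hs.comp continuous_fst)
  have e1 : ∫ ψ in (0 : ℝ)..π, majB δ m R (Real.cos ψ) * Real.sin ψ ^ (2 * m) =
      ∫ ψ in (0 : ℝ)..π, ∫ α in (0 : ℝ)..2 * π, G ψ α := by
    refine intervalIntegral.integral_congr fun ψ _ => ?_
    simp only [majB, hG]
    rw [intervalIntegral.integral_mul_const]
  have hGI : IntegrableOn (Function.uncurry G) (Set.uIoc 0 π ×ˢ Set.uIoc 0 (2 * π)) volume := by
    have : IntegrableOn (Function.uncurry G) (Set.Icc 0 π ×ˢ Set.Icc 0 (2 * π)) volume :=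
      hGc.continuousOn.integrableOn_compact (isCompact_Icc.prod isCompact_Icc)
    refine this.mono_set ?_
    rw [Set.uIoc_of_le pi_pos.le, Set.uIoc_of_le (by positivity)]
    exact Set.prod_mono Set.Ioc_subset_Icc_self Set.Ioc_subset_Icc_self
  rw [e1, intervalIntegral_intervalIntegral_swap hGI]
  clear_value G
  have hcp : ∀ p α : ℝ, Continuous fun ψ : ℝ => ‖1 - circleMap 0 R (α + ψ)‖ ^ p := fun p α =>
    (continuous_norm_one_sub_circleMap_rpow hR hR1 p).comp (f := fun ψ : ℝ => α + ψ) (by fun_prop)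
  have hcm : ∀ p α : ℝ, Continuous fun ψ : ℝ => ‖1 - circleMap 0 R (α - ψ)‖ ^ p := fun p α =>
    (continuous_norm_one_sub_circleMap_rpow hR hR1 p).comp (f := fun ψ : ℝ => α - ψ) (by fun_prop)
  have key : ∀ α, ∫ ψ in (0 : ℝ)..π, G ψ α ≤
      K * (2 * C1 + 2 * C2) * (1 - R) ^ (-m) * ‖1 - circleMap 0 R α ^ 2‖ ^ (m - 1 - δ) := by
    intro α
    set D := ‖1 - circleMap 0 R α ^ 2‖ with hD
    have hD0 : 0 < D := norm_pos_iff.2 (one_sub_sq_ne_zero (by simpa [abs_of_nonneg hR] using hR1))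
    set H : ℝ → ℝ := fun ψ => D ^ (-δ) * (K * (D ^ (m - 1) *
      ((‖1 - circleMap 0 R (α + ψ)‖ ^ (-(m + 1)) + ‖1 - circleMap 0 R (α - ψ)‖ ^ (-(m + 1))) +
      (1 - R) ^ (1 - m) * (‖1 - circleMap 0 R (α + ψ)‖ ^ (-2 : ℝ) + ‖1 - circleMap 0 R (α - ψ)‖ ^ (-2 : ℝ))))) with hH
    have hHI : IntervalIntegrable H volume 0 π := by
      refine Continuous.intervalIntegrable ?_ _ _
      exact continuous_const.mul (continuous_const.mul (continuous_const.mul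
        (((hcp _ α).add (hcm _ α)).add (continuous_const.mul ((hcp _ α).add (hcm _ α))))))
    have hGα : Continuous fun ψ => G ψ α := hGc.comp (f := fun ψ : ℝ => (ψ, α)) (by fun_prop)
    have b1 : ∫ ψ in (0 : ℝ)..π, G ψ α ≤ ∫ ψ in (0 : ℝ)..π, H ψ := by
      refine intervalIntegral.integral_mono_on pi_pos.le (hGα.intervalIntegrable _ _) hHI fun ψ hψ => ?_
      have := majB_integrand_bound hm hR0 hR1 α (Real.sin_nonneg_of_nonneg_of_le_pi hψ.1 hψ.2)
      simp only [hG, hH]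
      rw [mul_assoc]
      refine mul_le_mul_of_nonneg_left ?_ (by positivity)
      rw [mul_comm]
      exact this
    have b2 : ∫ ψ in (0 : ℝ)..π, H ψ = D ^ (-δ) * (K * (D ^ (m - 1) *
      (((∫ ψ in (0 : ℝ)..π, ‖1 - circleMap 0 R (α + ψ)‖ ^ (-(m + 1))) + ∫ ψ in (0 : ℝ)..π, ‖1 - circleMap 0 R (α - ψ)‖ ^ (-(m + 1))) +
      (1 - R) ^ (1 - m) * ((∫ ψ in (0 : ℝ)..π, ‖1 - circleMap 0 R (α + ψ)‖ ^ (-2 : ℝ)) + ∫ ψ in (0 : ℝ)..π, ‖1 - circleMap 0 R (α - ψ)‖ ^ (-2 : ℝ))))) := by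
      exact integral_nested_combination (hcp _ α) (hcm _ α) (hcp _ α) (hcm _ α) _ _ _ _
    have q1 : ∀ p C : ℝ, pI p R ≤ C → (∫ ψ in (0 : ℝ)..π, ‖1 - circleMap 0 R (α + ψ)‖ ^ p) ≤ C := fun p C h =>
      (integral_shift_le_pI hR hR1 p α).trans h
    have q2 : ∀ p C : ℝ, pI p R ≤ C → (∫ ψ in (0 : ℝ)..π, ‖1 - circleMap 0 R (α - ψ)‖ ^ p) ≤ C := fun p C h =>
      (integral_shift_sub_le_pI hR hR1 p α).trans h
    have p1 := h1 R (by linarith) hR1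
    have p2 := h2 R (by linarith) hR1
    rw [b2] at b1
    refine b1.trans ?_
    have hee : (0 : ℝ) ≤ (1 - R) ^ (1 - m) := rpow_nonneg he.le _
    calc _ ≤ D ^ (-δ) * (K * (D ^ (m - 1) *
        ((C1 * (1 - R) ^ (-(m + 1) + 1) + C1 * (1 - R) ^ (-(m + 1) + 1)) + (1 - R) ^ (1 - m) *
        (C2 * (1 - R) ^ (-2 + 1 : ℝ) + C2 * (1 - R) ^ (-2 + 1 : ℝ))))) := by
          have := q1 _ _ p1
          have := q2 _ _ p1
          have := q1 _ _ p2
          have := q2 _ _ p2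
          gcongr
      _ = _ := by
          have a1 : D ^ (m - 1 - δ) = D ^ (-δ) * D ^ (m - 1) := by
            rw [← rpow_add hD0]; congr 1; ring
          have a2 : (1 - R) ^ (-m) = (1 - R) ^ (1 - m) * (1 - R) ^ (-2 + 1 : ℝ) := by
            rw [← rpow_add he]; congr 1; ring
          rw [a1, show -(m + 1) + 1 = -m by ring, mul_add (_ * _), a2]
          ring
  calc _ ≤ ∫ α in (0 : ℝ)..2 * π, K * (2 * C1 + 2 * C2) * (1 - R) ^ (-m) * ‖1 - circleMap 0 R α ^ 2‖ ^ (m - 1 - δ) := by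
        refine intervalIntegral.integral_mono_on (by positivity) ?_ ?_ fun α _ => key α
        · refine Continuous.intervalIntegrable ?_ _ _
          refine intervalIntegral.continuous_parametric_intervalIntegral_of_continuous' ?_ _ _
          exact hGc.comp continuous_swap
        · refine Continuous.intervalIntegrable ?_ _ _
          refine continuous_const.mul (Continuous.rpow_const (by fun_prop) fun α => Or.inl ?_)
          exact norm_ne_zero_iff.2 (one_sub_sq_ne_zero (by simpa [abs_of_nonneg hR] using hR1))
    _ = _ := by
        rw [intervalIntegral.integral_const_mul, integral_sq_eq_pI]

lemma eq_of_hasSum_pow_eq {a b : ℕ → ℝ} {f : ℝ → ℝ}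
    (ha : ∀ r : ℝ, |r| < 1 → HasSum (fun n => a n * r ^ n) (f r))
    (hb : ∀ r : ℝ, |r| < 1 → HasSum (fun n => b n * r ^ n) (f r)) : a = b := by
  have key : ∀ a : ℕ → ℝ, (∀ r : ℝ, |r| < 1 → HasSum (fun n => a n * r ^ n) (f r)) →
      HasFPowerSeriesAt f (FormalMultilinearSeries.ofScalars ℝ a) 0 := by
    intro a ha
    rw [hasFPowerSeriesAt_iff]
    filter_upwards [Metric.ball_mem_nhds (0 : ℝ) one_pos] with r hr
    have := ha r (by simpa using hr)
    simpa [FormalMultilinearSeries.coeff_ofScalars, mul_comm] using this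
  have h := (key a ha).eq_formalMultilinearSeries (key b hb)
  ext n
  have := congrArg (fun p => FormalMultilinearSeries.coeff p n) h
  simpa [FormalMultilinearSeries.coeff_ofScalars] using this

lemma integrable_polynomial_bm (p : Polynomial ℝ) (κ : ℝ) : Integrable (fun t => p.eval t) (bm κ) := by
  obtain ⟨C, hC⟩ := (isCompact_Icc (a := (-1 : ℝ)) (b := 1)).exists_bound_of_continuousOn
    (f := fun t => p.eval t) p.continuous.continuousOn
  refine Integrable.of_bound p.continuous.aestronglyMeasurable C ?_
  filter_upwards [bm_ae κ] with t ht using hC t ht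

lemma hasSum_integral_geg_bm (c κ : ℝ) {r : ℝ} (hr : |r| < 1) :
    HasSum (fun n => (∫ t, (geg c n).eval t ∂bm κ) * r ^ n) (∫ t, (1 + r ^ 2 - 2 * r * t) ^ (-c) ∂bm κ) := by
  have h := hasSum_integral_geg (μ := bm κ) measurable_id (bm_ae κ) c (r := (r : ℂ)) (by simpa using hr)
  rw [← Complex.hasSum_ofReal]
  convert h using 1
  · ext n; simp
  · rw [← integral_complex_ofReal]
    refine integral_congr_ae ?_
    filter_upwards [bm_ae κ] with t ht
    have := cpow_ofReal_gen (r := r) ht (-c)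
    simp only [id]
    rw [← this]
    push_cast; rfl

lemma integral_geg_eq_zero {c : ℝ} (hc : 0 < c) {N : ℕ} (hN : 1 ≤ N) :
    ∫ t, (geg c N).eval t ∂bm (c + 1 / 2) = 0 := by
  set μ := bm (c + 1 / 2) with hμ
  set a : ℕ → ℝ := fun n => ∫ t, (geg c n).eval t ∂μ with ha
  set b : ℕ → ℝ := fun n => ∫ t, (geg (c + 1) n).eval t ∂μ with hb
  have heq : ∀ r : ℝ, |r| < 1 → ∫ t, (1 + r ^ 2 - 2 * r * t) ^ (-c) ∂μ =
      (1 - r ^ 2) * ∫ t, (1 + r ^ 2 - 2 * r * t) ^ (-(c + 1)) ∂μ := by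
    intro r hr
    have h1 : r ^ 2 < 1 := by rw [sq_lt_one_iff_abs_lt_one]; exact hr
    have h2 : |2 * r| < 1 + r ^ 2 := by
      rw [abs_mul, abs_two]
      nlinarith [sq_abs r, abs_nonneg r]
    have := euler_real (k := c + 1 / 2) (m := -(3 / 2)) (by positivity) h2
    rw [show -(-(3 / 2) + (c + 1 / 2) + 1) = -c by ring, show (-(3 / 2) + 1 - (c + 1 / 2) : ℝ) = -(c + 1) by ring,
      show (1 + r ^ 2) ^ 2 - (2 * r) ^ 2 = (1 - r ^ 2) ^ (2 : ℝ) by rw [rpow_two]; ring,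
      ← rpow_mul (by linarith), show (2 : ℝ) * -(-(3 / 2) + 1) = 1 by norm_num, rpow_one] at this
    exact this
  have hA := fun r hr => hasSum_integral_geg_bm c (c + 1 / 2) (r := r) hr
  have hB : ∀ r : ℝ, |r| < 1 → HasSum (fun n => (b n - if 2 ≤ n then b (n - 2) else 0) * r ^ n)
      (∫ t, (1 + r ^ 2 - 2 * r * t) ^ (-c) ∂μ) := by
    intro r hr
    have h1 := hasSum_integral_geg_bm (c + 1) (c + 1 / 2) (r := r) hr
    rw [heq r hr, sub_mul, one_mul]
    have h2 : HasSum (fun n => (if 2 ≤ n then b (n - 2) else 0) * r ^ n)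
        (r ^ 2 * ∫ t, (1 + r ^ 2 - 2 * r * t) ^ (-(c + 1)) ∂μ) := by
      have h3 : HasSum (fun n => b n * r ^ (n + 2)) (r ^ 2 * ∫ t, (1 + r ^ 2 - 2 * r * t) ^ (-(c + 1)) ∂μ) := by
        refine (h1.mul_left (r ^ 2)).congr_fun fun n => ?_
        simp only [hb, hμ]; rw [pow_add]; ring
      rw [← hasSum_nat_add_iff' 2]
      simpa [Finset.sum_range_succ] using h3
    refine (h1.sub h2).congr_fun fun n => ?_
    simp only [hb, hμ]; ring
  have hab := congrFun (eq_of_hasSum_pow_eq hA hB)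
  rcases N with _ | _ | n
  · omega
  · simp only [zero_add, geg_one, Polynomial.eval_mul, Polynomial.eval_C, Polynomial.eval_X]
    rw [MeasureTheory.integral_const_mul]
    have := bm_moment_odd (κ := c + 1 / 2) (p := 1) odd_one
    simp only [pow_one] at this
    rw [hμ, this, mul_zero]
  · have h1 := hab (n + 2)
    simp only [le_add_iff_nonneg_left, zero_le, if_true, Nat.add_sub_cancel] at h1
    have h2 : ((n : ℝ) + 2 + c) * a (n + 2) = c * (b (n + 2) - b n) := by
      simp only [ha, hb]
      rw [← MeasureTheory.integral_const_mul, ← integral_sub (integrable_polynomial_bm _ _) (integrable_polynomial_bm _ _),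
        ← MeasureTheory.integral_const_mul]
      exact integral_congr_ae (Filter.Eventually.of_forall fun t => geg_sub hc t n)
    have h1' : a (n + 2) = b (n + 2) - b n := h1
    rw [← h1'] at h2
    have : ((n : ℝ) + 2) * a (n + 2) = 0 := by linarith
    rcases mul_eq_zero.1 this with h | h
    · have : (0 : ℝ) ≤ n := n.cast_nonneg
      linarith
    · exact h

lemma integral_geg_mul_pow {c : ℝ} (hc : 0 < c) (j : ℕ) : ∀ N : ℕ, j < N →
    ∫ t, (geg c N).eval t * t ^ j ∂bm (c + 1 / 2) = 0 := by
  induction j with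
  | zero => intro N hN; simpa using integral_geg_eq_zero hc hN
  | succ j ih =>
    intro N hN
    obtain ⟨n, rfl⟩ : ∃ n, N = n + 1 := ⟨N - 1, by omega⟩
    have hI : ∀ M, Integrable (fun t => (geg c M).eval t * t ^ j) (bm (c + 1 / 2)) := fun M => by
      have := integrable_polynomial_bm (geg c M * Polynomial.X ^ j) (c + 1 / 2)
      simpa only [Polynomial.eval_mul, Polynomial.eval_pow, Polynomial.eval_X] using this
    have h1 : ∫ t, (2 * (n + 1 + c)) * ((geg c (n + 1)).eval t * t ^ (j + 1)) ∂bm (c + 1 / 2) =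
        ∫ t, ((n : ℝ) + 2) * ((geg c (n + 2)).eval t * t ^ j) + (n + 2 * c) * ((geg c n).eval t * t ^ j) ∂bm (c + 1 / 2) := by
      refine integral_congr_ae (Filter.Eventually.of_forall fun t => ?_)
      have := geg_rec c n t
      simp only
      linear_combination (-t ^ j) * this
    rw [integral_add ((hI _).const_mul _) ((hI _).const_mul _), MeasureTheory.integral_const_mul,
      MeasureTheory.integral_const_mul, MeasureTheory.integral_const_mul, ih _ (by omega), ih _ (by omega)] at h1
    have h2 : (2 * ((n : ℝ) + 1 + c)) ≠ 0 := by positivity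
    simpa [h2] using h1

lemma integral_geg_mul_polynomial {c : ℝ} (hc : 0 < c) {N : ℕ} (p : Polynomial ℝ) (hp : p.natDegree < N) :
    ∫ t, (geg c N).eval t * p.eval t ∂bm (c + 1 / 2) = 0 := by
  have h : ∀ t, (geg c N).eval t * p.eval t =
      ∑ i ∈ Finset.range (p.natDegree + 1), p.coeff i * ((geg c N).eval t * t ^ i) := fun t => by
    rw [Polynomial.eval_eq_sum_range (p := p), Finset.mul_sum]
    exact Finset.sum_congr rfl fun i _ => by ring
  simp only [h]
  rw [MeasureTheory.integral_finsetSum]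
  · refine Finset.sum_eq_zero fun i hi => ?_
    rw [MeasureTheory.integral_const_mul, integral_geg_mul_pow hc i N (by have := Finset.mem_range.1 hi; omega), mul_zero]
  · intro i _
    have := integrable_polynomial_bm (geg c N * Polynomial.X ^ i) (c + 1 / 2)
    simp only [Polynomial.eval_mul, Polynomial.eval_pow, Polynomial.eval_X] at this
    exact this.const_mul _

lemma integral_bm_add_one {κ : ℝ} (hκ : 0 < κ) (f : ℝ → ℝ) :
    ∫ t, f t ∂bm (κ + 1) = ∫ t, f t * (1 - t ^ 2) ∂bm κ := by
  rw [integral_bm (by positivity), integral_bm hκ]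
  refine integral_congr_ae (Filter.Eventually.of_forall fun t => ?_)
  simp only [bmDens, smul_eq_mul]
  by_cases ht : t ∈ Set.Ioo (-1 : ℝ) 1
  · rw [Set.indicator_of_mem ht, Set.indicator_of_mem ht, show κ + 1 - 1 = (κ - 1) + 1 by ring,
      rpow_add_one (by nlinarith [ht.1, ht.2])]
    ring
  · rw [Set.indicator_of_notMem ht, Set.indicator_of_notMem ht]; simp

lemma geg_even_odd (c : ℝ) (n : ℕ) :
    (∃ p : Polynomial ℝ, p.natDegree ≤ n ∧ ∀ t, (geg c (2 * n)).eval t = p.eval (2 * t ^ 2 - 1)) ∧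
    (∃ p : Polynomial ℝ, p.natDegree ≤ n ∧ ∀ t, (geg c (2 * n + 1)).eval t = t * p.eval (2 * t ^ 2 - 1)) := by
  induction n with
  | zero => exact ⟨⟨1, by simp, by simp [geg]⟩, ⟨Polynomial.C (2 * c), (Polynomial.natDegree_C _).le, by simp [geg, mul_comm]⟩⟩
  | succ n ih =>
    obtain ⟨⟨p, hp, hp'⟩, ⟨s, hs, hs'⟩⟩ := ih
    have h1 : ∃ p : Polynomial ℝ, p.natDegree ≤ n + 1 ∧ ∀ t, (geg c (2 * n + 2)).eval t = p.eval (2 * t ^ 2 - 1) := by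
      refine ⟨Polynomial.C ((2 * n + 1 + c) / (2 * n + 2)) * ((Polynomial.X + 1) * s) -
        Polynomial.C ((2 * n + 2 * c) / (2 * n + 2)) * p, ?_, fun t => ?_⟩
      · refine (Polynomial.natDegree_sub_le _ _).trans (max_le ?_ ?_)
        · refine (Polynomial.natDegree_C_mul_le _ _).trans (Polynomial.natDegree_mul_le.trans ?_)
          have : (Polynomial.X + 1 : Polynomial ℝ).natDegree ≤ 1 := by compute_degree
          omega
        · exact (Polynomial.natDegree_C_mul_le _ _).trans (by omega)
      · have := geg_rec c (2 * n) t
        push_cast at this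
        rw [hp', hs'] at this
        simp only [Polynomial.eval_sub, Polynomial.eval_mul, Polynomial.eval_add, Polynomial.eval_C, Polynomial.eval_X,
          Polynomial.eval_one]
        have h2 : (2 * (n : ℝ) + 2) ≠ 0 := by positivity
        field_simp
        linear_combination this
    refine ⟨h1, ?_⟩
    obtain ⟨p', hp1, hp2⟩ := h1
    refine ⟨Polynomial.C (2 * (2 * n + 2 + c) / (2 * n + 3)) * p' -
        Polynomial.C ((2 * n + 1 + 2 * c) / (2 * n + 3)) * s, ?_, fun t => ?_⟩
    · refine (Polynomial.natDegree_sub_le _ _).trans (max_le ?_ ?_)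
      · exact (Polynomial.natDegree_C_mul_le _ _).trans hp1
      · exact (Polynomial.natDegree_C_mul_le _ _).trans (by omega)
    · have := geg_rec c (2 * n + 1) t
      push_cast at this
      rw [show 2 * n + 1 + 1 = 2 * n + 2 by ring, hp2, hs'] at this
      rw [show 2 * (n + 1) + 1 = 2 * n + 1 + 2 by ring]
      simp only [Polynomial.eval_sub, Polynomial.eval_mul, Polynomial.eval_C]
      have h2 : (2 * (n : ℝ) + 3) ≠ 0 := by positivity
      generalize p'.eval (2 * t ^ 2 - 1) = P at *
      generalize s.eval (2 * t ^ 2 - 1) = S at *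
      field_simp
      linear_combination this

lemma exists_sum_of_natDegree_le {q : ℕ → Polynomial ℝ} (hq : ∀ k, (q k).degree = k) (n : ℕ) :
    ∀ p : Polynomial ℝ, p.natDegree ≤ n → ∃ c : ℕ → ℝ, p = ∑ k ∈ Finset.range (n + 1), Polynomial.C (c k) * q k := by
  have hqn : ∀ k, (q k).natDegree = k := fun k => Polynomial.natDegree_eq_of_degree_eq_some (hq k)
  have hl : ∀ k, (q k).coeff k ≠ 0 := fun k => by
    have : q k ≠ 0 := by intro h; have := hq k; rw [h] at this; simp at this
    have h2 := Polynomial.leadingCoeff_ne_zero.2 this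
    rwa [Polynomial.leadingCoeff, hqn] at h2
  induction n with
  | zero =>
    intro p hp
    refine ⟨fun _ => p.coeff 0 / (q 0).coeff 0, ?_⟩
    rw [Finset.sum_range_one, Polynomial.eq_C_of_natDegree_le_zero hp,
      Polynomial.eq_C_of_natDegree_le_zero (hqn 0).le, ← Polynomial.C_mul]
    simp [hl 0]
  | succ n ih =>
    intro p hp
    obtain ⟨c, hc⟩ := ih (p - Polynomial.C (p.coeff (n + 1) / (q (n + 1)).coeff (n + 1)) * q (n + 1)) (by
      rw [Polynomial.natDegree_le_iff_coeff_eq_zero]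
      intro N hN
      rw [Polynomial.coeff_sub, Polynomial.coeff_C_mul]
      rcases eq_or_lt_of_le (show n + 1 ≤ N from hN) with h | h
      · rw [← h, div_mul_cancel₀ _ (hl _), sub_self]
      · rw [Polynomial.coeff_eq_zero_of_natDegree_lt (p := p) (n := N) (by omega),
          Polynomial.coeff_eq_zero_of_natDegree_lt (p := q (n + 1)) (n := N) (by rw [hqn]; exact h)]
        simp)
    refine ⟨fun k => if k = n + 1 then p.coeff (n + 1) / (q (n + 1)).coeff (n + 1) else c k, ?_⟩
    simp only [Finset.sum_range_succ _ (n + 1), if_true]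
    rw [← sub_eq_iff_eq_add, hc]
    refine Finset.sum_congr rfl fun k hk => ?_
    rw [if_neg (by have := Finset.mem_range.1 hk; omega)]

lemma integral_wJac {l : ℝ} (hl : 0 < l) (F : ℝ → ℝ) :
    ∫ s in (-1 : ℝ)..1, F s * wJac (l - 1 / 2) (-(1 / 2)) s = 2 ^ l * ∫ t, F (2 * t ^ 2 - 1) ∂bm (l + 1 / 2) := by
  have h1 : ∫ t, F (2 * t ^ 2 - 1) ∂bm (l + 1 / 2) =
      2 * ∫ t in Set.Ioo (0 : ℝ) 1, (1 - t ^ 2) ^ (l - 1 / 2) * F (2 * t ^ 2 - 1) := by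
    rw [integral_bm (by positivity)]
    have := integral_comp_abs (f := fun t => bmDens (l + 1 / 2) t • F (2 * t ^ 2 - 1))
    simp only [bmDens_abs, sq_abs] at this
    rw [this, ← MeasureTheory.integral_indicator measurableSet_Ioi, ← MeasureTheory.integral_indicator measurableSet_Ioo]
    congr 2
    ext t
    simp only [Set.indicator_apply, bmDens, Set.mem_Ioi, Set.mem_Ioo, smul_eq_mul]
    split_ifs with h1 h2 h3 h3
    · rw [show l + 1 / 2 - 1 = l - 1 / 2 by ring]
    · exact absurd ⟨h1, h2.2⟩ h3
    · exact absurd ⟨by linarith, h3.2⟩ h2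
    · simp
    · exact absurd ‹0 < t ∧ t < 1›.1 h1
    · rfl
  have h2 : (fun t : ℝ => 2 * t ^ 2 - 1) '' Set.Ioo 0 1 = Set.Ioo (-1) 1 := by
    ext s
    constructor
    · rintro ⟨t, ⟨h1, h2⟩, rfl⟩
      constructor <;> simp only <;> nlinarith
    · rintro ⟨h1, h2⟩
      refine ⟨Real.sqrt ((s + 1) / 2), ⟨Real.sqrt_pos.2 (by linarith), ?_⟩, ?_⟩
      · rw [Real.sqrt_lt' one_pos]; linarith
      · simp only
        rw [Real.sq_sqrt (by linarith)]; ring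
  rw [intervalIntegral.integral_of_le (by norm_num), h1, integral_Ioc_eq_integral_Ioo, ← h2,
    integral_image_eq_integral_abs_deriv_smul measurableSet_Ioo (f' := fun t => 4 * t), ← mul_assoc,
    ← MeasureTheory.integral_const_mul]
  · refine setIntegral_congr_fun measurableSet_Ioo fun t ht => ?_
    have ht0 : 0 < t := ht.1
    have ht1 : 0 < 1 - t ^ 2 := by nlinarith [ht.1, ht.2]
    simp only [wJac, smul_eq_mul]
    rw [show 1 - (2 * t ^ 2 - 1) = 2 * (1 - t ^ 2) by ring, show 1 + (2 * t ^ 2 - 1) = 2 * t ^ 2 by ring,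
      mul_rpow two_pos.le ht1.le, mul_rpow two_pos.le (by positivity), abs_of_pos (by positivity),
      show (t ^ 2) ^ (-(1 / 2) : ℝ) = t⁻¹ by
        rw [← rpow_natCast, ← rpow_mul ht0.le, ← rpow_neg_one]; norm_num]
    have e : (2 : ℝ) ^ l * 2 = 2 ^ (l - 1 / 2) * 2 ^ (-(1 / 2) : ℝ) * 4 := by
      rw [← rpow_add two_pos, show l - 1 / 2 + -(1 / 2) = l - 1 by ring, rpow_sub_one two_ne_zero]; ring
    rw [e]
    field_simp
  · intro t _
    refine HasDerivAt.hasDerivWithinAt ?_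
    refine (((hasDerivAt_pow 2 t).const_mul 2).sub_const 1).congr_deriv ?_
    norm_num; ring
  · intro a ha b hb h
    simp only at h
    have : a ^ 2 = b ^ 2 := by linarith
    exact (pow_left_inj₀ ha.1.le hb.1.le two_ne_zero).1 this

/-- The partial sums of the reproducing kernel at the endpoint are Gegenbauer polynomials. -/
lemma exists_sum_orthonormal_eq_geg {l : ℝ} (hl : 0 < l) {q : ℕ → Polynomial ℝ} (hq : ∀ k, (q k).degree = k)
    (ho : ∀ j k, (∫ t in (-1 : ℝ)..1, (q j).eval t * (q k).eval t * wJac (l - 1 / 2) (-(1 / 2)) t) =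
      if j = k then 1 else 0) :
    ∃ C, 0 < C ∧ ∀ n t, ∑ k ∈ Finset.range (n + 1), (q k).eval 1 * (q k).eval (2 * t ^ 2 - 1) =
      C * (geg (l + 1) (2 * n)).eval t := by
  have hqn : ∀ k, (q k).natDegree = k := fun k => Polynomial.natDegree_eq_of_degree_eq_some (hq k)
  set μ := bm (l + 1 / 2) with hμ
  set L : Polynomial ℝ → ℝ := fun p => ∫ t, p.eval (2 * t ^ 2 - 1) ∂μ with hL
  have hLI : ∀ p : Polynomial ℝ, Integrable (fun t => p.eval (2 * t ^ 2 - 1)) μ := fun p => by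
    have := integrable_polynomial_bm (p.comp (2 * Polynomial.X ^ 2 - 1)) (l + 1 / 2)
    simpa [Polynomial.eval_comp, hμ] using this
  have hLq : ∀ j k, 2 ^ l * L (q j * q k) = if j = k then 1 else 0 := fun j k => by
    rw [← ho, integral_wJac hl (fun t => (q j).eval t * (q k).eval t)]
    simp [hL, hμ]
  have h2l : (0 : ℝ) < 2 ^ l := by positivity
  choose G hGd hG using fun n => (geg_even_odd (l + 1) n).1
  set v := L 1 with hv
  have hv0 : 0 < v := by
    have := bm_moment_nat (κ := l + 1 / 2) (by positivity) 0
    simp only [hv, hL, Polynomial.eval_one]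
    simp only [mul_zero, pow_zero] at this
    rw [hμ, this]
    have := bmC_pos (κ := l + 1 / 2) (by positivity)
    have h1 : 0 < Gamma (((0 : ℕ) : ℝ) + 1 / 2) := Gamma_pos_of_pos (by norm_num)
    have h2 : 0 < Gamma (((0 : ℕ) : ℝ) + (l + 1 / 2) + 1 / 2) := Gamma_pos_of_pos (by positivity)
    positivity
  have hLG : ∀ n, L (G n) = v := by
    intro n
    induction n with
    | zero =>
      simp only [hL, ← hG, hv]
      simp [geg]
    | succ n ih =>
      rw [← ih]
      have h1 := integral_geg_eq_zero hl (N := 2 * n + 2) (by omega)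
      have h2 : ∫ t, ((2 * n : ℕ) + 2 + l) * (geg l (2 * n + 2)).eval t ∂μ =
          ∫ t, l * ((G (n + 1)).eval (2 * t ^ 2 - 1) - (G n).eval (2 * t ^ 2 - 1)) ∂μ := by
        refine integral_congr_ae (Filter.Eventually.of_forall fun t => ?_)
        simp only [← hG]
        exact geg_sub hl t (2 * n)
      rw [MeasureTheory.integral_const_mul, h1, MeasureTheory.integral_const_mul, integral_sub (hLI _) (hLI _)] at h2
      have := (mul_eq_zero.1 (h2.symm.trans (mul_zero _))).resolve_left hl.ne'
      simp only [hL]; linarith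
  have hLGp : ∀ n (p : Polynomial ℝ), p.natDegree ≤ n → L (G n * p) = p.eval 1 * v := by
    intro n p hp
    obtain ⟨s, hs⟩ := Polynomial.X_sub_C_dvd_sub_C_eval (p := p) (a := 1)
    have hsd : s = 0 ∨ s.natDegree < n := by
      by_cases h0 : s = 0
      · exact Or.inl h0
      · right
        have h1 := congrArg Polynomial.natDegree hs
        rw [Polynomial.natDegree_sub_C, Polynomial.natDegree_mul (Polynomial.X_sub_C_ne_zero 1) h0,
          Polynomial.natDegree_X_sub_C] at h1
        omega
    have hps : ∀ t, (G n * p).eval (2 * t ^ 2 - 1) = p.eval 1 * (G n).eval (2 * t ^ 2 - 1) -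
        2 * ((geg (l + 1) (2 * n)).eval t * s.eval (2 * t ^ 2 - 1) * (1 - t ^ 2)) := fun t => by
      have := congrArg (Polynomial.eval (2 * t ^ 2 - 1)) hs
      simp only [Polynomial.eval_sub, Polynomial.eval_C, Polynomial.eval_mul, Polynomial.eval_X] at this
      rw [Polynomial.eval_mul, hG]
      linear_combination (G n).eval (2 * t ^ 2 - 1) * this
    have hz : ∫ t, (geg (l + 1) (2 * n)).eval t * s.eval (2 * t ^ 2 - 1) * (1 - t ^ 2) ∂μ = 0 := by
      rw [hμ, ← integral_bm_add_one (by positivity) (fun t => (geg (l + 1) (2 * n)).eval t * s.eval (2 * t ^ 2 - 1))]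
      rcases hsd with h0 | h0
      · simp [h0]
      · have := integral_geg_mul_polynomial (c := l + 1) (by positivity) (N := 2 * n)
          (s.comp (2 * Polynomial.X ^ 2 - 1)) (by
            refine Polynomial.natDegree_comp_le.trans_lt ?_
            have : (2 * Polynomial.X ^ 2 - 1 : Polynomial ℝ).natDegree ≤ 2 := by compute_degree
            nlinarith)
        rw [show l + 1 / 2 + 1 = l + 1 + 1 / 2 by ring]
        simpa [Polynomial.eval_comp] using this
    have hI : Integrable (fun t => (geg (l + 1) (2 * n)).eval t * s.eval (2 * t ^ 2 - 1) * (1 - t ^ 2)) μ := by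
      have := integrable_polynomial_bm (geg (l + 1) (2 * n) * s.comp (2 * Polynomial.X ^ 2 - 1) * (1 - Polynomial.X ^ 2)) (l + 1 / 2)
      simpa [Polynomial.eval_comp, hμ] using this
    simp only [hL, hps]
    rw [integral_sub ((hLI _).const_mul _) (hI.const_mul _), MeasureTheory.integral_const_mul,
      MeasureTheory.integral_const_mul, hz]
    have := hLG n
    simp only [hL] at this
    rw [this]; ring
  refine ⟨(2 ^ l * v)⁻¹, by positivity, fun n t => ?_⟩
  obtain ⟨c, hc⟩ := exists_sum_of_natDegree_le hq n (G n) (hGd n)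
  have hcj : ∀ j ∈ Finset.range (n + 1), c j = 2 ^ l * v * (q j).eval 1 := by
    intro j hj
    have h1 := hLGp n (q j) (by rw [hqn]; have := Finset.mem_range.1 hj; omega)
    have h2 : L (G n * q j) = ∑ k ∈ Finset.range (n + 1), c k * L (q k * q j) := by
      simp only [hL]
      rw [show (fun t => (G n * q j).eval (2 * t ^ 2 - 1)) = fun t => ∑ k ∈ Finset.range (n + 1),
        c k * (q k * q j).eval (2 * t ^ 2 - 1) by
          ext t
          conv_lhs => rw [hc]
          rw [Polynomial.eval_mul, Polynomial.eval_finsetSum, Finset.sum_mul]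
          exact Finset.sum_congr rfl fun k _ => by simp only [Polynomial.eval_mul, Polynomial.eval_C]; ring,
        MeasureTheory.integral_finsetSum _ fun k _ => (hLI _).const_mul _]
      exact Finset.sum_congr rfl fun k _ => MeasureTheory.integral_const_mul _ _
    have h3 : 2 ^ l * L (G n * q j) = c j := by
      rw [h2, Finset.mul_sum, Finset.sum_congr rfl fun k _ => show 2 ^ l * (c k * L (q k * q j)) = if k = j then c k else 0 by
        rw [mul_left_comm, hLq]; simp, Finset.sum_ite_eq' _ _ c, if_pos hj]
    rw [← h3, h1]; ring
  rw [hG, hc, Polynomial.eval_finsetSum, Finset.mul_sum]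
  refine Finset.sum_congr rfl fun k hk => ?_
  rw [Polynomial.eval_mul, Polynomial.eval_C, hcj k hk]
  field_simp

lemma exists_sum_orthonormal_eq_cesPoly {l : ℝ} (hl : 0 < l) {q : ℕ → Polynomial ℝ} (hq : ∀ k, (q k).degree = k)
    (ho : ∀ j k, (∫ t in (-1 : ℝ)..1, (q j).eval t * (q k).eval t * wJac (l - 1 / 2) (-(1 / 2)) t) =
      if j = k then 1 else 0) :
    ∃ C, 0 < C ∧ ∀ δ n t, ∑ k ∈ Finset.range (n + 1), rc (δ + 1) (n - k) * (q k).eval 1 * (q k).eval (2 * t ^ 2 - 1) =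
      C * (cesPoly δ l n).eval t := by
  obtain ⟨C, hC, h⟩ := exists_sum_orthonormal_eq_geg hl hq ho
  refine ⟨C, hC, fun δ n t => ?_⟩
  have abel : ∀ g : ℕ → ℝ, ∀ n, ∑ k ∈ Finset.range (n + 1), rc (δ + 1) (n - k) * g k =
      ∑ k ∈ Finset.range (n + 1), rc δ (n - k) * ∑ j ∈ Finset.range (k + 1), g j := by
    intro g n
    simp only [Finset.mul_sum]
    rw [Finset.sum_comm' (t' := Finset.range (n + 1)) (s' := fun j => Finset.Ico j (n + 1))
      (by intro x y; simp only [Finset.mem_range, Finset.mem_Ico]; omega)]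
    refine Finset.sum_congr rfl fun j hj => ?_
    have hj := Finset.mem_range.1 hj
    rw [← Finset.sum_mul, Finset.sum_Ico_eq_sum_range, rc_add_one_eq_sum, ← Finset.sum_range_reflect,
      show n - j + 1 = n + 1 - j by omega]
    congr 1
    refine Finset.sum_congr rfl fun i hi => ?_
    have hi := Finset.mem_range.1 hi
    congr 1; omega
  rw [cesPoly_eval, Finset.mul_sum]
  simp only [mul_assoc]
  rw [abel]
  refine Finset.sum_congr rfl fun k _ => ?_
  rw [h]; ring

lemma lintegral_pi_prod_eq_prod {n : ℕ} (μ : Fin n → Measure ℝ) [∀ i, SigmaFinite (μ i)]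
    {f : Fin n → ℝ → ENNReal} (hf : ∀ i, Measurable (f i)) :
    ∫⁻ x, ∏ i, f i (x i) ∂Measure.pi μ = ∏ i, ∫⁻ t, f i t ∂μ i := by
  induction n with
  | zero => simp
  | succ n ih =>
    rw [← (measurePreserving_piFinSuccAbove μ 0).symm.lintegral_comp_emb (MeasurableEquiv.measurableEmbedding _)]
    simp only [Fin.prod_univ_succ]
    have : ∀ p : ℝ × (Fin n → ℝ), f 0 ((MeasurableEquiv.piFinSuccAbove (fun _ => ℝ) 0).symm p 0) *
        ∏ i : Fin n, f i.succ ((MeasurableEquiv.piFinSuccAbove (fun _ => ℝ) 0).symm p i.succ) =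
        f 0 p.1 * ∏ i : Fin n, f i.succ (p.2 i) := by
      intro p
      simp [MeasurableEquiv.piFinSuccAbove, Fin.insertNthEquiv]
    simp only [this]
    have hm : Measurable fun x : Fin n → ℝ => ∏ i : Fin n, f i.succ (x i) :=
      Finset.measurable_prod _ fun i _ => (hf i.succ).comp (measurable_pi_apply i)
    rw [lintegral_prod_mul (hf 0).aemeasurable hm.aemeasurable]
    congr 1
    exact ih (fun i => μ i.succ) fun i => hf i.succ

lemma lintegral_Ioi_rpow_mul_exp {a : ℝ} (ha : 0 < a) :
    ∫⁻ t in Set.Ioi (0 : ℝ), ENNReal.ofReal (t ^ (a - 1) * rexp (-t)) = ENNReal.ofReal (Gamma a) := by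
  rw [← ofReal_integral_eq_lintegral_ofReal]
  · rw [Gamma_eq_integral ha]
    congr 1
    exact integral_congr_ae (Filter.Eventually.of_forall fun t => mul_comm _ _)
  · have := GammaIntegral_convergent ha
    exact this.congr (Filter.Eventually.of_forall fun t => mul_comm _ _)
  · filter_upwards [ae_restrict_mem measurableSet_Ioi] with t ht
    have : (0 : ℝ) < t := ht
    positivity

lemma lintegral_comp_smul_pi {d : ℕ} {s : ℝ} (hs : 0 < s) {f : (Fin d → ℝ) → ENNReal} :
    ∫⁻ x, f x = ENNReal.ofReal (s ^ d) * ∫⁻ x, f (s • x) := by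
  have h : ∫⁻ x, f (s • x) = ∫⁻ x, f x ∂(Measure.map (fun x : Fin d → ℝ => s • x) volume) :=
    ((Homeomorph.smulOfNeZero s hs.ne').measurableEmbedding.lintegral_map f).symm
  rw [h, Measure.map_addHaar_smul volume hs.ne', lintegral_smul_measure]
  have : (0 : ℝ) < s ^ d := by positivity
  simp only [Module.finrank_fintype_fun_eq_card, Fintype.card_fin, smul_eq_mul, ← mul_assoc]
  rw [← ENNReal.ofReal_mul (by positivity), abs_of_pos (by positivity), mul_inv_cancel₀ this.ne']
  simp

/-- The function `u ^ (a - 1)` cut off outside a set `S`. -/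
noncomputable def cutPow (S : Set ℝ) (a u : ℝ) : ENNReal :=
  S.indicator (fun u => ENNReal.ofReal (u ^ (a - 1))) u

lemma measurable_cutPow {S : Set ℝ} (hS : MeasurableSet S) (a : ℝ) : Measurable (cutPow S a) :=
  Measurable.indicator (by fun_prop) hS

lemma cutPow_mul {S : Set ℝ} (h0 : S ⊆ Set.Ici 0) (hS : ∀ s > 0, ∀ u, s * u ∈ S ↔ u ∈ S) {s : ℝ}
    (hs : 0 < s) (a u : ℝ) : cutPow S a (s * u) = ENNReal.ofReal (s ^ (a - 1)) * cutPow S a u := by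
  unfold cutPow
  by_cases hu : u ∈ S
  · rw [Set.indicator_of_mem ((hS s hs u).2 hu), Set.indicator_of_mem hu,
      ← ENNReal.ofReal_mul (by positivity), mul_rpow hs.le (h0 hu)]
  · rw [Set.indicator_of_notMem (fun h => hu ((hS s hs u).1 h)), Set.indicator_of_notMem hu, mul_zero]

lemma lintegral_cutPow_mul_exp {S : Set ℝ} (hm : MeasurableSet S) (h0 : S ⊆ Set.Ici 0)
    (h1 : Set.Ioi 0 ⊆ S) {a : ℝ} (ha : 0 < a) :
    ∫⁻ u, cutPow S a u * ENNReal.ofReal (rexp (-u)) = ENNReal.ofReal (Gamma a) := by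
  have h : S =ᵐ[volume] Set.Ioi 0 := by
    have h2 : Set.Ici (0:ℝ) =ᵐ[volume] Set.Ioi 0 := Ioi_ae_eq_Ici.symm
    filter_upwards [h2] with x hx
    have hx' : (x ∈ Set.Ici (0:ℝ)) = (x ∈ Set.Ioi (0:ℝ)) := hx
    show (x ∈ S) = (x ∈ Set.Ioi (0:ℝ))
    apply propext
    exact ⟨fun h => hx' ▸ h0 h, fun h => h1 h⟩
  rw [← lintegral_Ioi_rpow_mul_exp ha, ← setLIntegral_congr h, ← lintegral_indicator hm]
  refine lintegral_congr fun u => ?_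
  unfold cutPow
  by_cases hu : u ∈ S
  · rw [Set.indicator_of_mem hu, Set.indicator_of_mem hu, ENNReal.ofReal_mul' (exp_pos _).le]
  · rw [Set.indicator_of_notMem hu, Set.indicator_of_notMem hu, zero_mul]

lemma lintegral_dirichlet_aux {d : ℕ} {α : Fin (d + 1) → ℝ} (hα : ∀ j, 0 < α j) {S : Set ℝ}
    (hm : MeasurableSet S) (h0 : S ⊆ Set.Ici 0) (h1 : Set.Ioi 0 ⊆ S)
    (hS : ∀ s > 0, ∀ u, s * u ∈ S ↔ u ∈ S) :
    ENNReal.ofReal (Gamma (∑ j, α j)) * ∫⁻ x : Fin d → ℝ,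
      cutPow S (α (Fin.last d)) (1 - ∑ j, x j) * ∏ j, cutPow S (α j.castSucc) (x j) =
      ENNReal.ofReal (∏ j, Gamma (α j)) := by
  have hmeas := fun j => measurable_cutPow hm (α j)
  have hI := lintegral_pi_prod_eq_prod (fun _ : Fin (d + 1) => (volume : Measure ℝ))
    (f := fun j u => cutPow S (α j) u * ENNReal.ofReal (rexp (-u)))
    (fun j => (hmeas j).mul (by fun_prop))
  simp only [lintegral_cutPow_mul_exp hm h0 h1 (hα _)] at hI
  rw [← ENNReal.ofReal_prod_of_nonneg fun j _ => (Gamma_pos_of_pos (hα j)).le] at hI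
  rw [← hI, ← (measurePreserving_piFinSuccAbove (fun _ : Fin (d + 1) => (volume : Measure ℝ))
    (Fin.last d)).symm.lintegral_comp_emb (MeasurableEquiv.measurableEmbedding _)]
  have hp : ∀ p : ℝ × (Fin d → ℝ), ∏ i, cutPow S (α i)
      ((MeasurableEquiv.piFinSuccAbove (fun _ => ℝ) (Fin.last d)).symm p i) *
      ENNReal.ofReal (rexp (-((MeasurableEquiv.piFinSuccAbove (fun _ => ℝ) (Fin.last d)).symm p i))) =
      (cutPow S (α (Fin.last d)) p.1 * ∏ j : Fin d, cutPow S (α j.castSucc) (p.2 j)) *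
        ENNReal.ofReal (rexp (-(p.1 + ∑ j, p.2 j))) := by
    intro p
    rw [Fin.prod_univ_castSucc]
    simp only [MeasurableEquiv.piFinSuccAbove, Fin.insertNthEquiv, MeasurableEquiv.coe_mk,
      MeasurableEquiv.symm_mk, Equiv.symm_symm, Equiv.coe_fn_mk, Fin.insertNth_last', Fin.snoc_last,
      Fin.snoc_castSucc]
    rw [neg_add, exp_add, ENNReal.ofReal_mul (exp_pos _).le, ← Finset.sum_neg_distrib, exp_sum,
      ENNReal.ofReal_prod_of_nonneg fun j _ => (exp_pos _).le, Finset.prod_mul_distrib]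
    ring
  simp only [hp]
  have hm1 : Measurable fun p : ℝ × (Fin d → ℝ) => (cutPow S (α (Fin.last d)) p.1 *
      ∏ j : Fin d, cutPow S (α j.castSucc) (p.2 j)) * ENNReal.ofReal (rexp (-(p.1 + ∑ j, p.2 j))) := by
    refine Measurable.mul (Measurable.mul ((hmeas _).comp measurable_fst)
      (Finset.measurable_prod _ fun j _ => (hmeas _).comp (by fun_prop))) (by fun_prop)
  have hm2 : Measurable fun p : (Fin d → ℝ) × ℝ => (cutPow S (α (Fin.last d)) (p.2 - ∑ j, p.1 j) *
      ∏ j : Fin d, cutPow S (α j.castSucc) (p.1 j)) * ENNReal.ofReal (rexp (-p.2)) := by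
    refine Measurable.mul (Measurable.mul ((hmeas _).comp (by fun_prop))
      (Finset.measurable_prod _ fun j _ => (hmeas _).comp (by fun_prop))) (by fun_prop)
  rw [lintegral_prod_symm _ hm1.aemeasurable]
  have hshift : ∀ x : Fin d → ℝ, ∫⁻ s, (cutPow S (α (Fin.last d)) s *
      ∏ j : Fin d, cutPow S (α j.castSucc) (x j)) * ENNReal.ofReal (rexp (-(s + ∑ j, x j))) =
      ∫⁻ s, (cutPow S (α (Fin.last d)) (s - ∑ j, x j) *
      ∏ j : Fin d, cutPow S (α j.castSucc) (x j)) * ENNReal.ofReal (rexp (-s)) := by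
    intro x
    rw [← lintegral_sub_right_eq_self _ (∑ j, x j)]
    simp
  simp only [hshift]
  rw [show (Measure.pi fun j => (volume : Measure ℝ)) = (volume : Measure (Fin d → ℝ)) from rfl,
    lintegral_lintegral_swap hm2.aemeasurable]
  set D := ∫⁻ x : Fin d → ℝ,
      cutPow S (α (Fin.last d)) (1 - ∑ j, x j) * ∏ j, cutPow S (α j.castSucc) (x j) with hD
  have hmul : ∀ s : ℝ, ∫⁻ x : Fin d → ℝ, (cutPow S (α (Fin.last d)) (s - ∑ j, x j) *
      ∏ j : Fin d, cutPow S (α j.castSucc) (x j)) * ENNReal.ofReal (rexp (-s)) =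
      (∫⁻ x : Fin d → ℝ, (cutPow S (α (Fin.last d)) (s - ∑ j, x j) *
      ∏ j : Fin d, cutPow S (α j.castSucc) (x j))) * ENNReal.ofReal (rexp (-s)) := by
    intro s
    rw [lintegral_mul_const' _ _ ENNReal.ofReal_ne_top]
  simp only [hmul]
  have hinner : ∀ s : ℝ, s ≠ 0 → (∫⁻ x : Fin d → ℝ, (cutPow S (α (Fin.last d)) (s - ∑ j, x j) *
      ∏ j : Fin d, cutPow S (α j.castSucc) (x j))) * ENNReal.ofReal (rexp (-s)) =
      (Set.Ioi (0:ℝ)).indicator (fun s => ENNReal.ofReal (s ^ (∑ j, α j - 1) * rexp (-s))) s * D := by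
    intro s hs0
    rcases lt_or_gt_of_ne hs0 with hs | hs
    · rw [Set.indicator_of_notMem (by simp [hs.le]), zero_mul]
      have : ∀ x : Fin d → ℝ, (cutPow S (α (Fin.last d)) (s - ∑ j, x j) *
          ∏ j : Fin d, cutPow S (α j.castSucc) (x j)) = 0 := by
        intro x
        by_cases hx : ∀ j, x j ∈ S
        · have h2 : 0 ≤ ∑ j, x j := Finset.sum_nonneg fun j _ => h0 (hx j)
          have : s - ∑ j, x j ∉ S := fun h => by
            have := h0 h
            simp only [Set.mem_Ici] at this
            linarith
          rw [cutPow, Set.indicator_of_notMem this, zero_mul]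
        · push Not at hx
          obtain ⟨j, hj⟩ := hx
          rw [Finset.prod_eq_zero (Finset.mem_univ j), mul_zero]
          rw [cutPow, Set.indicator_of_notMem hj]
      simp [this]
    · rw [lintegral_comp_smul_pi hs, Set.indicator_of_mem (by exact hs)]
      have h2 : ∀ x : Fin d → ℝ, cutPow S (α (Fin.last d)) (s - ∑ j, (s • x) j) *
          ∏ j : Fin d, cutPow S (α j.castSucc) ((s • x) j) =
          ENNReal.ofReal (∏ j, s ^ (α j - 1)) * (cutPow S (α (Fin.last d)) (1 - ∑ j, x j) *
            ∏ j, cutPow S (α j.castSucc) (x j)) := by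
        intro x
        have : s - ∑ j, (s • x) j = s * (1 - ∑ j, x j) := by
          simp [mul_sub, Finset.mul_sum]
        rw [this]
        simp only [Pi.smul_apply, smul_eq_mul, cutPow_mul h0 hS hs]
        rw [ENNReal.ofReal_prod_of_nonneg fun j _ => by positivity, Fin.prod_univ_castSucc,
          Finset.prod_mul_distrib]
        ring
      simp only [h2]
      rw [lintegral_const_mul' _ _ ENNReal.ofReal_ne_top, ← hD,
        ENNReal.ofReal_mul (by positivity)]
      have h3 : s ^ (∑ j, α j - 1) = s ^ d * ∏ j, s ^ (α j - 1) := by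
        rw [← rpow_sum_of_pos hs, ← rpow_natCast, ← rpow_add hs, Finset.sum_sub_distrib]
        congr 1
        simp
        ring
      rw [h3, ENNReal.ofReal_mul (by positivity)]
      ring
  rw [lintegral_congr_ae (g := fun s => (Set.Ioi (0:ℝ)).indicator
    (fun s => ENNReal.ofReal (s ^ (∑ j, α j - 1) * rexp (-s))) s * D),
    lintegral_mul_const _ (Measurable.indicator (by fun_prop) measurableSet_Ioi),
    lintegral_indicator measurableSet_Ioi, lintegral_Ioi_rpow_mul_exp]
  · exact Finset.sum_pos (fun j _ => hα j) Finset.univ_nonempty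
  · filter_upwards [Measure.ae_ne volume (0:ℝ)] with s hs using hinner s hs

lemma xext_castSucc {d : ℕ} (x : Fin d → ℝ) (j : Fin d) : xext d x j.castSucc = x j := by
  simp [xext]

lemma xext_last {d : ℕ} (x : Fin d → ℝ) : xext d x (Fin.last d) = 1 - ∑ j, x j := by
  simp [xext]

lemma sum_xext {d : ℕ} (x : Fin d → ℝ) : ∑ j, xext d x j = 1 := by
  simp [Fin.sum_univ_castSucc, xext_castSucc, xext_last]

lemma mem_simplexT_iff {d : ℕ} {x : Fin d → ℝ} : x ∈ simplexT d ↔ ∀ j, 0 ≤ xext d x j := by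
  simp [simplexT, Fin.forall_fin_succ', xext_castSucc, xext_last]

lemma xext_le_one {d : ℕ} {x : Fin d → ℝ} (hx : x ∈ simplexT d) (j : Fin (d + 1)) :
    xext d x j ≤ 1 := by
  rw [← sum_xext x]
  exact Finset.single_le_sum (fun i _ => mem_simplexT_iff.1 hx i) (Finset.mem_univ j)

lemma continuous_xext {d : ℕ} (j : Fin (d + 1)) : Continuous fun x => xext d x j := by
  refine Fin.lastCases ?_ (fun j => ?_) j
  · simp only [xext_last]; fun_prop
  · simp only [xext_castSucc]; fun_prop

lemma isClosed_simplexT (d : ℕ) : IsClosed (simplexT d) := by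
  have : simplexT d = ⋂ j, {x | 0 ≤ xext d x j} := by
    ext x; simp [mem_simplexT_iff]
  rw [this]
  exact isClosed_iInter fun j => isClosed_le continuous_const (continuous_xext j)

lemma measurableSet_simplexT (d : ℕ) : MeasurableSet (simplexT d) := (isClosed_simplexT d).measurableSet

/-- The Dirichlet density on the simplex. -/
noncomputable def dirD {d : ℕ} (α : Fin (d + 1) → ℝ) (x : Fin d → ℝ) : ℝ :=
  ∏ j, xext d x j ^ (α j - 1)

lemma measurable_dirD {d : ℕ} (α : Fin (d + 1) → ℝ) : Measurable (dirD α) :=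
  Finset.measurable_prod _ fun j _ => (continuous_xext j).measurable.pow_const _

lemma dirD_nonneg {d : ℕ} (α : Fin (d + 1) → ℝ) {x : Fin d → ℝ} (hx : x ∈ simplexT d) :
    0 ≤ dirD α x :=
  Finset.prod_nonneg fun j _ => rpow_nonneg (mem_simplexT_iff.1 hx j) _

lemma lintegral_cutPow_eq {d : ℕ} (α : Fin (d + 1) → ℝ) {S : Set ℝ} (hm : MeasurableSet S)
    (h0 : S ⊆ Set.Ici 0) :
    ∫⁻ x : Fin d → ℝ, cutPow S (α (Fin.last d)) (1 - ∑ j, x j) * ∏ j, cutPow S (α j.castSucc) (x j) =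
      ∫⁻ x in {x | ∀ j, xext d x j ∈ S}, ENNReal.ofReal (dirD α x) := by
  have hms : MeasurableSet {x | ∀ j, xext d x j ∈ S} := by
    rw [Set.ofPred_forall]
    exact MeasurableSet.iInter fun j => (continuous_xext j).measurable hm
  rw [← lintegral_indicator hms]
  refine lintegral_congr fun x => ?_
  have : cutPow S (α (Fin.last d)) (1 - ∑ j, x j) * ∏ j, cutPow S (α j.castSucc) (x j) =
      ∏ j, cutPow S (α j) (xext d x j) := by
    rw [Fin.prod_univ_castSucc]
    simp only [xext_castSucc, xext_last]
    ring
  rw [this]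
  by_cases hx : ∀ j, xext d x j ∈ S
  · rw [Set.indicator_of_mem (by exact hx), dirD,
      ENNReal.ofReal_prod_of_nonneg fun j _ => rpow_nonneg (h0 (hx j)) _]
    exact Finset.prod_congr rfl fun j _ => by rw [cutPow, Set.indicator_of_mem (hx j)]
  · rw [Set.indicator_of_notMem (by exact hx)]
    push Not at hx
    obtain ⟨j, hj⟩ := hx
    exact Finset.prod_eq_zero (Finset.mem_univ j) (by rw [cutPow, Set.indicator_of_notMem hj])

lemma lintegral_dirD {d : ℕ} {α : Fin (d + 1) → ℝ} (hα : ∀ j, 0 < α j) {S : Set ℝ}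
    (hm : MeasurableSet S) (h0 : S ⊆ Set.Ici 0) (h1 : Set.Ioi 0 ⊆ S)
    (hS : ∀ s > 0, ∀ u, s * u ∈ S ↔ u ∈ S) :
    ∫⁻ x in {x | ∀ j, xext d x j ∈ S}, ENNReal.ofReal (dirD α x) =
      ENNReal.ofReal ((∏ j, Gamma (α j)) / Gamma (∑ j, α j)) := by
  have h := lintegral_dirichlet_aux hα hm h0 h1 hS
  rw [lintegral_cutPow_eq α hm h0] at h
  have hG : 0 < Gamma (∑ j, α j) :=
    Gamma_pos_of_pos (Finset.sum_pos (fun j _ => hα j) Finset.univ_nonempty)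
  rw [ENNReal.ofReal_div_of_pos hG, ← h, mul_comm, ENNReal.mul_div_cancel_right (by simpa using hG)
    ENNReal.ofReal_ne_top]

lemma setLIntegral_simplexT_dirD {d : ℕ} {α : Fin (d + 1) → ℝ} (hα : ∀ j, 0 < α j) :
    ∫⁻ x in simplexT d, ENNReal.ofReal (dirD α x) =
      ENNReal.ofReal ((∏ j, Gamma (α j)) / Gamma (∑ j, α j)) := by
  rw [← lintegral_dirD hα (S := Set.Ici 0) measurableSet_Ici subset_rfl Set.Ioi_subset_Ici_self
    (fun s hs u => by simp [mul_nonneg_iff_of_pos_left hs])]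
  congr 2
  ext x
  simp [mem_simplexT_iff]

lemma ae_xext_pos (d : ℕ) : ∀ᵐ x ∂volume.restrict (simplexT d), ∀ j, 0 < xext d x j := by
  have h1 := setLIntegral_simplexT_dirD (d := d) (α := fun _ => 1) (fun _ => one_pos)
  have h2 := lintegral_dirD (d := d) (α := fun _ => 1) (fun _ => one_pos) (S := Set.Ioi 0)
    measurableSet_Ioi Set.Ioi_subset_Ici_self subset_rfl (fun s hs u => by simp [hs])
  simp only [dirD, sub_self, rpow_zero, Finset.prod_const_one, ENNReal.ofReal_one,
    lintegral_one, Measure.restrict_apply_univ] at h1 h2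
  rw [ae_restrict_iff' (measurableSet_simplexT d), ae_iff]
  have hms : MeasurableSet {x | ∀ j, xext d x j ∈ Set.Ioi (0:ℝ)} := by
    rw [Set.ofPred_forall]
    exact MeasurableSet.iInter fun j => (continuous_xext j).measurable measurableSet_Ioi
  have : {x | ¬(x ∈ simplexT d → ∀ j, 0 < xext d x j)} =
      simplexT d \ {x | ∀ j, xext d x j ∈ Set.Ioi (0:ℝ)} := by
    ext x; simp
  rw [this, measure_sdiff (fun x hx => mem_simplexT_iff.2 fun j => (hx j).le) hms.nullMeasurableSet
    (by rw [h2]; exact ENNReal.ofReal_ne_top), h1, h2, tsub_self]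

/-- The Dirichlet measure on the simplex. -/
noncomputable def dirM (d : ℕ) (α : Fin (d + 1) → ℝ) : Measure (Fin d → ℝ) :=
  (volume.restrict (simplexT d)).withDensity fun x => ENNReal.ofReal (dirD α x)

lemma dirM_absolutelyContinuous (d : ℕ) (α : Fin (d + 1) → ℝ) :
    dirM d α ≪ volume.restrict (simplexT d) := withDensity_absolutelyContinuous _ _

lemma ae_dirM_mem (d : ℕ) (α : Fin (d + 1) → ℝ) : ∀ᵐ x ∂dirM d α, x ∈ simplexT d :=
  (dirM_absolutelyContinuous d α).ae_le (ae_restrict_mem (measurableSet_simplexT d))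

lemma isFiniteMeasure_dirM {d : ℕ} {α : Fin (d + 1) → ℝ} (hα : ∀ j, 0 < α j) :
    IsFiniteMeasure (dirM d α) := by
  refine ⟨?_⟩
  rw [dirM, withDensity_apply _ MeasurableSet.univ, Measure.restrict_univ,
    setLIntegral_simplexT_dirD hα]
  exact ENNReal.ofReal_lt_top

lemma dirM_real_univ {d : ℕ} {α : Fin (d + 1) → ℝ} (hα : ∀ j, 0 < α j) :
    (dirM d α).real Set.univ = (∏ j, Gamma (α j)) / Gamma (∑ j, α j) := by
  rw [measureReal_def, dirM, withDensity_apply _ MeasurableSet.univ, Measure.restrict_univ,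
    setLIntegral_simplexT_dirD hα, ENNReal.toReal_ofReal]
  exact div_nonneg (Finset.prod_nonneg fun j _ => (Gamma_pos_of_pos (hα j)).le)
    (Gamma_pos_of_pos (Finset.sum_pos (fun j _ => hα j) Finset.univ_nonempty)).le

lemma integral_dirM {d : ℕ} (α : Fin (d + 1) → ℝ) (f : (Fin d → ℝ) → ℝ) :
    ∫ x, f x ∂dirM d α = ∫ x in simplexT d, dirD α x * f x := by
  rw [dirM, integral_withDensity_eq_integral_toReal_smul (measurable_dirD α).ennreal_ofReal
    (Filter.Eventually.of_forall fun x => ENNReal.ofReal_lt_top)]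
  refine setIntegral_congr_fun (measurableSet_simplexT d) fun x hx => ?_
  simp [ENNReal.toReal_ofReal (dirD_nonneg α hx)]

lemma integral_dirM_mul_prod {d : ℕ} (α p : Fin (d + 1) → ℝ) (f : (Fin d → ℝ) → ℝ) :
    ∫ x, (∏ j, xext d x j ^ p j) * f x ∂dirM d α = ∫ x, f x ∂dirM d (fun j => α j + p j) := by
  rw [integral_dirM, integral_dirM]
  refine integral_congr_ae ?_
  filter_upwards [ae_xext_pos d] with x hx
  rw [← mul_assoc]
  congr 1
  rw [dirD, dirD, ← Finset.prod_mul_distrib]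
  refine Finset.prod_congr rfl fun j _ => ?_
  rw [← rpow_add (hx j)]
  ring_nf

lemma integral_dirM_prod {d : ℕ} {α p : Fin (d + 1) → ℝ} (hα : ∀ j, 0 < α j + p j) :
    ∫ x, (∏ j, xext d x j ^ p j) ∂dirM d α =
      (∏ j, Gamma (α j + p j)) / Gamma (∑ j, (α j + p j)) := by
  have := integral_dirM_mul_prod α p (fun _ => 1)
  simp only [mul_one] at this
  rw [this, MeasureTheory.integral_const, dirM_real_univ hα, smul_eq_mul, mul_one]

lemma WT_eq_dirD {d : ℕ} (κ : Fin (d + 1) → ℝ) : WT d κ = dirD fun j => κ j + 1 / 2 := by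
  ext x
  rw [WT, dirD, Fin.prod_univ_castSucc]
  simp only [xext_castSucc, xext_last]
  have h : ∀ a : ℝ, a + 1 / 2 - 1 = a - 1 / 2 := fun a => by ring
  simp only [h]

lemma two_mul_factorial_eq (p : ℕ) :
    ((2 * p).factorial : ℝ) = 4 ^ p * p.factorial * Gamma (p + 1 / 2) / √π := by
  have hpi : √π ≠ 0 := by positivity
  induction p with
  | zero =>
    rw [Nat.cast_zero, zero_add, Gamma_one_half_eq]
    simp [hpi]
  | succ p ih =>
    rw [show 2 * (p + 1) = 2 * p + 1 + 1 by ring, Nat.factorial_succ, Nat.factorial_succ,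
      Nat.factorial_succ]
    push_cast
    rw [ih, show (p : ℝ) + 1 + 1 / 2 = (p + 1 / 2) + 1 by ring, Gamma_add_one (by positivity)]
    field_simp
    ring

lemma bm_moment_div_factorial {κ : ℝ} (hκ : 0 ≤ κ) (p : ℕ) :
    (∫ t, t ^ (2 * p) ∂bm κ) / (2 * p).factorial =
      bmC κ * √π / (4 ^ p * p.factorial * Gamma (p + κ + 1 / 2)) := by
  rw [bm_moment_nat hκ, two_mul_factorial_eq]
  have h1 : 0 < Gamma ((p:ℝ) + 1 / 2) := Gamma_pos_of_pos (by positivity)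
  have h2 : 0 < Gamma ((p:ℝ) + κ + 1 / 2) := Gamma_pos_of_pos (by positivity)
  have h3 : (0:ℝ) < p.factorial := by positivity
  generalize Gamma ((p:ℝ) + 1 / 2) = G at *
  generalize Gamma ((p:ℝ) + κ + 1 / 2) = G' at *
  generalize (p.factorial : ℝ) = F at *
  field_simp

lemma integral_pi_bm_pow {m : ℕ} (κ a : Fin m → ℝ) (N : ℕ) :
    ∫ t, (∑ j, a j * t j) ^ N ∂Measure.pi (fun j => bm (κ j)) =
      ∑ ν ∈ piAntidiag univ N, (N.factorial : ℝ) *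
        ∏ j, (a j ^ ν j * ((∫ t, t ^ ν j ∂bm (κ j)) / (ν j).factorial)) := by
  simp only [Finset.sum_pow_eq_sum_piAntidiag]
  rw [MeasureTheory.integral_finsetSum]
  · refine Finset.sum_congr rfl fun ν hν => ?_
    rw [MeasureTheory.integral_const_mul]
    have h1 := integral_fintype_prod_eq_prod (𝕜 := ℝ) (μ := fun j => bm (κ j))
      (fun j (t : ℝ) => (a j * t) ^ ν j)
    rw [h1]
    have hs := Nat.multinomial_spec univ ν
    rw [(mem_piAntidiag.1 hν).1] at hs
    rw [← hs]
    push_cast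
    simp only [mul_pow, MeasureTheory.integral_const_mul]
    rw [mul_comm (∏ j, ((ν j).factorial : ℝ)), mul_assoc, ← Finset.prod_mul_distrib]
    congr 1
    refine Finset.prod_congr rfl fun j _ => ?_
    have : ((ν j).factorial : ℝ) ≠ 0 := by positivity
    field_simp
  · intro ν _
    refine Integrable.const_mul ?_ _
    refine Integrable.fintype_prod (f := fun j (t : ℝ) => (a j * t) ^ ν j) fun j => ?_
    have := integrable_polynomial_bm ((Polynomial.C (a j) * Polynomial.X) ^ ν j) (κ j)
    simpa using this

lemma integral_pi_bm_pow_odd {m : ℕ} (κ a : Fin m → ℝ) {N : ℕ} (hN : Odd N) :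
    ∫ t, (∑ j, a j * t j) ^ N ∂Measure.pi (fun j => bm (κ j)) = 0 := by
  rw [integral_pi_bm_pow]
  refine Finset.sum_eq_zero fun ν hν => ?_
  have h : ∃ j, Odd (ν j) := by
    by_contra! h
    have : Even (∑ j, ν j) := Finset.even_sum _ fun j _ => by simpa using h j
    have h2 : ∑ j, ν j = N := (mem_piAntidiag.1 hν).1
    rw [h2] at this
    exact (Nat.not_even_iff_odd.2 hN) this
  obtain ⟨j, hj⟩ := h
  rw [Finset.prod_eq_zero (Finset.mem_univ j) (by rw [bm_moment_odd hj]; simp), mul_zero]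

lemma integral_pi_bm_pow_even {m : ℕ} {κ : Fin m → ℝ} (hκ : ∀ j, 0 ≤ κ j) (a : Fin m → ℝ) (P : ℕ) :
    ∫ t, (∑ j, a j * t j) ^ (2 * P) ∂Measure.pi (fun j => bm (κ j)) =
      ∑ p ∈ piAntidiag univ P, ((2 * P).factorial : ℝ) * ∏ j, ((a j ^ 2) ^ p j *
        (bmC (κ j) * √π / (4 ^ p j * (p j).factorial * Gamma (p j + κ j + 1 / 2)))) := by
  rw [integral_pi_bm_pow]
  symm
  refine Finset.sum_of_injOn (fun p j => 2 * p j) ?_ ?_ ?_ ?_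
  · intro p _ p' _ h
    funext j
    have := congrFun h j
    simpa using this
  · intro p hp
    have := (mem_piAntidiag.1 (Finset.mem_coe.1 hp)).1
    rw [Finset.mem_coe, mem_piAntidiag]
    refine ⟨?_, by simp⟩
    rw [← this, ← Finset.mul_sum]
  · intro ν hν hni
    have h : ∃ j, Odd (ν j) := by
      by_contra! h
      apply hni
      have h' : ∀ j, Even (ν j) := fun j => by simpa using h j
      refine ⟨fun j => ν j / 2, ?_, ?_⟩
      · rw [Finset.mem_coe, mem_piAntidiag]
        refine ⟨?_, by simp⟩
        have h2 : ∑ j, ν j = 2 * P := (mem_piAntidiag.1 hν).1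
        have h3 : ∑ j, ν j = 2 * ∑ j, ν j / 2 := by
          rw [Finset.mul_sum]
          exact Finset.sum_congr rfl fun j _ => (Nat.two_mul_div_two_of_even (h' j)).symm
        have : ∑ j, ν j / 2 = P := by omega
        exact this
      · funext j
        exact Nat.two_mul_div_two_of_even (h' j)
    obtain ⟨j, hj⟩ := h
    rw [Finset.prod_eq_zero (Finset.mem_univ j) (by rw [bm_moment_odd hj]; simp), mul_zero]
  · intro p _
    congr 1
    refine Finset.prod_congr rfl fun j _ => ?_
    rw [bm_moment_div_factorial (hκ j), pow_mul]

lemma measure_eq_of_moments {μ ν : Measure ℝ} [IsFiniteMeasure μ] [IsFiniteMeasure ν]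
    (hμ : ∀ᵐ t ∂μ, t ∈ Set.Icc (-1 : ℝ) 1) (hν : ∀ᵐ t ∂ν, t ∈ Set.Icc (-1 : ℝ) 1)
    (h : ∀ N : ℕ, ∫ t, t ^ N ∂μ = ∫ t, t ^ N ∂ν) : μ = ν := by
  have hintg : ∀ (p : Polynomial ℝ) (ρ : Measure ℝ) [IsFiniteMeasure ρ],
      (∀ᵐ t ∂ρ, t ∈ Set.Icc (-1 : ℝ) 1) → Integrable (fun t => p.eval t) ρ := by
    intro p ρ _ hρ
    obtain ⟨C, hC⟩ := (isCompact_Icc (a := (-1 : ℝ)) (b := 1)).exists_bound_of_continuousOn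
      (f := fun t => p.eval t) p.continuous.continuousOn
    refine Integrable.of_bound p.continuous.aestronglyMeasurable C ?_
    filter_upwards [hρ] with t ht using hC t ht
  have hpoly : ∀ p : Polynomial ℝ, ∫ t, p.eval t ∂μ = ∫ t, p.eval t ∂ν := by
    intro p
    simp only [Polynomial.eval_eq_sum_range]
    have hi : ∀ (ρ : Measure ℝ) [IsFiniteMeasure ρ], (∀ᵐ t ∂ρ, t ∈ Set.Icc (-1 : ℝ) 1) →
        ∀ k ∈ Finset.range (p.natDegree + 1), Integrable (fun t => p.coeff k * t ^ k) ρ := by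
      intro ρ _ hρ k _
      have := hintg (Polynomial.C (p.coeff k) * Polynomial.X ^ k) ρ hρ
      simpa using this
    rw [MeasureTheory.integral_finsetSum _ (hi μ hμ), MeasureTheory.integral_finsetSum _ (hi ν hν)]
    exact Finset.sum_congr rfl fun k _ => by
      rw [MeasureTheory.integral_const_mul, MeasureTheory.integral_const_mul, h]
  refine ext_of_forall_integral_eq_of_IsFiniteMeasure fun f => ?_
  rw [← sub_eq_zero, ← abs_nonpos_iff]
  refine le_of_forall_pos_le_add fun ε hε => ?_
  set M := μ.real Set.univ + ν.real Set.univ + 1 with hM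
  have hM0 : 0 < M := by positivity
  obtain ⟨p, hp⟩ := exists_polynomial_near_of_continuousOn (-1) 1 f f.continuous.continuousOn
    (ε / M) (by positivity)
  have key : ∀ (ρ : Measure ℝ) [IsFiniteMeasure ρ], (∀ᵐ t ∂ρ, t ∈ Set.Icc (-1 : ℝ) 1) →
      |∫ t, p.eval t ∂ρ - ∫ t, f t ∂ρ| ≤ ε / M * ρ.real Set.univ := by
    intro ρ _ hρ
    rw [← MeasureTheory.integral_sub (hintg p ρ hρ) (f.integrable ρ), ← Real.norm_eq_abs]
    refine norm_integral_le_of_norm_le_const ?_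
    filter_upwards [hρ] with t ht using (hp t ht).le
  have h1 := abs_le.1 (key μ hμ)
  have h2 := abs_le.1 (key ν hν)
  rw [hpoly p] at h1
  have h3 : ε / M * μ.real Set.univ + ε / M * ν.real Set.univ ≤ ε := by
    rw [← mul_add, div_mul_eq_mul_div, div_le_iff₀ hM0]
    have : 0 ≤ ε := hε.le
    nlinarith
  rw [zero_add, abs_le]
  constructor <;> linarith [h1.1, h1.2, h2.1, h2.2]

lemma map_eq_smul_of_moments {Ω : Type*} [MeasurableSpace Ω] {μ : Measure Ω} [IsFiniteMeasure μ]
    {Z : Ω → ℝ} (hZ : Measurable Z) (hZ1 : ∀ᵐ ω ∂μ, Z ω ∈ Set.Icc (-1 : ℝ) 1) {ν : Measure ℝ}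
    [IsFiniteMeasure ν] (hν : ∀ᵐ t ∂ν, t ∈ Set.Icc (-1 : ℝ) 1) {C : ℝ} (hC : 0 ≤ C)
    (h : ∀ N : ℕ, ∫ ω, Z ω ^ N ∂μ = C * ∫ t, t ^ N ∂ν) :
    μ.map Z = ENNReal.ofReal C • ν := by
  have : IsFiniteMeasure (ENNReal.ofReal C • ν) := Measure.smul_finite _ ENNReal.ofReal_ne_top
  refine measure_eq_of_moments ?_ ?_ fun N => ?_
  · exact (ae_map_iff hZ.aemeasurable (p := fun t => t ∈ Set.Icc (-1 : ℝ) 1) measurableSet_Icc).2 hZ1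
  · exact Measure.ae_smul_measure hν _
  · rw [integral_map hZ.aemeasurable (by fun_prop), MeasureTheory.integral_smul_measure, h,
      ENNReal.toReal_ofReal hC, smul_eq_mul]

lemma integral_eq_of_map_eq_smul {Ω : Type*} [MeasurableSpace Ω] {μ : Measure Ω}
    {Z : Ω → ℝ} (hZ : Measurable Z) {ν : Measure ℝ} {C : ℝ} (hC : 0 ≤ C)
    (h : μ.map Z = ENNReal.ofReal C • ν) {f : ℝ → ℝ} (hf : AEStronglyMeasurable f ν) :
    ∫ ω, f (Z ω) ∂μ = C * ∫ t, f t ∂ν := by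
  rw [← integral_map hZ.aemeasurable (by rw [h]; exact hf.mono_ac Measure.smul_absolutelyContinuous), h, MeasureTheory.integral_smul_measure,
    ENNReal.toReal_ofReal hC, smul_eq_mul]

lemma continuous_zST {d : ℕ} (x : Fin d → ℝ) :
    Continuous fun p : (Fin d → ℝ) × (Fin (d + 1) → ℝ) => zST d x p.1 p.2 := by
  unfold zST
  refine continuous_finsetSum _ fun j _ => Continuous.mul ?_ (by fun_prop)
  exact (continuous_const.mul ((continuous_xext j).comp continuous_fst)).sqrt

lemma abs_zST_le {d : ℕ} {x y : Fin d → ℝ} (hx : x ∈ simplexT d) (hy : y ∈ simplexT d)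
    {t : Fin (d + 1) → ℝ} (ht : ∀ j, t j ∈ Set.Icc (-1 : ℝ) 1) : zST d x y t ∈ Set.Icc (-1 : ℝ) 1 := by
  rw [Set.mem_Icc, ← abs_le, zST]
  refine (Finset.abs_sum_le_sum_abs _ _).trans ?_
  have h : ∀ j, |√(xext d x j * xext d y j) * t j| ≤ (xext d x j + xext d y j) / 2 := by
    intro j
    have h1 := mem_simplexT_iff.1 hx j
    have h2 := mem_simplexT_iff.1 hy j
    rw [abs_mul, abs_of_nonneg (sqrt_nonneg _), sqrt_mul h1]
    have h3 : |t j| ≤ 1 := abs_le.2 (ht j)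
    have := sq_sqrt h1
    have := sq_sqrt h2
    have h4 : √(xext d x j) * √(xext d y j) * |t j| ≤ √(xext d x j) * √(xext d y j) :=
      mul_le_of_le_one_right (by positivity) h3
    nlinarith [sq_nonneg (√(xext d x j) - √(xext d y j))]
  refine (Finset.sum_le_sum fun j _ => h j).trans ?_
  rw [← Finset.sum_div, Finset.sum_add_distrib, sum_xext, sum_xext]
  norm_num

lemma ae_pi_bm_mem {m : ℕ} (κ : Fin m → ℝ) :
    ∀ᵐ t ∂Measure.pi (fun j => bm (κ j)), ∀ j, t j ∈ Set.Icc (-1 : ℝ) 1 := by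
  rw [ae_all_iff]
  intro j
  exact (Measure.quasiMeasurePreserving_eval (fun j => bm (κ j)) j).ae (bm_ae (κ j))

lemma ae_prod_zST {d : ℕ} (α κ : Fin (d + 1) → ℝ) {x : Fin d → ℝ} (hx : x ∈ simplexT d) :
    ∀ᵐ p ∂(dirM d α).prod (Measure.pi fun j => bm (κ j)), zST d x p.1 p.2 ∈ Set.Icc (-1 : ℝ) 1 := by
  have h1 := Measure.quasiMeasurePreserving_fst (μ := dirM d α)
    (ν := Measure.pi fun j => bm (κ j)) |>.ae (ae_dirM_mem d α)
  have h2 := Measure.quasiMeasurePreserving_snd (μ := dirM d α)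
    (ν := Measure.pi fun j => bm (κ j)) |>.ae (ae_pi_bm_mem κ)
  filter_upwards [h1, h2] with p hp1 hp2 using abs_zST_le hx hp1 hp2

lemma zST_moment_term {m : ℕ} {κ x : Fin m → ℝ} (hκ : ∀ j, 0 ≤ κ j) {P : ℕ} {p : Fin m → ℕ}
    (hp : p ∈ piAntidiag univ P) :
    ((2 * P).factorial : ℝ) * (∏ j, (x j ^ p j *
        (bmC (κ j) * √π / (4 ^ p j * (p j).factorial * Gamma (p j + κ j + 1 / 2))))) *
      ((∏ j, Gamma (κ j + 1 / 2 + p j)) / Gamma (∑ j, (κ j + 1 / 2 + p j))) =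
    ((∏ j, bmC (κ j) * √π) / √π) * (Gamma (P + 1 / 2) / Gamma (P + ∑ j, κ j + m / 2)) *
      (Nat.multinomial univ p * ∏ j, x j ^ p j) := by
  have hsum := (mem_piAntidiag.1 hp).1
  have h1 : ∑ j, (κ j + 1 / 2 + p j) = P + ∑ j, κ j + m / 2 := by
    rw [Finset.sum_add_distrib, Finset.sum_add_distrib, ← hsum]
    simp
    ring
  have h2 : ∀ j, κ j + 1 / 2 + p j = p j + κ j + 1 / 2 := fun j => by ring
  rw [h1]
  simp only [h2]
  have hspec := Nat.multinomial_spec univ p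
  rw [hsum] at hspec
  have h3 : (Nat.multinomial univ p : ℝ) = P.factorial / ∏ j, ((p j).factorial : ℝ) := by
    rw [eq_div_iff (Finset.prod_ne_zero_iff.2 fun j _ => by positivity), ← hspec]
    push_cast
    ring
  have h4 : (∏ j : Fin m, (4:ℝ) ^ p j) = 4 ^ P := by
    rw [Finset.prod_pow_eq_pow_sum, hsum]
  rw [h3, two_mul_factorial_eq, Finset.prod_mul_distrib, Finset.prod_div_distrib,
    Finset.prod_mul_distrib (f := fun j => (4:ℝ) ^ p j * (p j).factorial),
    Finset.prod_mul_distrib (f := fun j => (4:ℝ) ^ p j), h4]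
  have g1 : (∏ j, Gamma (p j + κ j + 1 / 2)) ≠ 0 :=
    Finset.prod_ne_zero_iff.2 fun j _ => (Gamma_pos_of_pos (by have := hκ j; positivity)).ne'
  have g2 : (∏ j, ((p j).factorial : ℝ)) ≠ 0 := Finset.prod_ne_zero_iff.2 fun j _ => by positivity
  generalize (∏ j, Gamma (p j + κ j + 1 / 2)) = G at *
  generalize (∏ j, ((p j).factorial : ℝ)) = F at *
  generalize Gamma (P + ∑ j, κ j + m / 2) = G'
  generalize Gamma ((P:ℝ) + 1 / 2) = G''
  generalize (∏ j, bmC (κ j) * √π) = K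
  generalize (∏ j, x j ^ p j) = X
  generalize (P.factorial : ℝ) = F'
  have : √π ≠ 0 := by positivity
  field_simp

lemma integral_zST_pow {d : ℕ} {κ : Fin (d + 1) → ℝ} (hκ : ∀ j, 0 ≤ κ j) {x : Fin d → ℝ}
    (hx : x ∈ simplexT d) (N : ℕ) :
    ∫ p, zST d x p.1 p.2 ^ N ∂(dirM d fun j => κ j + 1 / 2).prod (Measure.pi fun j => bm (κ j)) =
      (∏ j, bmC (κ j) * √π) / √π / bmC (∑ j, κ j + d / 2) * ∫ t, t ^ N ∂bm (∑ j, κ j + d / 2) := by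
  have hα : ∀ j, 0 < κ j + 1 / 2 := fun j => by have := hκ j; positivity
  have := isFiniteMeasure_dirM hα
  have hS : 0 ≤ ∑ j, κ j + d / 2 := by
    have := Finset.sum_nonneg fun j (_ : j ∈ univ) => hκ j
    positivity
  rw [MeasureTheory.integral_prod]
  swap
  · refine Integrable.of_bound ((continuous_zST x).pow N).aestronglyMeasurable 1 ?_
    filter_upwards [ae_prod_zST _ κ hx] with p hp
    rw [norm_pow]
    exact pow_le_one₀ (norm_nonneg _) (abs_le.2 hp)
  simp only [zST]
  rcases Nat.even_or_odd' N with ⟨P, rfl | rfl⟩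
  · simp only [integral_pi_bm_pow_even hκ]
    rw [bm_moment_nat hS]
    have hae : ∀ᵐ y ∂dirM d (fun j => κ j + 1 / 2), (∑ p ∈ piAntidiag univ P,
        ((2 * P).factorial : ℝ) * ∏ j, ((√(xext d x j * xext d y j) ^ 2) ^ p j *
        (bmC (κ j) * √π / (4 ^ p j * (p j).factorial * Gamma (p j + κ j + 1 / 2))))) =
        ∑ p ∈ piAntidiag univ P, (((2 * P).factorial : ℝ) * (∏ j, (xext d x j ^ p j *
        (bmC (κ j) * √π / (4 ^ p j * (p j).factorial * Gamma (p j + κ j + 1 / 2)))))) *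
        ∏ j, xext d y j ^ (p j : ℝ) := by
      filter_upwards [ae_dirM_mem _ _] with y hy
      refine Finset.sum_congr rfl fun p _ => ?_
      rw [mul_assoc, ← Finset.prod_mul_distrib]
      congr 1
      refine Finset.prod_congr rfl fun j _ => ?_
      rw [sq_sqrt (mul_nonneg (mem_simplexT_iff.1 hx j) (mem_simplexT_iff.1 hy j)), mul_pow,
        rpow_natCast]
      ring
    rw [integral_congr_ae hae, MeasureTheory.integral_finsetSum]
    · simp only [MeasureTheory.integral_const_mul]
      rw [Finset.sum_congr rfl (g := fun p => ((∏ j, bmC (κ j) * √π) / √π) *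
        (Gamma (P + 1 / 2) / Gamma (P + ∑ j, κ j + ((d + 1 : ℕ) : ℝ) / 2)) *
        (Nat.multinomial univ p * ∏ j, xext d x j ^ p j)), ← Finset.mul_sum,
        ← Finset.sum_pow_eq_sum_piAntidiag, sum_xext, one_pow, mul_one]
      · have h3 := bmC_pos hS
        rw [show (P:ℝ) + ∑ j, κ j + ((d + 1 : ℕ) : ℝ) / 2 = P + (∑ j, κ j + d / 2) + 1 / 2 by
          push_cast; ring]
        generalize bmC (∑ j, κ j + d / 2) = b at *
        generalize (∏ j, bmC (κ j) * √π) = K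
        field_simp
      · intro p hp
        rw [integral_dirM_prod fun j => by have := hα j; positivity]
        exact zST_moment_term hκ hp
    · intro p _
      refine Integrable.const_mul (Integrable.of_bound ?_ 1 ?_) _
      · exact (Finset.measurable_prod _ fun j _ =>
          (continuous_xext j).measurable.pow_const _).aestronglyMeasurable
      · filter_upwards [ae_dirM_mem _ _] with y hy
        rw [norm_prod]
        refine Finset.prod_le_one (fun j _ => norm_nonneg _) fun j _ => ?_
        have h0 := mem_simplexT_iff.1 hy j
        rw [Real.norm_of_nonneg (rpow_nonneg h0 _), rpow_natCast]
        exact pow_le_one₀ h0 (xext_le_one hy j)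
  · simp only [integral_pi_bm_pow_odd κ _ (odd_two_mul_add_one P), bm_moment_odd (odd_two_mul_add_one P)]
    simp

/-- The distribution of `z(x, y, t)` does not depend on `x`. -/
lemma map_zST {d : ℕ} {κ : Fin (d + 1) → ℝ} (hκ : ∀ j, 0 ≤ κ j) :
    ∃ C : ℝ, 0 < C ∧ ∀ x ∈ simplexT d,
      ((dirM d fun j => κ j + 1 / 2).prod (Measure.pi fun j => bm (κ j))).map
        (fun p => zST d x p.1 p.2) = ENNReal.ofReal C • bm (∑ j, κ j + d / 2) := by
  have hS : 0 ≤ ∑ j, κ j + d / 2 := by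
    have := Finset.sum_nonneg fun j (_ : j ∈ univ) => hκ j
    positivity
  have hC : 0 < (∏ j, bmC (κ j) * √π) / √π / bmC (∑ j, κ j + d / 2) := by
    have h1 := bmC_pos hS
    have h2 : 0 < ∏ j, bmC (κ j) * √π := Finset.prod_pos fun j _ => by
      have := bmC_pos (hκ j)
      positivity
    positivity
  refine ⟨_, hC, fun x hx => ?_⟩
  have hα : ∀ j, 0 < κ j + 1 / 2 := fun j => by have := hκ j; positivity
  have := isFiniteMeasure_dirM hα
  exact map_eq_smul_of_moments (continuous_zST x).measurable (ae_prod_zST _ κ hx) (bm_ae _) hC.le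
    fun N => integral_zST_pow hκ hx N

lemma measurableSet_cube (m : ℕ) : MeasurableSet (cube m) :=
  MeasurableSet.univ_pi fun _ => measurableSet_Icc

lemma measurable_wcube {m : ℕ} (κ : Fin m → ℝ) : Measurable (wcube κ) := by
  unfold wcube
  exact Finset.measurable_prod _ fun j _ => by fun_prop

lemma wcube_nonneg {m : ℕ} (κ : Fin m → ℝ) {t : Fin m → ℝ} (ht : t ∈ cube m) : 0 ≤ wcube κ t := by
  refine Finset.prod_nonneg fun j _ => rpow_nonneg ?_ _
  have := ht j trivial
  nlinarith [this.1, this.2]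

lemma setLIntegral_Icc_eq_bm {κ : ℝ} (hκ : 0 < κ) {s : Set ℝ} (hs : MeasurableSet s) :
    ∫⁻ t, (s ∩ Set.Icc (-1) 1).indicator (fun t => ENNReal.ofReal ((1 - t ^ 2) ^ (κ - 1))) t =
      bm κ s := by
  rw [bm, if_neg hκ.ne', if_pos hκ, withDensity_apply _ hs, ← lintegral_indicator hs]
  refine lintegral_congr_ae ?_
  filter_upwards [Measure.ae_ne volume (1:ℝ), Measure.ae_ne volume (-1:ℝ)] with t h1 h2
  by_cases hts : t ∈ s
  · rw [Set.indicator_of_mem hts, bmDens]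
    by_cases ht : t ∈ Set.Icc (-1 : ℝ) 1
    · have h3 : t ∈ Set.Ioo (-1 : ℝ) 1 := ⟨lt_of_le_of_ne ht.1 (Ne.symm h2), lt_of_le_of_ne ht.2 h1⟩
      rw [Set.indicator_of_mem (show t ∈ s ∩ Set.Icc (-1) 1 from ⟨hts, ht⟩), Set.indicator_of_mem h3]
    · have h3 : t ∉ Set.Ioo (-1 : ℝ) 1 := fun h => ht ⟨h.1.le, h.2.le⟩
      rw [Set.indicator_of_notMem (s := s ∩ Set.Icc (-1) 1) (fun h => ht h.2), Set.indicator_of_notMem h3, ENNReal.ofReal_zero]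
  · rw [Set.indicator_of_notMem hts, Set.indicator_of_notMem (s := s ∩ Set.Icc (-1) 1) (fun h => hts h.1)]

lemma pi_bm_eq {m : ℕ} {κ : Fin m → ℝ} (hκ : ∀ j, 0 < κ j) :
    Measure.pi (fun j => bm (κ j)) =
      (volume.restrict (cube m)).withDensity fun t => ENNReal.ofReal (wcube κ t) := by
  refine Measure.pi_eq fun s hs => ?_
  have hms : MeasurableSet (Set.univ.pi s) := MeasurableSet.univ_pi hs
  rw [withDensity_apply _ hms, Measure.restrict_restrict hms,
    ← lintegral_indicator (hms.inter (measurableSet_cube m))]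
  have h := lintegral_pi_prod_eq_prod (fun _ : Fin m => (volume : Measure ℝ))
    (f := fun j => (s j ∩ Set.Icc (-1) 1).indicator
      (fun t => ENNReal.ofReal ((1 - t ^ 2) ^ (κ j - 1))))
    (fun j => Measurable.indicator (by fun_prop) ((hs j).inter measurableSet_Icc))
  simp only [setLIntegral_Icc_eq_bm (hκ _) (hs _)] at h
  rw [← h, ← volume_pi]
  refine lintegral_congr fun t => ?_
  by_cases ht : ∀ j, t j ∈ s j ∩ Set.Icc (-1) 1
  · have h1 : t ∈ Set.univ.pi s ∩ cube m := ⟨fun j _ => (ht j).1, fun j _ => (ht j).2⟩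
    rw [Set.indicator_of_mem h1, wcube, ENNReal.ofReal_prod_of_nonneg]
    · exact Finset.prod_congr rfl fun j _ => by rw [Set.indicator_of_mem (ht j)]
    · intro j _
      have := (ht j).2
      exact rpow_nonneg (by nlinarith [this.1, this.2]) _
  · have h1 : t ∉ Set.univ.pi s ∩ cube m := fun h => ht fun j => ⟨h.1 j trivial, h.2 j trivial⟩
    rw [Set.indicator_of_notMem h1]
    push Not at ht
    obtain ⟨j, hj⟩ := ht
    rw [Finset.prod_eq_zero (Finset.mem_univ j)]
    rw [Set.indicator_of_notMem hj]

lemma integral_pi_bm {m : ℕ} {κ : Fin m → ℝ} (hκ : ∀ j, 0 < κ j) (f : (Fin m → ℝ) → ℝ) :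
    ∫ t, f t ∂Measure.pi (fun j => bm (κ j)) = ∫ t in cube m, f t * wcube κ t := by
  rw [pi_bm_eq hκ, integral_withDensity_eq_integral_toReal_smul (measurable_wcube κ).ennreal_ofReal
    (Filter.Eventually.of_forall fun x => ENNReal.ofReal_lt_top)]
  refine setIntegral_congr_fun (measurableSet_cube m) fun t ht => ?_
  simp [ENNReal.toReal_ofReal (wcube_nonneg κ ht), mul_comm]

/-- The unnormalized `L¹` norm of the kernel obtained from a polynomial. -/
noncomputable def simpL (d : ℕ) (κ : Fin (d + 1) → ℝ) (S : Polynomial ℝ) (x : Fin d → ℝ) : ℝ :=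
  ∫ y, |∫ t, S.eval (zST d x y t) ∂Measure.pi fun j => bm (κ j)| ∂dirM d fun j => κ j + 1 / 2

lemma simpL_nonneg {d : ℕ} (κ : Fin (d + 1) → ℝ) (S : Polynomial ℝ) (x : Fin d → ℝ) :
    0 ≤ simpL d κ S x := integral_nonneg fun _ => abs_nonneg _

lemma pi_bm_real_univ_pos {m : ℕ} {κ : Fin m → ℝ} (hκ : ∀ j, 0 ≤ κ j) :
    0 < ∫ _, (1 : ℝ) ∂Measure.pi (fun j => bm (κ j)) := by
  have := integral_fintype_prod_eq_prod (𝕜 := ℝ) (μ := fun j => bm (κ j)) (fun j (t : ℝ) => 1)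
  simp only [Finset.prod_const_one] at this
  rw [this]
  refine Finset.prod_pos fun j _ => ?_
  have h := bm_moment_nat (hκ j) 0
  simp only [mul_zero, pow_zero] at h
  rw [h]
  have h1 := bmC_pos (hκ j)
  have h2 := hκ j
  have h3 : 0 < Gamma (((0:ℕ):ℝ) + 1 / 2) := Gamma_pos_of_pos (by norm_num)
  have h4 : 0 < Gamma (((0:ℕ):ℝ) + κ j + 1 / 2) := Gamma_pos_of_pos (by push_cast; linarith)
  positivity

lemma integral_WT_pos {d : ℕ} {κ : Fin (d + 1) → ℝ} (hκ : ∀ j, 0 < κ j) :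
    0 < ∫ y in simplexT d, WT d κ y := by
  have hα : ∀ j, 0 < κ j + 1 / 2 := fun j => by have := hκ j; positivity
  have h := integral_dirM (fun j => κ j + 1 / 2) (fun _ => (1:ℝ))
  simp only [mul_one] at h
  rw [WT_eq_dirD, ← h, MeasureTheory.integral_const, dirM_real_univ hα, smul_eq_mul, mul_one]
  exact div_pos (Finset.prod_pos fun j _ => Gamma_pos_of_pos (hα j))
    (Gamma_pos_of_pos (Finset.sum_pos (fun j _ => hα j) Finset.univ_nonempty))

lemma iSup_kernel_eq {d : ℕ} {κ : Fin (d + 1) → ℝ} (hκ : ∀ j, 0 < κ j) {S : Polynomial ℝ} {B : ℝ}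
    (hB : 0 ≤ B) {K : (Fin d → ℝ) → (Fin d → ℝ) → ℝ}
    (hK : ∀ x y, K x y = B * ∫ t, S.eval (zST d x y t) ∂Measure.pi fun j => bm (κ j)) :
    ⨆ x : simplexT d, (∫ y in simplexT d, WT d κ y)⁻¹ * ∫ y in simplexT d, |K x y| * WT d κ y =
      (∫ y in simplexT d, WT d κ y)⁻¹ * B * ⨆ x : simplexT d, simpL d κ S x := by
  rw [Real.mul_iSup_of_nonneg (mul_nonneg (inv_nonneg.2 (integral_WT_pos hκ).le) hB)]
  congr 1
  funext x
  rw [mul_assoc]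
  congr 1
  rw [simpL, integral_dirM, ← MeasureTheory.integral_const_mul, WT_eq_dirD]
  congr 1
  funext y
  rw [hK, abs_mul, abs_of_nonneg hB]
  ring

lemma exists_norm_eq_iSup_simpL {d : ℕ} (hd : 1 ≤ d) {κ : Fin (d + 1) → ℝ} (hκ : ∀ j, 0 < κ j)
    {q : ℕ → Polynomial ℝ} (hq : ∀ k, (q k).degree = k)
    (hqorth : ∀ j k, (∫ t in (-1 : ℝ)..1,
        (q j).eval t * (q k).eval t * wJac ((∑ i, κ i) + ((d : ℝ) - 2) / 2) (-(1 / 2)) t) =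
      if j = k then 1 else 0) :
    ∃ C, 0 < C ∧ (∀ n, projNormT d κ q n =
        C * ⨆ x : simplexT d, simpL d κ (cesPoly (-1) (∑ i, κ i + ((d : ℝ) - 1) / 2) n) x) ∧
      ∀ δ, -1 < δ → ∀ n, cesaroNormT d κ q δ n = C * (rc (δ + 1) n)⁻¹ *
        ⨆ x : simplexT d, simpL d κ (cesPoly δ (∑ i, κ i + ((d : ℝ) - 1) / 2) n) x := by
  have hd' : (1:ℝ) ≤ d := by exact_mod_cast hd
  set l := ∑ i, κ i + ((d : ℝ) - 1) / 2 with hl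
  have hl0 : 0 < l := by
    have := Finset.sum_pos (fun j (_ : j ∈ univ) => hκ j) Finset.univ_nonempty
    linarith
  obtain ⟨C, hC, h⟩ := exists_sum_orthonormal_eq_cesPoly hl0 hq (fun j k => by
    rw [← hqorth j k, hl]
    congr! 4
    ring)
  have hW := integral_WT_pos hκ
  have hB := pi_bm_real_univ_pos fun j => (hκ j).le
  have hB' : ∫ t in cube (d + 1), wcube κ t = ∫ _, (1 : ℝ) ∂Measure.pi (fun j => bm (κ j)) := by
    rw [integral_pi_bm hκ]; simp
  set B := ∫ _, (1 : ℝ) ∂Measure.pi (fun j => bm (κ j)) with hBdef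
  refine ⟨(∫ y in simplexT d, WT d κ y)⁻¹ * (B⁻¹ * C), by positivity, fun n => ?_, fun δ hδ n => ?_⟩
  · rw [projNormT]
    refine iSup_kernel_eq hκ (by positivity) fun x y => ?_
    rw [simpP, hB', integral_pi_bm hκ, ← MeasureTheory.integral_const_mul,
      ← MeasureTheory.integral_const_mul]
    congr 1
    funext t
    rw [show B⁻¹ * C * ((cesPoly (-1) l n).eval (zST d x y t) * wcube κ t) =
      B⁻¹ * ((C * (cesPoly (-1) l n).eval (zST d x y t)) * wcube κ t) by ring]
    congr 2
    rw [← h (-1) n, Finset.sum_eq_single_of_mem n (by simp)]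
    · simp
    · intro k hk hkn
      have : k < n := lt_of_le_of_ne (Nat.lt_succ_iff.1 (Finset.mem_range.1 hk)) hkn
      obtain ⟨j, hj⟩ := Nat.exists_eq_add_of_lt this
      have : rc (-1 + 1) (n - k) = 0 := by
        rw [show n - k = j + 1 by omega, neg_add_cancel]
        simp [rc, Finset.prod_range_succ']
      rw [this]; ring
  · rw [cesaroNormT, mul_assoc _ (B⁻¹ * C)]
    have hr := rc_pos (c := δ + 1) (by linarith) n
    refine iSup_kernel_eq hκ (by positivity) fun x y => ?_
    rw [simpK, hB', integral_pi_bm hκ, ← MeasureTheory.integral_const_mul,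
      ← MeasureTheory.integral_const_mul]
    congr 1
    funext t
    simp only [cesA_eq_rc]
    rw [h δ n]
    ring

/-- The weighted measure `|s| ^ (2 * κ) d(bm κ)`. -/
noncomputable def bmAbs (κ k : ℝ) : Measure ℝ :=
  (bm κ).withDensity fun s => ENNReal.ofReal (|s| ^ (2 * k))

instance (κ k : ℝ) [hk : Fact (0 ≤ k)] : IsFiniteMeasure (bmAbs κ k) := by
  refine isFiniteMeasure_withDensity_ofReal (Integrable.hasFiniteIntegral ?_)
  refine Integrable.of_bound (continuous_abs.measurable.pow_const _).aestronglyMeasurable 1 ?_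
  filter_upwards [bm_ae κ] with t ht
  have h := hk.out
  rw [Real.norm_of_nonneg (by positivity)]
  exact rpow_le_one (abs_nonneg _) (abs_le.2 ht) (by positivity)

lemma integral_bmAbs (κ k : ℝ) (f : ℝ → ℝ) :
    ∫ s, f s ∂bmAbs κ k = ∫ s, |s| ^ (2 * k) * f s ∂bm κ := by
  rw [bmAbs, integral_withDensity_eq_integral_toReal_smul (by fun_prop)
    (Filter.Eventually.of_forall fun x => ENNReal.ofReal_lt_top)]
  refine integral_congr_ae (Filter.Eventually.of_forall fun s => ?_)
  simp only [smul_eq_mul]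
  rw [ENNReal.toReal_ofReal (by positivity)]

lemma bmAbs_ae (κ k : ℝ) : ∀ᵐ t ∂bmAbs κ k, t ∈ Set.Icc (-1 : ℝ) 1 :=
  (withDensity_absolutelyContinuous _ _).ae_le (bm_ae κ)

/-- Multiplicative factorization of the beta measures. -/
lemma map_mul_bmAbs_prod_bm {κ k : ℝ} (hk : 0 < k) (hκ : k ≤ κ) :
    ((bmAbs (κ - k) k).prod (bm k)).map (fun p => p.1 * p.2) =
      ENNReal.ofReal (bmC (κ - k) * bmC k / bmC κ) • bm κ := by
  have : Fact (0 ≤ k) := ⟨hk.le⟩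
  have h1 := bmC_pos (κ := κ - k) (by linarith)
  have h2 := bmC_pos hk.le
  have h3 := bmC_pos (hk.le.trans hκ)
  refine map_eq_smul_of_moments (by fun_prop) ?_ (bm_ae κ) (by positivity) fun N => ?_
  · have h1 := Measure.quasiMeasurePreserving_fst (μ := bmAbs (κ - k) k) (ν := bm k) |>.ae (bmAbs_ae _ _)
    have h2 := Measure.quasiMeasurePreserving_snd (μ := bmAbs (κ - k) k) (ν := bm k) |>.ae (bm_ae k)
    filter_upwards [h1, h2] with p h1 h2
    have h1 : |p.1| ≤ 1 := abs_le.2 h1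
    have h2 : |p.2| ≤ 1 := abs_le.2 h2
    refine abs_le.1 ?_
    rw [abs_mul]
    exact mul_le_one₀ h1 (abs_nonneg _) h2
  · simp only [mul_pow]
    rw [integral_prod_mul (f := fun s : ℝ => s ^ N) (g := fun s : ℝ => s ^ N)]
    rcases Nat.even_or_odd' N with ⟨P, rfl | rfl⟩
    · have e1 : ∫ s, s ^ (2 * P) ∂bmAbs (κ - k) k = ∫ s, |s| ^ (2 * (k + P)) ∂bm (κ - k) := by
        rw [integral_bmAbs]
        refine integral_congr_ae (Filter.Eventually.of_forall fun s => ?_)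
        show |s| ^ (2 * k) * s ^ (2 * P) = |s| ^ (2 * (k + P))
        rw [mul_add, rpow_add_of_nonneg (abs_nonneg _) (by positivity) (by positivity),
          ← Even.pow_abs (even_two_mul P) s]
        congr 1
        rw [← rpow_natCast]; push_cast; rfl
      rw [e1, (bm_moment (by linarith) (by positivity)).2, bm_moment_nat hk.le,
        bm_moment_nat (hk.le.trans hκ), show k + P + (κ - k) + 1 / 2 = P + κ + 1 / 2 by ring,
        show k + P + 1 / 2 = P + k + 1 / 2 by ring]
      have g1 : Gamma (P + k + 1 / 2) ≠ 0 := (Gamma_pos_of_pos (by positivity)).ne'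
      field_simp
    · rw [bm_moment_odd (κ := k) (odd_two_mul_add_one P), bm_moment_odd (κ := κ) (odd_two_mul_add_one P)]
      simp

lemma continuous_integrable_comp_affine {μ : Measure ℝ} [IsFiniteMeasure μ]
    (hμ : ∀ᵐ t ∂μ, t ∈ Set.Icc (-1 : ℝ) 1) {M : ℝ → ℝ} (hM : Continuous M) (a b : ℝ) :
    Integrable (fun s => M (a * s + b)) μ := by
  obtain ⟨C, hC⟩ := (isCompact_Icc (a := (-1:ℝ)) (b := 1)).exists_bound_of_continuousOn
    (f := fun s => M (a * s + b)) (by fun_prop)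
  refine Integrable.of_bound (by fun_prop) C ?_
  filter_upwards [hμ] with t ht using hC t ht

lemma abs_integral_bm_le {κ k : ℝ} (hk : 0 < k) (hκ : k ≤ κ) {F M : ℝ → ℝ} {B : ℝ}
    (hF : Continuous F) (hM : Continuous M)
    (h : ∀ a b, |a| + |b| ≤ 1 →
      |a| ^ k * |∫ t, F (a * t + b) ∂bm k| ≤ B * (M (a + b) + M (-a + b)))
    {a b : ℝ} (hab : |a| + |b| ≤ 1) :
    |a| ^ k * |∫ u, F (a * u + b) ∂bm κ| ≤
      2 * (bmC κ / (bmC (κ - k) * bmC k)) * B * ∫ s, M (a * s + b) ∂bm (κ - k) := by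
  have : Fact (0 ≤ k) := ⟨hk.le⟩
  have h1 := bmC_pos (κ := κ - k) (by linarith)
  have h2 := bmC_pos hk.le
  have h3 := bmC_pos (hk.le.trans hκ)
  have e := integral_eq_of_map_eq_smul (Z := fun p : ℝ × ℝ => p.1 * p.2) (by fun_prop) (by positivity)
    (map_mul_bmAbs_prod_bm hk hκ) (f := fun u => F (a * u + b)) (by fun_prop)
  rw [MeasureTheory.integral_prod, integral_bmAbs] at e
  swap
  · obtain ⟨C, hC⟩ := (isCompact_Icc (a := (-1:ℝ)) (b := 1)).exists_bound_of_continuousOn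
      (f := fun s => F (a * s + b)) (by fun_prop)
    refine Integrable.of_bound (by fun_prop) C ?_
    have h1 := Measure.quasiMeasurePreserving_fst (μ := bmAbs (κ - k) k) (ν := bm k) |>.ae (bmAbs_ae _ _)
    have h2 := Measure.quasiMeasurePreserving_snd (μ := bmAbs (κ - k) k) (ν := bm k) |>.ae (bm_ae k)
    filter_upwards [h1, h2] with p h1 h2
    refine hC _ (abs_le.1 ?_)
    rw [abs_mul]
    exact mul_le_one₀ (abs_le.2 h1) (abs_nonneg _) (abs_le.2 h2)
  set Q := bmC (κ - k) * bmC k / bmC κ with hQ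
  have hQ0 : 0 < Q := by positivity
  have hQi : bmC κ / (bmC (κ - k) * bmC k) = Q⁻¹ := by rw [hQ, inv_div]
  have i1 := continuous_integrable_comp_affine (bm_ae (κ - k)) hM a b
  have i2 := continuous_integrable_comp_affine (bm_ae (κ - k)) hM (-a) b
  have key : Q * (|a| ^ k * |∫ u, F (a * u + b) ∂bm κ|) ≤ 2 * B * ∫ s, M (a * s + b) ∂bm (κ - k) := by
    calc Q * (|a| ^ k * |∫ u, F (a * u + b) ∂bm κ|) = |a| ^ k * |Q * ∫ u, F (a * u + b) ∂bm κ| := by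
          rw [abs_mul, abs_of_pos hQ0]; ring
      _ = |∫ s, |a| ^ k * (|s| ^ (2 * k) * ∫ t, F (a * (s * t) + b) ∂bm k) ∂bm (κ - k)| := by
          rw [← e, MeasureTheory.integral_const_mul, abs_mul, abs_of_nonneg (a := |a| ^ k) (by positivity)]
      _ ≤ ∫ s, B * (M (a * s + b) + M (-a * s + b)) ∂bm (κ - k) := by
          have i3 : Integrable (fun s => B * (M (a * s + b) + M (-a * s + b))) (bm (κ - k)) :=
            (i1.add i2).const_mul B
          refine (Real.norm_eq_abs _).symm.trans_le (norm_integral_le_of_norm_le i3 ?_)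
          filter_upwards [bm_ae (κ - k)] with s hs
          have hs1 : |s| ≤ 1 := abs_le.2 hs
          have h4 := h (a * s) b (by rw [abs_mul]; nlinarith [abs_nonneg a, abs_nonneg s])
          rw [Real.norm_eq_abs, abs_mul, abs_mul, abs_of_nonneg (a := |a| ^ k) (by positivity),
            abs_of_nonneg (a := |s| ^ (2 * k)) (by positivity)]
          rw [abs_mul, mul_rpow (abs_nonneg _) (abs_nonneg _)] at h4
          have h5 : |s| ^ (2 * k) ≤ |s| ^ k := rpow_le_rpow_of_exponent_ge' (abs_nonneg _) hs1 hk.le (by linarith)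
          simp only [mul_assoc] at h4 ⊢
          rw [neg_mul]
          refine le_trans ?_ h4
          gcongr
      _ = 2 * B * ∫ s, M (a * s + b) ∂bm (κ - k) := by
          have := integral_bm_neg (κ - k) (fun s => M (a * s + b))
          simp only [mul_neg] at this
          rw [MeasureTheory.integral_const_mul, MeasureTheory.integral_add i1 i2]
          simp only [neg_mul]
          rw [this]; ring
  rw [hQi]
  calc _ = Q⁻¹ * (Q * (|a| ^ k * |∫ u, F (a * u + b) ∂bm κ|)) := by field_simp
    _ ≤ Q⁻¹ * (2 * B * ∫ s, M (a * s + b) ∂bm (κ - k)) := by gcongr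
    _ = _ := by ring

lemma integrable_pi_bm_of_continuous {m : ℕ} (κ : Fin m → ℝ) {G : (Fin m → ℝ) → ℝ} (hG : Continuous G) :
    Integrable G (Measure.pi fun j => bm (κ j)) := by
  obtain ⟨C, hC⟩ := (isCompact_univ_pi fun _ : Fin m => isCompact_Icc (a := (-1:ℝ)) (b := 1)).exists_bound_of_continuousOn
    hG.continuousOn
  refine Integrable.of_bound hG.aestronglyMeasurable C ?_
  filter_upwards [ae_pi_bm_mem κ] with t ht using hC t fun j _ => ht j

lemma integral_pi_bm_split {m : ℕ} (κ a : Fin (m + 1) → ℝ) (i : Fin (m + 1)) {G : ℝ → ℝ} (hG : Continuous G) :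
    ∫ t, G (∑ j, a j * t j) ∂Measure.pi (fun j => bm (κ j)) =
      ∫ t, (∫ u, G (a i * u + ∑ j, a (i.succAbove j) * t j) ∂bm (κ i))
        ∂Measure.pi (fun j => bm (κ (i.succAbove j))) ∧
    Integrable (fun t => ∫ u, G (a i * u + ∑ j, a (i.succAbove j) * t j) ∂bm (κ i))
      (Measure.pi (fun j => bm (κ (i.succAbove j)))) := by
  have hmp := measurePreserving_piFinSuccAbove (fun j => bm (κ j)) i
  set g : ℝ × (Fin m → ℝ) → ℝ := fun p => G (a i * p.1 + ∑ j, a (i.succAbove j) * p.2 j) with hg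
  have hgc : Continuous g := by fun_prop
  have he : ∀ t, g (MeasurableEquiv.piFinSuccAbove (fun _ => ℝ) i t) = G (∑ j, a j * t j) := by
    intro t
    rw [Fin.sum_univ_succAbove _ i]
    rfl
  have hi : Integrable g ((bm (κ i)).prod (Measure.pi fun j => bm (κ (i.succAbove j)))) := by
    rw [← hmp.integrable_comp_emb (MeasurableEquiv.measurableEmbedding _)]
    refine (integrable_pi_bm_of_continuous κ (G := fun t => G (∑ j, a j * t j)) (by fun_prop)).congr ?_
    exact Filter.Eventually.of_forall fun t => (he t).symm
  have h := hmp.integral_comp' g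
  simp only [he] at h
  exact ⟨by rw [h, integral_prod_symm _ hi], hi.integral_prod_right⟩

lemma sum_sqrt_le_one {d : ℕ} {x y : Fin d → ℝ} (hx : x ∈ simplexT d) (hy : y ∈ simplexT d) :
    ∑ j, √(xext d x j * xext d y j) ≤ 1 := by
  have := (abs_zST_le hx hy (t := fun _ => 1) (fun j => by norm_num)).2
  simpa [zST] using this

lemma abs_integral_pi_bm_le {d : ℕ} {κ : Fin (d + 1) → ℝ} {i : Fin (d + 1)} {k : ℝ} (hk : 0 < k) (hκ : k ≤ κ i)
    {F M : ℝ → ℝ} {B : ℝ} (hF : Continuous F) (hM : Continuous M)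
    (h : ∀ a b, |a| + |b| ≤ 1 →
      |a| ^ k * |∫ t, F (a * t + b) ∂bm k| ≤ B * (M (a + b) + M (-a + b)))
    {x y : Fin d → ℝ} (hx : x ∈ simplexT d) (hy : y ∈ simplexT d) :
    √(xext d x i * xext d y i) ^ k * |∫ t, F (zST d x y t) ∂Measure.pi fun j => bm (κ j)| ≤
      2 * (bmC (κ i) / (bmC (κ i - k) * bmC k)) * B *
        ∫ t, M (zST d x y t) ∂Measure.pi fun j => bm (Function.update κ i (κ i - k) j) := by
  simp only [zST]
  set a : Fin (d + 1) → ℝ := fun j => √(xext d x j * xext d y j) with ha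
  have ha0 : ∀ j, 0 ≤ a j := fun j => sqrt_nonneg _
  have ha1 : a i + ∑ j, a (i.succAbove j) ≤ 1 := by
    rw [← Fin.sum_univ_succAbove]; exact sum_sqrt_le_one hx hy
  rw [(integral_pi_bm_split κ a i hF).1, (integral_pi_bm_split _ a i hM).1]
  have hi := (integral_pi_bm_split (Function.update κ i (κ i - k)) a i hM).2
  simp only [Function.update_self, ne_eq, Fin.succAbove_ne, not_false_eq_true, Function.update_of_ne] at hi ⊢
  rw [← MeasureTheory.integral_const_mul, ← abs_of_nonneg (rpow_nonneg (ha0 i) k), ← abs_mul,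
    ← MeasureTheory.integral_const_mul]
  refine (Real.norm_eq_abs _).symm.trans_le (norm_integral_le_of_norm_le (hi.const_mul _) ?_)
  filter_upwards [ae_pi_bm_mem fun j => κ (i.succAbove j)] with t ht
  have := abs_integral_bm_le hk hκ hF hM h (a := a i) (b := ∑ j, a (i.succAbove j) * t j) (by
    rw [abs_of_nonneg (ha0 i)]
    refine le_trans ?_ ha1
    gcongr
    refine (Finset.abs_sum_le_sum_abs _ _).trans (Finset.sum_le_sum fun j _ => ?_)
    rw [abs_mul, abs_of_nonneg (ha0 _)]
    exact mul_le_of_le_one_right (ha0 _) (abs_le.2 (ht j)))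
  rw [norm_mul, Real.norm_eq_abs, Real.norm_eq_abs, abs_of_nonneg (rpow_nonneg (ha0 i) k)]
  rwa [abs_of_nonneg (ha0 i)] at this

lemma integrable_dirM_prod {d : ℕ} {α κ : Fin (d + 1) → ℝ} (hα : ∀ j, 0 < α j) {x : Fin d → ℝ}
    (hx : x ∈ simplexT d) {M : ℝ → ℝ} (hM : Continuous M) :
    Integrable (fun p : (Fin d → ℝ) × (Fin (d + 1) → ℝ) => M (zST d x p.1 p.2))
      ((dirM d α).prod (Measure.pi fun j => bm (κ j))) := by
  have := isFiniteMeasure_dirM hα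
  obtain ⟨C, hC⟩ := (isCompact_Icc (a := (-1:ℝ)) (b := 1)).exists_bound_of_continuousOn hM.continuousOn
  refine Integrable.of_bound (hM.comp (continuous_zST x)).aestronglyMeasurable C ?_
  filter_upwards [ae_prod_zST α κ hx] with p hp using hC _ hp

lemma exists_xext_ge {d : ℕ} (x : Fin d → ℝ) : ∃ i, 1 / ((d : ℝ) + 1) ≤ xext d x i := by
  by_contra! h
  have h1 := Finset.sum_lt_sum_of_nonempty (s := univ) Finset.univ_nonempty fun i _ => h i
  rw [sum_xext] at h1
  simp only [Finset.sum_const, Finset.card_univ, Fintype.card_fin, nsmul_eq_mul] at h1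
  push_cast at h1
  rw [mul_one_div_cancel (by positivity)] at h1
  exact lt_irrefl _ h1

lemma rpow_le_of_sqrt_mul {d : ℕ} {u v k : ℝ} (hk : 0 < k) (hu : 1 / ((d : ℝ) + 1) ≤ u) (hv : 0 ≤ v) (hv1 : v ≤ 1) :
    v ^ k ≤ ((d : ℝ) + 1) ^ (k / 2) * √(u * v) ^ k := by
  have hu0 : 0 < u := lt_of_lt_of_le (by positivity) hu
  rw [sqrt_eq_rpow, ← rpow_mul (by positivity), show 1 / 2 * k = k / 2 by ring, ← mul_rpow (by positivity) (by positivity)]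
  calc v ^ k ≤ v ^ (k / 2) := rpow_le_rpow_of_exponent_ge' hv hv1 (by positivity) (by linarith)
    _ ≤ _ := by
      refine rpow_le_rpow hv ?_ (by positivity)
      rw [← mul_assoc]
      refine le_mul_of_one_le_left hv ?_
      rw [div_le_iff₀ (by positivity)] at hu
      linarith

lemma simpL_le_of_index {d : ℕ} {κ : Fin (d + 1) → ℝ} (hκ0 : ∀ j, 0 < κ j) (i : Fin (d + 1)) {k : ℝ} (hk : 0 < k)
    (hκ : k ≤ κ i) : ∃ C, 0 < C ∧ ∀ {S : Polynomial ℝ} {M : ℝ → ℝ} {B : ℝ}, Continuous M → (∀ u, 0 ≤ M u) → 0 ≤ B →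
    (∀ a b, |a| + |b| ≤ 1 →
      |a| ^ k * |∫ t, S.eval (a * t + b) ∂bm k| ≤ B * (M (a + b) + M (-a + b))) →
    ∀ x ∈ simplexT d, 1 / ((d : ℝ) + 1) ≤ xext d x i →
      simpL d κ S x ≤ C * B * ∫ t, M t ∂bm (∑ j, κ j + d / 2 - k) := by
  set κ' : Fin (d + 1) → ℝ := Function.update κ i (κ i - k) with hκ'
  have hκ'0 : ∀ j, 0 ≤ κ' j := by
    intro j
    by_cases hj : j = i
    · subst hj; simp only [hκ', Function.update_self]; linarith
    · simp only [hκ', Function.update_of_ne hj]; exact (hκ0 j).le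
  have hs : ∑ j, κ' j + (d : ℝ) / 2 = ∑ j, κ j + d / 2 - k := by
    rw [hκ', Finset.sum_update_of_mem (mem_univ i), ← Finset.add_sum_erase _ _ (mem_univ i), Finset.sdiff_singleton_eq_erase]
    ring
  have hκκ' : ∀ j, κ j + 1 / 2 = κ' j + 1 / 2 + (if j = i then k else 0) := by
    intro j
    by_cases hj : j = i
    · subst hj; simp [hκ']; ring
    · simp [hκ', hj]
  obtain ⟨C1, hC1, hmap⟩ := map_zST hκ'0
  have b1 := bmC_pos (κ := κ i - k) (by linarith)
  have b2 := bmC_pos hk.le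
  have b3 := bmC_pos (hk.le.trans hκ)
  have hα : ∀ j, 0 < κ' j + 1 / 2 := fun j => by have := hκ'0 j; positivity
  refine ⟨((d : ℝ) + 1) ^ (k / 2) * (2 * (bmC (κ i) / (bmC (κ i - k) * bmC k))) * C1, by positivity, ?_⟩
  intro S M B hM hM0 hB h x hx hxi
  have hdir : simpL d κ S x = ∫ y, xext d y i ^ k *
      |∫ t, S.eval (zST d x y t) ∂Measure.pi fun j => bm (κ j)| ∂dirM d fun j => κ' j + 1 / 2 := by
    rw [simpL, show (fun j => κ j + 1 / 2) = fun j => κ' j + 1 / 2 + (if j = i then k else 0) from funext hκκ',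
      ← integral_dirM_mul_prod]
    congr 1
    funext y
    congr 1
    rw [Finset.prod_eq_single i]
    · simp
    · intro j _ hj; simp [hj]
    · simp
  have hintg := integrable_dirM_prod (κ := κ') hα hx hM
  have hval := integral_eq_of_map_eq_smul (continuous_zST x).measurable hC1.le (hmap x hx) hM.aestronglyMeasurable
  have := isFiniteMeasure_dirM hα
  rw [MeasureTheory.integral_prod _ hintg, hs] at hval
  rw [hdir]
  calc _ ≤ ∫ y, ((d : ℝ) + 1) ^ (k / 2) * (2 * (bmC (κ i) / (bmC (κ i - k) * bmC k))) * B *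
        (∫ t, M (zST d x y t) ∂Measure.pi fun j => bm (κ' j)) ∂dirM d fun j => κ' j + 1 / 2 := by
        refine integral_mono_of_nonneg ?_ (hintg.integral_prod_left.const_mul _) ?_
        · filter_upwards [ae_dirM_mem _ _] with y hy
          have := mem_simplexT_iff.1 hy i
          simp only [Pi.zero_apply]
          positivity
        · filter_upwards [ae_dirM_mem _ _] with y hy
          have h1 := abs_integral_pi_bm_le (x := x) (y := y) hk hκ S.continuous hM h hx hy
          have h2 := rpow_le_of_sqrt_mul (d := d) hk hxi (mem_simplexT_iff.1 hy i) (xext_le_one hy i)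
          calc _ ≤ ((d : ℝ) + 1) ^ (k / 2) * √(xext d x i * xext d y i) ^ k * _ := by gcongr
            _ ≤ ((d : ℝ) + 1) ^ (k / 2) * (2 * (bmC (κ i) / (bmC (κ i - k) * bmC k)) * B *
                ∫ t, M (zST d x y t) ∂Measure.pi fun j => bm (κ' j)) := by
                rw [mul_assoc]; gcongr
            _ = _ := by ring
    _ = _ := by rw [MeasureTheory.integral_const_mul, hval]; ring

lemma continuous_majB_cos (δ m : ℝ) {R : ℝ} (hR0 : 0 ≤ R) (hR1 : R < 1) :
    Continuous fun ψ => majB δ m R (Real.cos ψ) :=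
  intervalIntegral.continuous_parametric_intervalIntegral_of_continuous'
    (continuousOn_majB_cos δ m hR0 hR1) 0 (2 * π)

lemma integral_bm_eq_cos {κ : ℝ} (hκ : 0 < κ) (f : ℝ → ℝ) :
    ∫ t, f t ∂bm κ = ∫ ψ in (0 : ℝ)..π, f (Real.cos ψ) * Real.sin ψ ^ (2 * κ - 1) := by
  have himg : Real.cos '' Set.Ioo 0 π = Set.Ioo (-1) 1 := by
    have := Real.cosPartialHomeomorph.image_source_eq_target
    exact this
  rw [integral_bm hκ]
  have e1 : ∫ t, bmDens κ t • f t = ∫ t in Set.Ioo (-1 : ℝ) 1, (1 - t ^ 2) ^ (κ - 1) * f t := by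
    rw [← MeasureTheory.integral_indicator measurableSet_Ioo]
    congr 1
    funext t
    by_cases ht : t ∈ Set.Ioo (-1 : ℝ) 1
    · rw [Set.indicator_of_mem ht, bmDens, Set.indicator_of_mem ht, smul_eq_mul]
    · rw [Set.indicator_of_notMem ht, bmDens, Set.indicator_of_notMem ht, zero_smul]
  rw [e1, ← himg, integral_image_eq_integral_abs_deriv_smul measurableSet_Ioo
    (fun x _ => (Real.hasDerivAt_cos x).hasDerivWithinAt)
    (Real.injOn_cos.mono Set.Ioo_subset_Icc_self),
    intervalIntegral.integral_of_le pi_pos.le, ← integral_Ioc_eq_integral_Ioo]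
  rw [integral_Ioc_eq_integral_Ioo, integral_Ioc_eq_integral_Ioo]
  refine setIntegral_congr_fun measurableSet_Ioo fun ψ hψ => ?_
  have hs : 0 < Real.sin ψ := Real.sin_pos_of_mem_Ioo hψ
  simp only [smul_eq_mul, abs_neg, abs_of_pos hs]
  rw [show 1 - Real.cos ψ ^ 2 = Real.sin ψ ^ 2 by rw [Real.sin_sq], ← rpow_natCast, ← rpow_mul hs.le,
    show 2 * κ - 1 = 1 + ((2 : ℕ) : ℝ) * (κ - 1) by push_cast; ring, rpow_add hs, rpow_one]
  ring

lemma simpL_cesPoly_le {d : ℕ} {κ : Fin (d + 1) → ℝ} (hκ0 : ∀ j, 0 < κ j) {k m : ℝ} (hk : 0 < k)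
    (hkκ : ∀ j, k ≤ κ j) (hkm : k ≤ m + 1) (hm : 0 < m) (hl : m + k = ∑ j, κ j + ((d : ℝ) - 1) / 2) :
    ∃ C, 0 < C ∧ ∀ (δ R : ℝ) (n : ℕ), 1 / 2 ≤ R → R < 1 → ∀ x ∈ simplexT d,
      R ^ (2 * n) * simpL d κ (cesPoly δ (m + k) n) x ≤ C * (1 - R) ^ (-m) * pI (m - 1 - δ) (R ^ 2) := by
  choose C hC h using fun i => simpL_le_of_index hκ0 i hk (hkκ i)
  obtain ⟨C', hC', h'⟩ := integral_majB_le m hm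
  set V := (bm k).real Set.univ
  have hV : 0 ≤ V := measureReal_nonneg
  refine ⟨(1 + ∑ i, C i) * (V + 1) / (2 * π) * C', ?_, fun δ R n hR0 hR1 x hx => ?_⟩
  · have := Finset.sum_nonneg fun i (_ : i ∈ univ) => (hC i).le
    positivity
  obtain ⟨i, hi⟩ := exists_xext_ge x
  have hR : 0 < R := by linarith
  have hCi : C i ≤ 1 + ∑ i, C i := by
    have := Finset.single_le_sum (fun i _ => (hC i).le) (mem_univ i)
    linarith
  have hM : Continuous fun u => majB δ m R (Real.cos (Real.arccos u)) :=
    (continuous_majB_cos δ m hR.le hR1).comp Real.continuous_arccos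
  have hMeq : ∀ u, |u| ≤ 1 → majB δ m R (Real.cos (Real.arccos u)) = majB δ m R u := fun u hu => by
    rw [Real.cos_arccos (abs_le.1 hu).1 (abs_le.1 hu).2]
  have key := h i (S := cesPoly δ (m + k) n) (M := fun u => majB δ m R (Real.cos (Real.arccos u)))
    (B := V / (2 * π * R ^ (2 * n))) hM (fun u => majB_nonneg _ _ _ _) (by positivity)
    (fun a b hab => by
      have h1 := abs_integral_cesPoly_le hk hkm hab δ n hR0 hR1
      rw [hMeq _ ((abs_add_le a b).trans hab), hMeq _ ((abs_add_le (-a) b).trans (by rwa [abs_neg])),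
        div_mul_eq_mul_div, le_div_iff₀ (by positivity)]
      linarith) x hx hi
  have e1 : ∫ t, majB δ m R (Real.cos (Real.arccos t)) ∂bm (∑ j, κ j + d / 2 - k) =
      ∫ ψ in (0 : ℝ)..π, majB δ m R (Real.cos ψ) * Real.sin ψ ^ (2 * m) := by
    rw [show ∑ j, κ j + (d : ℝ) / 2 - k = m + 1 / 2 by linarith, integral_bm_eq_cos (by linarith)]
    refine intervalIntegral.integral_congr fun ψ _ => ?_
    rw [Real.cos_arccos (Real.neg_one_le_cos _) (Real.cos_le_one _)]
    congr 2; ring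
  rw [e1] at key
  have h2 := h' δ R hR0 hR1
  have hp := pI_nonneg (m - 1 - δ) (R ^ 2)
  have he : 0 < 1 - R := by linarith
  have hb : 0 ≤ ∫ ψ in (0 : ℝ)..π, majB δ m R (Real.cos ψ) * Real.sin ψ ^ (2 * m) := by
    refine intervalIntegral.integral_nonneg pi_pos.le fun ψ hψ => ?_
    exact mul_nonneg (majB_nonneg _ _ _ _) (rpow_nonneg (Real.sin_nonneg_of_mem_Icc hψ) _)
  calc _ ≤ R ^ (2 * n) * (C i * (V / (2 * π * R ^ (2 * n))) *
        ∫ ψ in (0 : ℝ)..π, majB δ m R (Real.cos ψ) * Real.sin ψ ^ (2 * m)) := by gcongr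
    _ = C i * V / (2 * π) * ∫ ψ in (0 : ℝ)..π, majB δ m R (Real.cos ψ) * Real.sin ψ ^ (2 * m) := by
        have := pi_pos
        field_simp
    _ ≤ (1 + ∑ i, C i) * (V + 1) / (2 * π) * (C' * (1 - R) ^ (-m) * pI (m - 1 - δ) (R ^ 2)) := by
        have hS : 0 < 1 + ∑ i, C i := (hC i).trans_le hCi
        have : C i * V / (2 * π) ≤ (1 + ∑ i, C i) * (V + 1) / (2 * π) := by
          gcongr
          linarith
        exact mul_le_mul this h2 hb (by positivity)
    _ = _ := by ring

/-- Upper bounds for the unnormalized norms. -/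
lemma simpL_cesPoly_bounds {d : ℕ} {κ : Fin (d + 1) → ℝ} (hκ0 : ∀ j, 0 < κ j) {k m : ℝ} (hk : 0 < k)
    (hkκ : ∀ j, k ≤ κ j) (hkm : k ≤ m + 1) (hm : 0 < m) (hl : m + k = ∑ j, κ j + ((d : ℝ) - 1) / 2) (δ : ℝ) :
    (δ < m → ∃ C, 0 < C ∧ ∀ n : ℕ, 1 ≤ n → ∀ x ∈ simplexT d, simpL d κ (cesPoly δ (m + k) n) x ≤ C * (n : ℝ) ^ m) ∧
    (δ = m → ∃ C, 0 < C ∧ ∀ n : ℕ, 2 ≤ n → ∀ x ∈ simplexT d,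
      simpL d κ (cesPoly δ (m + k) n) x ≤ C * ((n : ℝ) ^ m * Real.log n)) ∧
    (m < δ → ∃ C, 0 < C ∧ ∀ n : ℕ, 1 ≤ n → ∀ x ∈ simplexT d, simpL d κ (cesPoly δ (m + k) n) x ≤ C * (n : ℝ) ^ δ) := by
  obtain ⟨C, hC, h⟩ := simpL_cesPoly_le hκ0 hk hkκ hkm hm hl
  have main : ∀ n : ℕ, 1 ≤ n → ∃ R : ℝ, 1 / 4 ≤ R ^ 2 ∧ R ^ 2 < 1 ∧ 1 / (2 * (n : ℝ)) ≤ 1 - R ^ 2 ∧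
      ∀ x ∈ simplexT d, simpL d κ (cesPoly δ (m + k) n) x ≤
        4 * C * 2 ^ m * (n : ℝ) ^ m * pI (m - 1 - δ) (R ^ 2) := by
    intro n hn
    have hn' : (1 : ℝ) ≤ n := by exact_mod_cast hn
    set e : ℝ := 1 / (2 * n) with he
    have he0 : 0 < e := by positivity
    have he1 : e ≤ 1 / 2 := by rw [he]; gcongr; linarith
    have hp := pI_nonneg (m - 1 - δ) ((1 - e) ^ 2)
    refine ⟨1 - e, by nlinarith, by nlinarith, by nlinarith, fun x hx => ?_⟩
    have h1 := h δ (1 - e) n (by linarith) (by linarith) x hx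
    have h2 : 1 / 4 ≤ (1 - e) ^ (2 * n) := by
      have b := one_add_mul_le_pow (a := -e) (by linarith) n
      have : (n : ℝ) * -e = -(1 / 2) := by rw [he]; field_simp
      rw [this] at b
      rw [← sub_eq_add_neg 1 e] at b
      rw [mul_comm, pow_mul]
      nlinarith
    have h3 : (1 - (1 - e)) ^ (-m) = 2 ^ m * (n : ℝ) ^ m := by
      rw [sub_sub_cancel, rpow_neg he0.le, he, one_div, inv_rpow (by positivity), inv_inv, mul_rpow (by norm_num) (by positivity)]
    rw [h3] at h1
    have h4 := simpL_nonneg κ (cesPoly δ (m + k) n) x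
    nlinarith
  refine ⟨fun hδ => ?_, fun hδ => ?_, fun hδ => ?_⟩
  · obtain ⟨C1, hC1, hp⟩ := pI_le_of_gt (p := m - 1 - δ) (by linarith)
    refine ⟨4 * C * 2 ^ m * C1, by positivity, fun n hn x hx => ?_⟩
    obtain ⟨R, hR0, hR1, -, hR⟩ := main n hn
    refine (hR x hx).trans ?_
    have := hp _ hR0 hR1
    calc _ ≤ 4 * C * 2 ^ m * (n : ℝ) ^ m * C1 := by gcongr
      _ = _ := by ring
  · obtain ⟨C1, hC1, hp⟩ := pI_le_of_eq
    subst hδ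
    have hl2 : 0 < Real.log 2 := Real.log_pos (by norm_num)
    refine ⟨4 * C * 2 ^ δ * (C1 * (1 / Real.log 2 + 2)), by positivity, fun n hn x hx => ?_⟩
    have hn' : (2 : ℝ) ≤ n := by exact_mod_cast hn
    obtain ⟨R, hR0, hR1, hR2, hR⟩ := main n (by omega)
    refine (hR x hx).trans ?_
    have h1 := hp _ hR0 hR1
    have h2 : Real.log (1 / (1 - R ^ 2)) ≤ Real.log 2 + Real.log n := by
      rw [← Real.log_mul (by norm_num) (by positivity)]
      refine Real.log_le_log (by rw [one_div]; exact inv_pos.2 (by linarith)) ?_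
      rw [one_div_le (by linarith) (by positivity)]
      exact hR2
    have h3 : Real.log 2 ≤ Real.log n := Real.log_le_log (by norm_num) hn'
    have h4 : 1 + Real.log (1 / (1 - R ^ 2)) ≤ (1 / Real.log 2 + 2) * Real.log n := by
      have : 1 ≤ 1 / Real.log 2 * Real.log n := by
        rw [one_div, inv_mul_eq_div, le_div_iff₀ hl2]; linarith
      linarith
    rw [show δ - 1 - δ = -1 by ring]
    calc _ ≤ 4 * C * 2 ^ δ * (n : ℝ) ^ δ * (C1 * ((1 / Real.log 2 + 2) * Real.log n)) := by
          gcongr; exact h1.trans (by gcongr)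
      _ = _ := by ring
  · obtain ⟨C1, hC1, hp⟩ := pI_le_of_lt (p := m - 1 - δ) (by linarith)
    refine ⟨4 * C * 2 ^ m * C1 * 2 ^ (δ - m), by positivity, fun n hn x hx => ?_⟩
    have hn' : (1 : ℝ) ≤ n := by exact_mod_cast hn
    obtain ⟨R, hR0, hR1, hR2, hR⟩ := main n hn
    refine (hR x hx).trans ?_
    have h1 := hp _ hR0 hR1
    have h2 : (1 - R ^ 2) ^ (m - 1 - δ + 1) ≤ 2 ^ (δ - m) * (n : ℝ) ^ (δ - m) := by
      refine (rpow_le_rpow_of_nonpos (by positivity) hR2 (by linarith)).trans_eq ?_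
      rw [one_div, inv_rpow (by positivity), ← rpow_neg (by positivity), mul_rpow (by norm_num) (by positivity)]
      ring_nf
    calc _ ≤ 4 * C * 2 ^ m * (n : ℝ) ^ m * (C1 * (2 ^ (δ - m) * (n : ℝ) ^ (δ - m))) := by
          gcongr; exact h1.trans (by gcongr)
      _ = 4 * C * 2 ^ m * C1 * 2 ^ (δ - m) * ((n : ℝ) ^ m * (n : ℝ) ^ (δ - m)) := by ring
      _ = _ := by rw [← rpow_add (by positivity)]; congr 2; ring

/-- The polynomial `a ↦ ∫ S (a u) d(bm k)(u)`. -/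
noncomputable def bmPoly (k : ℝ) (S : Polynomial ℝ) : Polynomial ℝ :=
  ∑ j ∈ range (S.natDegree + 1), Polynomial.monomial j (S.coeff j * ∫ u, u ^ j ∂bm k)

lemma bmPoly_eval (k : ℝ) (S : Polynomial ℝ) (a : ℝ) :
    (bmPoly k S).eval a = ∫ u, S.eval (a * u) ∂bm k := by
  simp only [Polynomial.eval_eq_sum_range (p := S)]
  rw [MeasureTheory.integral_finsetSum]
  · rw [bmPoly, Polynomial.eval_finsetSum]
    refine Finset.sum_congr rfl fun j _ => ?_
    rw [Polynomial.eval_monomial, ← MeasureTheory.integral_const_mul, ← MeasureTheory.integral_mul_const]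
    congr 1; funext u; ring
  · intro j _
    have := continuous_integrable_comp_affine (bm_ae k) (M := fun s => S.coeff j * s ^ j) (by fun_prop) a 0
    simpa using this

lemma bmPoly_coeff (k : ℝ) (S : Polynomial ℝ) (j : ℕ) :
    (bmPoly k S).coeff j = S.coeff j * ∫ u, u ^ j ∂bm k := by
  rw [bmPoly, Polynomial.finsetSum_coeff]
  simp only [Polynomial.coeff_monomial, Finset.sum_ite_eq', Finset.mem_range]
  split_ifs with h
  · rfl
  · rw [Polynomial.coeff_eq_zero_of_natDegree_lt (by omega), zero_mul]

lemma bmPoly_natDegree_le (k : ℝ) (S : Polynomial ℝ) : (bmPoly k S).natDegree ≤ S.natDegree := by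
  rw [Polynomial.natDegree_le_iff_coeff_eq_zero]
  intro N hN
  rw [bmPoly_coeff, Polynomial.coeff_eq_zero_of_natDegree_lt hN, zero_mul]

lemma bmPoly_eval_neg (k : ℝ) (S : Polynomial ℝ) (a : ℝ) :
    (bmPoly k S).eval (-a) = (bmPoly k S).eval a := by
  rw [bmPoly_eval, bmPoly_eval, ← integral_bm_neg]
  simp

lemma bmPoly_eval_abs (k : ℝ) (S : Polynomial ℝ) (a : ℝ) :
    (bmPoly k S).eval |a| = (bmPoly k S).eval a := by
  rcases abs_choice a with h | h <;> rw [h]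
  exact bmPoly_eval_neg k S a

/-- The vertices of the simplex. -/
lemma exists_vertex {d : ℕ} (i : Fin (d + 1)) :
    ∃ x ∈ simplexT d, ∀ j, xext d x j = if j = i then 1 else 0 := by
  have h : ∃ x, ∀ j, xext d x j = if j = i then 1 else 0 := by
    refine Fin.lastCases ⟨0, fun j => ?_⟩ (fun i => ⟨Pi.single i 1, fun j => ?_⟩) i
    · refine Fin.lastCases ?_ (fun j => ?_) j
      · simp [xext_last]
      · simp [xext_castSucc, (Fin.castSucc_lt_last j).ne]
    · refine Fin.lastCases ?_ (fun j => ?_) j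
      · simp [xext_last, (Fin.castSucc_lt_last i).ne']
      · simp [xext_castSucc, Pi.single_apply]
  obtain ⟨x, hx⟩ := h
  refine ⟨x, mem_simplexT_iff.2 fun j => ?_, hx⟩
  rw [hx]; split_ifs <;> norm_num

lemma map_xext_dirM {d : ℕ} {κ : Fin (d + 1) → ℝ} (hκ : ∀ j, 0 < κ j) (i : Fin (d + 1)) {k m : ℝ}
    (hki : κ i = k) (hm : 0 ≤ m) (hl : m + k = ∑ j, κ j + ((d : ℝ) - 1) / 2) :
    ∃ C, 0 < C ∧ (dirM d fun j => κ j + 1 / 2).map (fun y => xext d y i) =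
      ENNReal.ofReal C • (bmAbs (m + 1 / 2) k).map (fun t => t ^ 2) := by
  have hk : 0 < k := hki ▸ hκ i
  have : Fact (0 ≤ k) := ⟨hk.le⟩
  have hα : ∀ j, 0 < κ j + 1 / 2 := fun j => by have := hκ j; positivity
  have := isFiniteMeasure_dirM hα
  have hm' : 0 ≤ m + 1 / 2 := by linarith
  have hb := bmC_pos hm'
  have hp : 0 < ∏ j ∈ univ.erase i, Gamma (κ j + 1 / 2) := Finset.prod_pos fun j _ => Gamma_pos_of_pos (hα j)
  refine ⟨(∏ j ∈ univ.erase i, Gamma (κ j + 1 / 2)) / bmC (m + 1 / 2), by positivity, ?_⟩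
  refine map_eq_smul_of_moments (continuous_xext i).measurable ?_ ?_ (by positivity) fun N => ?_
  · filter_upwards [ae_dirM_mem _ _] with y hy
    exact ⟨by linarith [mem_simplexT_iff.1 hy i], xext_le_one hy i⟩
  · refine (ae_map_iff (by fun_prop) (p := fun t => t ∈ Set.Icc (-1 : ℝ) 1) measurableSet_Icc).2 ?_
    filter_upwards [bmAbs_ae _ _] with t ht
    exact ⟨by nlinarith, by nlinarith [ht.1, ht.2]⟩
  · rw [integral_map (by fun_prop) (by fun_prop), integral_bmAbs]
    have e1 : ∫ s, |s| ^ (2 * k) * (s ^ 2) ^ N ∂bm (m + 1 / 2) = ∫ s, |s| ^ (2 * (k + N)) ∂bm (m + 1 / 2) := by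
      refine integral_congr_ae (Filter.Eventually.of_forall fun s => ?_)
      show |s| ^ (2 * k) * (s ^ 2) ^ N = |s| ^ (2 * (k + N))
      rw [mul_add, rpow_add_of_nonneg (abs_nonneg _) (by positivity) (by positivity), ← sq_abs, ← pow_mul]
      congr 1
      rw [← rpow_natCast]; push_cast; rfl
    rw [e1, (bm_moment hm' (by positivity)).2]
    have e2 := integral_dirM_prod (d := d) (α := fun j => κ j + 1 / 2) (p := fun j => if j = i then (N : ℝ) else 0)
      (fun j => by have := hα j; split_ifs <;> positivity)
    have e3 : ∀ y : Fin d → ℝ, (∏ j, xext d y j ^ (if j = i then (N : ℝ) else 0)) = xext d y i ^ N := by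
      intro y
      rw [Finset.prod_eq_single i (fun j _ hj => by simp [hj]) (by simp)]
      simp
    simp only [e3] at e2
    rw [e2, ← Finset.mul_prod_erase _ _ (mem_univ i), Finset.sum_add_distrib, Finset.sum_add_distrib,
      Finset.prod_congr rfl (g := fun j => Gamma (κ j + 1 / 2)) (fun j hj => by
        simp [Finset.ne_of_mem_erase hj])]
    simp only [if_true, hki, Finset.sum_const, Finset.card_univ, Fintype.card_fin, nsmul_eq_mul,
      Finset.sum_ite_eq', mem_univ]
    rw [show ∑ j, κ j + ((d + 1 : ℕ) : ℝ) * (1 / 2) + N = k + N + (m + 1 / 2) + 1 / 2 by push_cast; linarith,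
      show k + 1 / 2 + (N : ℝ) = k + N + 1 / 2 by ring]
    generalize (∏ j ∈ univ.erase i, Gamma (κ j + 1 / 2)) = G
    generalize bmC (m + 1 / 2) = b at *
    field_simp

lemma simpL_vertex {d : ℕ} {κ : Fin (d + 1) → ℝ} (hκ : ∀ j, 0 < κ j) (i : Fin (d + 1)) {k m : ℝ}
    (hki : κ i = k) (hm : 0 ≤ m) (hl : m + k = ∑ j, κ j + ((d : ℝ) - 1) / 2) :
    ∃ C, 0 < C ∧ ∃ x ∈ simplexT d, ∀ S : Polynomial ℝ, simpL d κ S x =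
      C * ∫ θ in (0 : ℝ)..π, |Real.cos θ| ^ (2 * k) * |(bmPoly k S).eval (Real.cos θ)| * Real.sin θ ^ (2 * m) := by
  obtain ⟨x, hx, hxi⟩ := exists_vertex i
  obtain ⟨C, hC, hmap⟩ := map_xext_dirM hκ i hki hm hl
  set D := ∫ _, (1 : ℝ) ∂Measure.pi (fun j => bm (κ (i.succAbove j))) with hD
  have hD0 : 0 < D := pi_bm_real_univ_pos fun j => (hκ _).le
  refine ⟨D * C, by positivity, x, hx, fun S => ?_⟩
  have e1 : ∀ y, ∫ t, S.eval (zST d x y t) ∂Measure.pi (fun j => bm (κ j)) =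
      D * (bmPoly k S).eval √(xext d y i) := by
    intro y
    simp only [zST, hxi]
    rw [(integral_pi_bm_split κ _ i S.continuous).1]
    simp only [if_true, Fin.succAbove_ne, if_false, one_mul, zero_mul, sqrt_zero, Finset.sum_const_zero, add_zero]
    rw [hki, ← bmPoly_eval, hD, ← MeasureTheory.integral_mul_const]
    simp
  have hcont : Continuous fun v => |(bmPoly k S).eval √v| := by
    exact ((bmPoly k S).continuous.comp continuous_sqrt).abs
  simp only [simpL, e1, abs_mul, abs_of_pos hD0]
  rw [MeasureTheory.integral_const_mul, integral_eq_of_map_eq_smul (continuous_xext i).measurable hC.le hmap hcont.aestronglyMeasurable,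
    integral_map (by fun_prop) hcont.aestronglyMeasurable, integral_bmAbs, integral_bm_eq_cos (by linarith), mul_assoc]
  congr 2
  refine intervalIntegral.integral_congr fun θ _ => ?_
  rw [sqrt_sq_eq_abs, bmPoly_eval_abs, show 2 * (m + 1 / 2) - 1 = 2 * m by ring]

/-- A lower bound valid above the critical index. -/
lemma simpL_ge_abs_integral {d : ℕ} {κ : Fin (d + 1) → ℝ} (hκ : ∀ j, 0 < κ j) :
    ∃ C, 0 < C ∧ ∀ x ∈ simplexT d, ∀ S : Polynomial ℝ,
      C * |∫ t, S.eval t ∂bm (∑ j, κ j + d / 2)| ≤ simpL d κ S x := by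
  obtain ⟨C, hC, h⟩ := map_zST fun j => (hκ j).le
  refine ⟨C, hC, fun x hx S => ?_⟩
  have hα : ∀ j, 0 < κ j + 1 / 2 := fun j => by have := hκ j; positivity
  have hval := integral_eq_of_map_eq_smul (continuous_zST x).measurable hC.le (h x hx) S.continuous.aestronglyMeasurable
  have := isFiniteMeasure_dirM hα
  rw [MeasureTheory.integral_prod _ (integrable_dirM_prod hα hx S.continuous)] at hval
  rw [← abs_of_pos hC, ← abs_mul, ← hval]
  exact abs_integral_le_integral_abs

lemma coeff_le_integral_cos {V : Polynomial ℝ} {n : ℕ} (hV : V.natDegree ≤ 2 * n)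
    (heven : ∀ a, V.eval (-a) = V.eval a) (p : ℕ) :
    π * |V.coeff (2 * n)| ≤
      4 ^ (p + n) * ∫ θ in (0 : ℝ)..π, |V.eval (Real.cos θ)| * |Real.sin θ * Real.cos θ| ^ p := by
  set f : ℂ → ℂ := fun z => (∑ j ∈ range (2 * n + 1), (V.coeff j : ℂ) * ((z ^ 2 + 1) / 2) ^ j * z ^ (2 * n - j)) *
    (1 - z ^ 4) ^ p with hf
  have hd : Differentiable ℂ f := by fun_prop
  have hav : circleAverage f 0 1 = f 0 := hd.diffContOnCl.circleAverage
  set g : ℝ → ℝ := fun θ => |V.eval (Real.cos θ)| * |Real.sin θ * Real.cos θ| ^ p with hg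
  have hgc : Continuous g := by
    have := V.continuous.comp Real.continuous_cos
    exact this.abs.mul (by fun_prop)
  have hnorm : ∀ θ, ‖f (circleMap 0 1 θ)‖ = 4 ^ p * g θ := by
    intro θ
    set z := circleMap 0 1 θ with hz
    have hz1 : ‖z‖ = 1 := by simp [hz]
    have hzc : z = (Real.cos θ : ℂ) + (Real.sin θ : ℂ) * Complex.I := by
      rw [hz, circleMap_zero, Complex.ofReal_one, one_mul, Complex.exp_mul_I, Complex.ofReal_cos, Complex.ofReal_sin]
    have hcs : (Real.cos θ : ℂ) ^ 2 + (Real.sin θ : ℂ) ^ 2 = 1 := by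
      exact_mod_cast Real.cos_sq_add_sin_sq θ
    have e1 : (z ^ 2 + 1) / 2 = (Real.cos θ : ℂ) * z := by
      rw [hzc]; linear_combination (-1 / 2 : ℂ) * hcs + ((Real.sin θ : ℂ) ^ 2 / 2) * Complex.I_sq
    have e2 : 1 - z ^ 4 = -4 * Complex.I * (Real.sin θ * Real.cos θ : ℝ) * z ^ 2 := by
      have a1 : 1 + z ^ 2 = 2 * ((Real.cos θ : ℂ) * z) := by rw [← e1]; ring
      have a2 : 1 - z ^ 2 = -2 * Complex.I * Real.sin θ * z := by
        rw [hzc]; linear_combination (-1 : ℂ) * hcs - ((Real.sin θ : ℂ) ^ 2 * (-1)) * Complex.I_sq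
      calc 1 - z ^ 4 = (1 - z ^ 2) * (1 + z ^ 2) := by ring
        _ = _ := by rw [a1, a2]; push_cast; ring
    have e3 : ∑ j ∈ range (2 * n + 1), (V.coeff j : ℂ) * ((z ^ 2 + 1) / 2) ^ j * z ^ (2 * n - j) =
        ((V.eval (Real.cos θ) : ℝ) : ℂ) * z ^ (2 * n) := by
      rw [Polynomial.eval_eq_sum_range' (n := 2 * n + 1) (by omega)]
      push_cast
      rw [Finset.sum_mul]
      refine Finset.sum_congr rfl fun j hj => ?_
      have : z ^ (2 * n) = z ^ j * z ^ (2 * n - j) := by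
        rw [← pow_add, Nat.add_sub_cancel' (by have := Finset.mem_range.1 hj; omega)]
      rw [e1, this, mul_pow]
      push_cast
      ring
    simp only [hf, hg]
    rw [e3, e2, norm_mul, norm_mul, norm_pow, norm_pow, norm_mul, norm_mul, norm_mul, norm_pow, hz1, Complex.norm_real,
      Complex.norm_real, Complex.norm_I]
    simp only [one_pow, mul_one, norm_neg, Real.norm_eq_abs, mul_pow]
    rw [show ‖(4 : ℂ)‖ = 4 by simp]
    ring
  have hper : ∫ θ in (0 : ℝ)..2 * π, g θ = 2 * ∫ θ in (0 : ℝ)..π, g θ := by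
    have hp : ∀ θ, g (θ + π) = g θ := by
      intro θ
      simp only [hg, Real.cos_add_pi, Real.sin_add_pi, heven, neg_mul_neg]
    rw [← intervalIntegral.integral_add_adjacent_intervals (b := π) (hgc.intervalIntegrable _ _) (hgc.intervalIntegrable _ _)]
    have := intervalIntegral.integral_comp_add_right (a := 0) (b := π) g π
    simp only [hp, zero_add] at this
    rw [show 2 * π = π + π by ring, ← this]
    ring
  have hf0 : f 0 = ((V.coeff (2 * n) / 4 ^ n : ℝ) : ℂ) := by
    simp only [hf]
    rw [Finset.sum_eq_single (2 * n)]
    · simp [pow_mul]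
      norm_num
      ring
    · intro j hj hjn
      have : 2 * n - j ≠ 0 := by have := Finset.mem_range.1 hj; omega
      simp [this]
    · simp
  have hle : ‖f 0‖ ≤ (2 * π)⁻¹ * ∫ θ in (0 : ℝ)..2 * π, 4 ^ p * g θ := by
    rw [← hav, circleAverage, norm_smul, Real.norm_of_nonneg (by positivity)]
    gcongr
    refine (intervalIntegral.norm_integral_le_integral_norm (by positivity)).trans_eq ?_
    simp only [hnorm]
  rw [hf0, intervalIntegral.integral_const_mul, hper, Complex.norm_real, Real.norm_eq_abs, abs_div,
    abs_of_pos (a := (4 : ℝ) ^ n) (by positivity), div_le_iff₀ (by positivity)] at hle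
  have := pi_pos
  calc _ ≤ π * ((2 * π)⁻¹ * (4 ^ p * (2 * ∫ θ in (0 : ℝ)..π, g θ)) * 4 ^ n) := by gcongr
    _ = _ := by rw [pow_add]; field_simp

lemma integral_pow_bm_eq_rc {k : ℝ} (hk : 0 ≤ k) (n : ℕ) :
    ∫ u, u ^ (2 * n) ∂bm k = bmC k * √π / Gamma (k + 1 / 2) * (rc (1 / 2) n / rc (k + 1 / 2) n) := by
  rw [bm_moment_nat hk]
  have hg : Gamma (k + 1 / 2) ≠ 0 := (Gamma_pos_of_pos (by linarith)).ne'
  induction n with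
  | zero => 
    simp only [rc_zero, Nat.cast_zero, zero_add, Gamma_one_half_eq]
    ring
  | succ n ih =>
    have h1 : Gamma (((n + 1 : ℕ) : ℝ) + 1 / 2) = (n + 1 / 2) * Gamma (n + 1 / 2) := by
      rw [← Gamma_add_one (by positivity)]; congr 1; push_cast; ring
    have h2 : Gamma (((n + 1 : ℕ) : ℝ) + k + 1 / 2) = (n + k + 1 / 2) * Gamma (n + k + 1 / 2) := by
      rw [← Gamma_add_one (by positivity)]; congr 1; push_cast; ring
    have h3 : Gamma ((n : ℝ) + k + 1 / 2) ≠ 0 := (Gamma_pos_of_pos (by positivity)).ne'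
    have h4 := (rc_pos (c := k + 1 / 2) (by linarith) n).ne'
    have h5 : (n : ℝ) + k + 1 / 2 ≠ 0 := by positivity
    rw [h1, h2, rc_succ, rc_succ]
    have h6 : k + 1 / 2 + (n : ℝ) ≠ 0 := by positivity
    calc _ = bmC k * Gamma (n + 1 / 2) / Gamma (n + k + 1 / 2) * ((n + 1 / 2) / (n + k + 1 / 2)) := by field_simp
      _ = _ := by
        rw [ih, show k + 1 / 2 + (n : ℝ) = n + k + 1 / 2 by ring]
        field_simp
        ring

lemma cesPoly_degree_coeff (δ l : ℝ) (n : ℕ) :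
    (cesPoly δ l n).natDegree ≤ 2 * n ∧ (cesPoly δ l n).coeff (2 * n) = 4 ^ n * rc (l + 1) (2 * n) := by
  constructor
  · refine Polynomial.natDegree_sum_le_of_forall_le _ _ fun j hj => ?_
    refine (Polynomial.natDegree_C_mul_le _ _).trans ((geg_degree_coeff _ _).1.trans ?_)
    have := Finset.mem_range.1 hj
    omega
  · rw [cesPoly, Polynomial.finsetSum_coeff, Finset.sum_eq_single n]
    · rw [Polynomial.coeff_C_mul, (geg_degree_coeff _ _).2, Nat.sub_self, rc_zero, pow_mul]
      norm_num
    · intro j hj hjn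
      rw [Polynomial.coeff_C_mul, Polynomial.coeff_eq_zero_of_natDegree_lt, mul_zero]
      refine (geg_degree_coeff _ _).1.trans_lt ?_
      have := Finset.mem_range.1 hj
      omega
    · simp

lemma exists_le_coeff_bmPoly {k m : ℝ} (hk : 0 < k) (hm : 0 < m) : ∃ c, 0 < c ∧ ∀ (δ : ℝ) (n : ℕ), 1 ≤ n →
    c * (n : ℝ) ^ m * 4 ^ n ≤ (bmPoly k (cesPoly δ (m + k) n)).coeff (2 * n) := by
  obtain ⟨c1, C1, hc1, hC1, h1⟩ := rc_bounds (a := 1 / 2) (by norm_num)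
  obtain ⟨c2, C2, hc2, hC2, h2⟩ := rc_bounds (a := k + 1 / 2) (by linarith)
  obtain ⟨c3, C3, hc3, hC3, h3⟩ := rc_bounds (a := m + k + 1) (by linarith)
  have hg : 0 < Gamma (k + 1 / 2) := Gamma_pos_of_pos (by linarith)
  have hb := bmC_pos hk.le
  have := pi_pos
  refine ⟨c3 * (bmC k * √π / Gamma (k + 1 / 2)) * (c1 / C2), by positivity, fun δ n hn => ?_⟩
  have hn' : (1 : ℝ) ≤ n := by exact_mod_cast hn
  have hn0 : (0 : ℝ) < n := by linarith
  rw [bmPoly_coeff, (cesPoly_degree_coeff _ _ _).2, integral_pow_bm_eq_rc hk.le]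
  have a1 := (h1 n hn).1
  have a2 := (h2 n hn).2
  have a3 := (h3 (2 * n) (by omega)).1
  have a4 := rc_pos (c := k + 1 / 2) (by linarith) n
  have a5 : c3 * (n : ℝ) ^ (m + k) ≤ rc (m + k + 1) (2 * n) := by
    refine le_trans ?_ a3
    rw [add_sub_cancel_right]
    gcongr
    omega
  have a6 : c1 / C2 * (n : ℝ) ^ (-k) ≤ rc (1 / 2) n / rc (k + 1 / 2) n := by
    rw [le_div_iff₀ a4]
    calc _ ≤ c1 / C2 * (n : ℝ) ^ (-k) * (C2 * (n : ℝ) ^ (k + 1 / 2 - 1)) := by gcongr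
      _ = c1 * ((n : ℝ) ^ (-k) * (n : ℝ) ^ (k + 1 / 2 - 1)) := by field_simp
      _ ≤ _ := by
        rw [← rpow_add hn0]
        convert a1 using 3
        ring
  calc _ = 4 ^ n * (c3 * (n : ℝ) ^ (m + k)) * (bmC k * √π / Gamma (k + 1 / 2) * (c1 / C2 * (n : ℝ) ^ (-k))) := by
        rw [show m = (m + k) + -k by ring, rpow_add hn0, show m + k + -k + k = m + k by ring]; ring
    _ ≤ _ := by
        have := rc_pos (c := m + k + 1) (by linarith) (2 * n)
        gcongr

lemma exists_le_integral_bmPoly {k m : ℝ} (hk : 0 < k) (hm : 0 < m) : ∃ c, 0 < c ∧ ∀ (δ : ℝ) (n : ℕ), 1 ≤ n →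
    c * (n : ℝ) ^ m ≤ ∫ θ in (0 : ℝ)..π, |Real.cos θ| ^ (2 * k) *
      |(bmPoly k (cesPoly δ (m + k) n)).eval (Real.cos θ)| * Real.sin θ ^ (2 * m) := by
  obtain ⟨c, hc, h⟩ := exists_le_coeff_bmPoly hk hm
  obtain ⟨p, hp⟩ := exists_nat_ge (2 * k + 2 * m)
  have := pi_pos
  refine ⟨π * c / 4 ^ p, by positivity, fun δ n hn => ?_⟩
  set V := bmPoly k (cesPoly δ (m + k) n) with hV
  have h1 := coeff_le_integral_cos (V := V) (n := n)
    ((bmPoly_natDegree_le _ _).trans (cesPoly_degree_coeff _ _ _).1) (bmPoly_eval_neg _ _) p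
  have h2 := (h δ n hn).trans (le_abs_self _)
  have hVc := (V.continuous.comp Real.continuous_cos).abs
  have h3 : ∫ θ in (0 : ℝ)..π, |V.eval (Real.cos θ)| * |Real.sin θ * Real.cos θ| ^ p ≤
      ∫ θ in (0 : ℝ)..π, |Real.cos θ| ^ (2 * k) * |V.eval (Real.cos θ)| * Real.sin θ ^ (2 * m) := by
    refine intervalIntegral.integral_mono_on pi_pos.le (Continuous.intervalIntegrable ?_ _ _)
      (Continuous.intervalIntegrable ?_ _ _) fun θ hθ => ?_
    · exact hVc.mul (by fun_prop)
    · exact ((Real.continuous_cos.abs.rpow_const fun _ => Or.inr (by positivity)).mul hVc).mul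
        (Real.continuous_sin.rpow_const fun _ => Or.inr (by positivity))
    · have hs := Real.sin_nonneg_of_mem_Icc hθ
      have hc1 : |Real.cos θ| ≤ 1 := Real.abs_cos_le_one θ
      have hs1 : Real.sin θ ≤ 1 := Real.sin_le_one θ
      have b1 : |Real.cos θ| ^ p ≤ |Real.cos θ| ^ (2 * k) := by
        rw [← rpow_natCast]
        exact rpow_le_rpow_of_exponent_ge' (abs_nonneg _) hc1 (by positivity) (by linarith)
      have b2 : Real.sin θ ^ p ≤ Real.sin θ ^ (2 * m) := by
        rw [← rpow_natCast]
        exact rpow_le_rpow_of_exponent_ge' hs hs1 (by positivity) (by linarith)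
      rw [abs_mul, mul_pow, abs_of_nonneg hs]
      calc _ = |Real.cos θ| ^ p * |V.eval (Real.cos θ)| * Real.sin θ ^ p := by ring
        _ ≤ _ := by gcongr
  have h4 : π * (c * (n : ℝ) ^ m * 4 ^ n) ≤ 4 ^ (p + n) * ∫ θ in (0 : ℝ)..π, |Real.cos θ| ^ (2 * k) *
      |V.eval (Real.cos θ)| * Real.sin θ ^ (2 * m) := by
    refine le_trans ?_ (h1.trans ?_) <;> gcongr
  rw [pow_add] at h4
  rw [div_mul_eq_mul_div, div_le_iff₀ (by positivity)]
  have h5 : (0 : ℝ) < 4 ^ n := by positivity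
  refine le_of_mul_le_mul_right ?_ h5
  linarith

lemma integral_geg_bm_even {l : ℝ} (hl : 0 < l) (j : ℕ) :
    ∫ t, (geg (l + 1) (2 * j)).eval t ∂bm (l + 1 / 2) = (bm (l + 1 / 2)).real Set.univ := by
  have hi : ∀ c N, Integrable (fun t => (geg c N).eval t) (bm (l + 1 / 2)) := fun c N =>
    integrable_geg_comp (U := id) measurable_id (bm_ae _) c N
  induction j with
  | zero => simp
  | succ j ih =>
    have h := integral_geg_eq_zero hl (N := 2 * j + 2) (by omega)
    have h2 := congrArg (fun f => ∫ t, f t ∂bm (l + 1 / 2)) (funext fun u => geg_sub hl u (2 * j))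
    simp only [MeasureTheory.integral_const_mul] at h2
    rw [h, MeasureTheory.integral_sub (hi _ _) (hi _ _), ih, mul_zero] at h2
    have h3 := (mul_eq_zero.1 h2.symm).resolve_left hl.ne'
    rw [mul_add, mul_one]
    linarith

lemma integral_cesPoly_bm {l : ℝ} (hl : 0 < l) (δ : ℝ) (n : ℕ) :
    ∫ t, (cesPoly δ l n).eval t ∂bm (l + 1 / 2) = (bm (l + 1 / 2)).real Set.univ * rc (δ + 1) n := by
  have hi : ∀ c N, Integrable (fun t => (geg c N).eval t) (bm (l + 1 / 2)) := fun c N =>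
    integrable_geg_comp (U := id) measurable_id (bm_ae _) c N
  simp_rw [cesPoly_eval]
  rw [MeasureTheory.integral_finsetSum _ fun k _ => (hi _ _).const_mul _]
  simp_rw [MeasureTheory.integral_const_mul]
  rw [rc_add_one_eq_sum, ← Finset.sum_range_reflect, Finset.mul_sum]
  refine Finset.sum_congr rfl fun j hj => ?_
  rw [integral_geg_bm_even hl, mul_comm]
  congr 2
  have := Finset.mem_range.1 hj
  omega

lemma exists_simpL_ge_rc {d : ℕ} {κ : Fin (d + 1) → ℝ} (hκ : ∀ j, 0 < κ j) {l : ℝ} (hl0 : 0 < l)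
    (hl : l = ∑ j, κ j + ((d : ℝ) - 1) / 2) :
    ∃ c, 0 < c ∧ ∀ x ∈ simplexT d, ∀ δ, -1 < δ → ∀ n,
      c * rc (δ + 1) n ≤ simpL d κ (cesPoly δ l n) x := by
  obtain ⟨C, hC, h⟩ := simpL_ge_abs_integral hκ
  have hv : 0 < (bm (l + 1 / 2)).real Set.univ := by
    have h2 := integral_pow_bm_eq_rc (k := l + 1 / 2) (by linarith) 0
    simp only [mul_zero, pow_zero, MeasureTheory.integral_const, smul_eq_mul, mul_one, rc_zero] at h2
    rw [h2]
    have := bmC_pos (κ := l + 1 / 2) (by linarith)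
    have : 0 < Gamma (l + 1 / 2 + 1 / 2) := Gamma_pos_of_pos (by linarith)
    have := pi_pos
    positivity
  refine ⟨C * (bm (l + 1 / 2)).real Set.univ, by positivity, fun x hx δ hδ n => ?_⟩
  have h2 := h x hx (cesPoly δ l n)
  rw [show ∑ j, κ j + (d : ℝ) / 2 = l + 1 / 2 by rw [hl]; ring, integral_cesPoly_bm hl0,
    abs_of_nonneg (by have := rc_pos (c := δ + 1) (by linarith) n; positivity)] at h2
  linarith

lemma geg_rec_coeff (c : ℝ) (n i : ℕ) : ((n : ℝ) + 2) * (geg c (n + 2)).coeff (i + 1) =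
    2 * (n + 1 + c) * (geg c (n + 1)).coeff i - (n + 2 * c) * (geg c n).coeff (i + 1) := by
  have : (n : ℝ) + 2 ≠ 0 := by positivity
  simp only [geg, Polynomial.coeff_sub, Polynomial.coeff_C_mul, mul_assoc, Polynomial.coeff_X_mul]
  field_simp

lemma geg_rec_coeff_zero (c : ℝ) (n : ℕ) : ((n : ℝ) + 2) * (geg c (n + 2)).coeff 0 =
    - ((n + 2 * c) * (geg c n).coeff 0) := by
  have : (n : ℝ) + 2 ≠ 0 := by positivity
  simp only [geg, Polynomial.coeff_sub, Polynomial.coeff_C_mul, mul_assoc, Polynomial.coeff_X_mul_zero]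
  field_simp
  ring

lemma geg_coeff_contiguous (c : ℝ) (n : ℕ) :
    (∀ i : ℕ, ((i : ℝ) + 1) * (geg c (n + 1)).coeff (i + 1) = (i + n + 2 * c) * (geg c n).coeff i) ∧
    (∀ i : ℕ, ((i : ℝ) - n - 1) * (geg c (n + 1)).coeff i = (i + 1) * (geg c n).coeff (i + 1)) := by
  induction n with
  | zero =>
    constructor <;> intro i
    · rcases i with _ | i
      · simp [geg_one]
      · simp [geg_one, Polynomial.coeff_one]
    · rcases i with _ | _ | i
      · simp [geg_one, Polynomial.coeff_one]
      · simp [geg_one, Polynomial.coeff_one]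
      · simp [geg_one, Polynomial.coeff_one]
  | succ n ih =>
    obtain ⟨hA, hB⟩ := ih
    have hn : (n : ℝ) + 2 ≠ 0 := by positivity
    constructor <;> intro i
    · refine mul_left_cancel₀ hn ?_
      have h1 := geg_rec_coeff c n i
      have h2 := hB i
      push_cast
      linear_combination ((i : ℝ) + 1) * h1 + (n + 2 * c) * h2
    · refine mul_left_cancel₀ hn ?_
      rcases i with _ | i
      · have h1 := geg_rec_coeff_zero c n
        have h2 := hA 0
        push_cast at h2 ⊢
        linear_combination (-(n : ℝ) - 2) * h1 - (n + 2) * h2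
      · have h1 := geg_rec_coeff c n i
        have h2 := hA (i + 1)
        have h3 := hB i
        push_cast at h2 ⊢
        linear_combination ((i : ℝ) - n - 1) * h1 - (n + 2) * h2 + 2 * (n + 1 + c) * h3

lemma geg_coeff_add_two (c : ℝ) (n i : ℕ) :
    ((i : ℝ) + 2) * (i + 1) * (geg c n).coeff (i + 2) = (i - n) * (i + n + 2 * c) * (geg c n).coeff i := by
  rcases n with _ | n
  · rcases i with _ | i <;> simp [Polynomial.coeff_one]
  · have h1 := (geg_coeff_contiguous c n).1 (i + 1)
    have h2 := (geg_coeff_contiguous c n).2 i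
    push_cast at h1 ⊢
    linear_combination ((i : ℝ) + 1) * h1 - (i + 1 + n + 2 * c) * h2

lemma coeff_hypergeometric_operator (G : Polynomial ℝ) (p a b e : ℝ) (i : ℕ) :
    (Polynomial.X * G.derivative.derivative + Polynomial.C p * (Polynomial.X * (Polynomial.X * G.derivative.derivative)) +
      Polynomial.C a * G.derivative + Polynomial.C b * (Polynomial.X * G.derivative) + Polynomial.C e * G).coeff i =
    (i + 1) * (i + a) * G.coeff (i + 1) + (p * (i * (i - 1)) + b * i + e) * G.coeff i := by
  rcases i with _ | _ | i <;>
  simp only [Polynomial.coeff_add, Polynomial.coeff_C_mul, Polynomial.coeff_X_mul, Polynomial.coeff_X_mul_zero,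
    Polynomial.coeff_derivative] <;> push_cast <;> ring

/-- Connection between the expansions of a terminating hypergeometric series at its two endpoints. -/
lemma coeff_comp_of_hypergeometric {F : Polynomial ℝ} {g l : ℝ} {j : ℕ}
    (hF : ∀ i : ℕ, ((i : ℝ) + 1) * (i + g) * F.coeff (i + 1) = (i - j) * (i + j + l) * F.coeff i) (i : ℕ) :
    ((i : ℝ) + 1) * (i + (l + 1 - g)) * (Polynomial.taylor 1 F).coeff (i + 1) =
      (j - i) * (i + j + l) * (Polynomial.taylor 1 F).coeff i := by
  have h : Polynomial.X * F.derivative.derivative +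
      Polynomial.C (-1) * (Polynomial.X * (Polynomial.X * F.derivative.derivative)) +
      Polynomial.C g * F.derivative + Polynomial.C (-(l + 1)) * (Polynomial.X * F.derivative) +
      Polynomial.C (j * (j + l)) * F = 0 := by
    ext i
    rw [coeff_hypergeometric_operator, Polynomial.coeff_zero]
    linear_combination hF i
  have h2 := congrArg (Polynomial.taylor 1) h
  set G := Polynomial.taylor 1 F with hG
  have hd : ∀ P : Polynomial ℝ, Polynomial.taylor 1 P.derivative = (Polynomial.taylor 1 P).derivative := by
    intro P
    simp [Polynomial.taylor_apply, Polynomial.derivative_comp]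
  simp only [map_add, Polynomial.taylor_mul, hd, Polynomial.taylor_X, Polynomial.taylor_C, map_zero] at h2
  rw [← hG] at h2
  have h3 := coeff_hypergeometric_operator G 1 (l + 1 - g) (l + 1) (-(j * (j + l))) i
  have h4 : Polynomial.X * G.derivative.derivative +
      Polynomial.C 1 * (Polynomial.X * (Polynomial.X * G.derivative.derivative)) +
      Polynomial.C (l + 1 - g) * G.derivative + Polynomial.C (l + 1) * (Polynomial.X * G.derivative) +
      Polynomial.C (-(j * (j + l))) * G = 0 := by
    simp only [map_add, map_sub, map_neg, map_mul, map_one] at h2 ⊢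
    linear_combination -h2
  rw [h4, Polynomial.coeff_zero] at h3
  linear_combination -h3

lemma bmPoly_geg_eval_taylor {k m : ℝ} (hk : 0 ≤ k) (j : ℕ) : ∃ G : ℕ → ℝ,
    (∀ a, (bmPoly k (geg (m + k + 1) (2 * j))).eval a = ∑ i ∈ range (j + 1), G i * (a ^ 2 - 1) ^ i) ∧
    G j = 4 ^ j * rc (m + k + 1) (2 * j) * ∫ u, u ^ (2 * j) ∂bm k ∧
    ∀ i : ℕ, ((i : ℝ) + 1) * (i + (m + 3 / 2)) * G (i + 1) = (j - i) * (i + j + (m + k + 1)) * G i := by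
  set E := bmPoly k (geg (m + k + 1) (2 * j)) with hE
  have hEd : E.natDegree ≤ 2 * j := (bmPoly_natDegree_le _ _).trans (geg_degree_coeff _ _).1
  set F : Polynomial ℝ := ∑ i ∈ range (j + 1), Polynomial.monomial i (E.coeff (2 * i)) with hF
  have hFc : ∀ i, F.coeff i = E.coeff (2 * i) := by
    intro i
    rw [hF, Polynomial.finsetSum_coeff]
    simp only [Polynomial.coeff_monomial, Finset.sum_ite_eq', Finset.mem_range]
    split_ifs with h
    · rfl
    · rw [Polynomial.coeff_eq_zero_of_natDegree_lt]; omega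
  have hFd : F.natDegree ≤ j := by
    rw [Polynomial.natDegree_le_iff_coeff_eq_zero]
    intro N hN
    rw [hFc, Polynomial.coeff_eq_zero_of_natDegree_lt]; omega
  have hFrec : ∀ i : ℕ, ((i : ℝ) + 1) * (i + (k + 1 / 2)) * F.coeff (i + 1) =
      (i - j) * (i + j + (m + k + 1)) * F.coeff i := by
    intro i
    have h1 := geg_coeff_add_two (m + k + 1) (2 * j) (2 * i)
    have h2 : ((i : ℝ) + k + 1 / 2) * ∫ u, u ^ (2 * (i + 1)) ∂bm k = (i + 1 / 2) * ∫ u, u ^ (2 * i) ∂bm k := by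
      have e1 := (rc_pos (c := k + 1 / 2) (by linarith) i).ne'
      have e2 : (i : ℝ) + k + 1 / 2 ≠ 0 := by positivity
      have e3 : k + 1 / 2 + (i : ℝ) ≠ 0 := by positivity
      have e4 : (i : ℝ) + 1 ≠ 0 := by positivity
      have e5 : Gamma (k + 1 / 2) ≠ 0 := (Gamma_pos_of_pos (by linarith)).ne'
      rw [integral_pow_bm_eq_rc hk, integral_pow_bm_eq_rc hk, rc_succ, rc_succ,
        show k + 1 / 2 + (i : ℝ) = i + k + 1 / 2 by ring, show 1 / 2 + (i : ℝ) = i + 1 / 2 by ring]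
      generalize Gamma (k + 1 / 2) = γ at *
      generalize (i : ℝ) + k + 1 / 2 = w at *
      generalize rc (k + 1 / 2) i = w2 at *
      field_simp
    have h3 : (0 : ℝ) < 2 * (2 * i + 1) := by positivity
    refine mul_left_cancel₀ h3.ne' ?_
    rw [hFc, hFc, hE, bmPoly_coeff, bmPoly_coeff]
    push_cast at h1
    rw [show 2 * (i + 1) = 2 * i + 2 by ring] at h2 ⊢
    set M1 := ∫ u, u ^ (2 * i + 2) ∂bm k
    set M0 := ∫ u, u ^ (2 * i) ∂bm k
    linear_combination ((i : ℝ) + (k + 1 / 2)) * M1 * h1 + 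
      (2 * (i : ℝ) - 2 * j) * (2 * i + 2 * j + 2 * (m + k + 1)) * (geg (m + k + 1) (2 * j)).coeff (2 * i) * h2
  refine ⟨(Polynomial.taylor 1 F).coeff, fun a => ?_, ?_, fun i => ?_⟩
  · have h1 : E.eval a = F.eval (a ^ 2) := by
      have : E = Polynomial.expand ℝ 2 F := by
        ext i
        rw [Polynomial.coeff_expand (by norm_num), hFc]
        split_ifs with hi
        · rw [Nat.mul_div_cancel' hi]
        · rw [hE, bmPoly_coeff, bm_moment_odd (Nat.not_even_iff_odd.1 fun h => hi h.two_dvd), mul_zero]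
      rw [this, Polynomial.expand_eval]
    rw [h1, show a ^ 2 = (a ^ 2 - 1) + 1 by ring, ← Polynomial.taylor_eval, Polynomial.eval_eq_sum_range' (n := j + 1)]
    · simp
    · rw [Polynomial.natDegree_taylor]; omega
  · have h1 : (bmPoly k (geg (m + k + 1) (2 * j))).coeff (2 * j) = 4 ^ j * rc (m + k + 1) (2 * j) * ∫ u, u ^ (2 * j) ∂bm k := by
      rw [bmPoly_coeff, (geg_degree_coeff _ _).2, pow_mul]; norm_num
    rw [← h1, ← hE, ← hFc]
    rcases hFd.lt_or_eq with h | h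
    · rw [Polynomial.coeff_eq_zero_of_natDegree_lt h, Polynomial.coeff_eq_zero_of_natDegree_lt]
      rwa [Polynomial.natDegree_taylor]
    · conv_lhs => rw [← h]
      rw [Polynomial.coeff_taylor_natDegree, Polynomial.leadingCoeff, h]
  · have := coeff_comp_of_hypergeometric hFrec i
    rw [show m + 3 / 2 = m + k + 1 + 1 - (k + 1 / 2) by ring]
    exact this

/-- Beyond the interval of orthogonality the averaged Gegenbauer polynomials dominate ordinary ones. -/
lemma exists_geg_le_bmPoly {k m : ℝ} (hk : 0 < k) (hm : 0 < m) : ∃ c, 0 < c ∧ ∀ j : ℕ, 1 ≤ j → ∀ a : ℝ, 1 ≤ a →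
    c * (geg (m + 1) (2 * j)).eval a ≤ (bmPoly k (geg (m + k + 1) (2 * j))).eval a := by
  obtain ⟨c1, C1, hc1, hC1, h1⟩ := rc_bounds (a := 1 / 2) (by norm_num)
  obtain ⟨c2, C2, hc2, hC2, h2⟩ := rc_bounds (a := k + 1 / 2) (by linarith)
  obtain ⟨c3, C3, hc3, hC3, h3⟩ := rc_bounds (a := m + k + 1) (by linarith)
  obtain ⟨c4, C4, hc4, hC4, h4⟩ := rc_bounds (a := m + 1) (by linarith)
  have hg : 0 < Gamma (k + 1 / 2) := Gamma_pos_of_pos (by linarith)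
  have hb := bmC_pos hk.le
  have hpi := pi_pos
  set B := bmC k * √π / Gamma (k + 1 / 2) with hB
  have hB0 : 0 < B := by positivity
  refine ⟨B * (c1 / C2) * (c3 / C4), by positivity, fun j hj a ha => ?_⟩
  obtain ⟨G, hG1, hG2, hG3⟩ := bmPoly_geg_eval_taylor (m := m) hk.le j
  obtain ⟨H, hH1, hH2, hH3⟩ := bmPoly_geg_eval_taylor (m := m) le_rfl j
  have hj' : (1 : ℝ) ≤ j := by exact_mod_cast hj
  have hj0 : (0 : ℝ) < j := by linarith
  set Mk := ∫ u, u ^ (2 * j) ∂bm k with hMk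
  have hM0 : ∫ u, u ^ (2 * j) ∂bm 0 = 2 := by
    rw [integral_bm_zero]; simp [pow_mul]; norm_num
  have hMk' : B * (c1 / C2) * (j : ℝ) ^ (-k) ≤ Mk := by
    rw [hMk, integral_pow_bm_eq_rc hk.le, mul_assoc]
    refine mul_le_mul_of_nonneg_left ?_ hB0.le
    rw [le_div_iff₀ (rc_pos (by linarith) j)]
    calc _ ≤ c1 / C2 * (j : ℝ) ^ (-k) * (C2 * (j : ℝ) ^ (k + 1 / 2 - 1)) := by
          gcongr; exact (h2 j hj).2
      _ = c1 * ((j : ℝ) ^ (-k) * (j : ℝ) ^ (k + 1 / 2 - 1)) := by field_simp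
      _ ≤ _ := by
        rw [← rpow_add hj0]
        convert (h1 j hj).1 using 3
        ring
  have hrk : ∀ N, 0 < rc (m + k + 1) N := fun N => rc_pos (by linarith) N
  have hr0 : ∀ N, 0 < rc (m + 0 + 1) N := fun N => rc_pos (by linarith) N
  have hMk0 : 0 < Mk := lt_of_lt_of_le (by positivity) hMk'
  have key : ∀ i ≤ j, 0 < H i ∧ G i * 2 * rc (m + 0 + 1) (i + j) = H i * Mk * rc (m + k + 1) (i + j) := by
    intro i hi
    induction hi using Nat.decreasingInduction with
    | self =>
      rw [hG2, hH2, hM0, two_mul j]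
      have := hr0 (j + j)
      exact ⟨by positivity, by ring⟩
    | of_succ i hi ih =>
      have hij : (i : ℝ) < j := by exact_mod_cast hi
      obtain ⟨ih1, ih2⟩ := ih
      have g1 := hG3 i
      have g2 := hH3 i
      have e1 : (0 : ℝ) < (j - i) := by linarith
      have e2 : 0 < ((i : ℝ) + j + (m + 0 + 1)) := by positivity
      have e3 : 0 < ((i : ℝ) + j + (m + k + 1)) := by positivity
      constructor
      · have : 0 < ((j : ℝ) - i) * (i + j + (m + 0 + 1)) * H i := by rw [← g2]; positivity
        exact pos_of_mul_pos_right this (by positivity)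
      · rw [show i + 1 + j = i + j + 1 by ring, rc_succ, rc_succ] at ih2
        have e4 : (0 : ℝ) < ((i + j : ℕ) : ℝ) + 1 := by positivity
        have ih3 : G (i + 1) * 2 * (rc (m + 0 + 1) (i + j) * (m + 0 + 1 + (i + j : ℕ))) =
            H (i + 1) * Mk * (rc (m + k + 1) (i + j) * (m + k + 1 + (i + j : ℕ))) := by
          field_simp at ih2
          linear_combination ih2
        push_cast at ih3
        refine mul_left_cancel₀ (mul_pos (mul_pos e1 e2) e3).ne' ?_
        linear_combination ((i : ℝ) + 1) * (i + (m + 3 / 2)) * ih3 - 2 * rc (m + 0 + 1) (i + j) * (i + j + (m + 0 + 1)) * g1 +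
          Mk * rc (m + k + 1) (i + j) * (i + j + (m + k + 1)) * g2
  have h0 : 2 * (geg (m + 1) (2 * j)).eval a = ∑ i ∈ range (j + 1), H i * (a ^ 2 - 1) ^ i := by
    rw [← hH1, bmPoly_eval, integral_bm_zero, mul_one, mul_neg, mul_one, geg_neg, add_zero]
    simp; ring
  have h5 : (geg (m + 1) (2 * j)).eval a = ∑ i ∈ range (j + 1), H i / 2 * (a ^ 2 - 1) ^ i := by
    rw [eq_comm, ← mul_right_inj' (two_ne_zero (α := ℝ)), h0, Finset.mul_sum]
    exact Finset.sum_congr rfl fun i _ => by ring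
  rw [hG1, h5, Finset.mul_sum]
  refine Finset.sum_le_sum fun i hi => ?_
  have hi' := Finset.mem_range_succ_iff.1 hi
  obtain ⟨k1, k2⟩ := key i hi'
  have ha2 : 0 ≤ a ^ 2 - 1 := by nlinarith
  rw [← mul_assoc]
  refine mul_le_mul_of_nonneg_right ?_ (pow_nonneg ha2 _)
  have hN : 1 ≤ i + j := by omega
  have hN0 : (0 : ℝ) < ((i + j : ℕ) : ℝ) := by exact_mod_cast hN
  have h6 : c3 / C4 * (j : ℝ) ^ k * rc (m + 0 + 1) (i + j) ≤ rc (m + k + 1) (i + j) := by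
    rw [add_zero]
    calc _ ≤ c3 / C4 * ((i + j : ℕ) : ℝ) ^ k * (C4 * ((i + j : ℕ) : ℝ) ^ (m + 1 - 1)) := by
          have := rc_pos (c := m + 1) (by linarith) (i + j)
          gcongr
          · omega
          · exact (h4 _ hN).2
      _ = c3 * (((i + j : ℕ) : ℝ) ^ k * ((i + j : ℕ) : ℝ) ^ (m + 1 - 1)) := by field_simp
      _ ≤ _ := by
        rw [← rpow_add hN0]
        convert (h3 _ hN).1 using 3
        ring
  refine le_of_mul_le_mul_right ?_ (hr0 (i + j))
  calc B * (c1 / C2) * (c3 / C4) * (H i / 2) * rc (m + 0 + 1) (i + j)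
      = (B * (c1 / C2) * (j : ℝ) ^ (-k)) * (c3 / C4 * (j : ℝ) ^ k * rc (m + 0 + 1) (i + j)) * (H i / 2) := by
        have : (j : ℝ) ^ (-k) * (j : ℝ) ^ k = 1 := by rw [← rpow_add hj0]; simp
        linear_combination (-(B * (c1 / C2) * (c3 / C4) * (H i / 2) * rc (m + 0 + 1) (i + j))) * this
    _ ≤ Mk * rc (m + k + 1) (i + j) * (H i / 2) := by
        have := hr0 (i + j)
        gcongr
    _ = _ := by linear_combination (-1 / 2 : ℝ) * k2

lemma bmPoly_cesPoly_eval (k δ l : ℝ) (n : ℕ) (a : ℝ) : (bmPoly k (cesPoly δ l n)).eval a =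
    ∑ j ∈ range (n + 1), rc δ (n - j) * (bmPoly k (geg (l + 1) (2 * j))).eval a := by
  have hi : ∀ c N, Integrable (fun u => (geg c N).eval (a * u)) (bm k) := fun c N => by
    simpa using continuous_integrable_comp_affine (bm_ae k) (M := fun s => (geg c N).eval s) (by fun_prop) a 0
  simp_rw [bmPoly_eval, cesPoly_eval]
  rw [MeasureTheory.integral_finsetSum _ fun j _ => (hi _ _).const_mul _]
  simp_rw [MeasureTheory.integral_const_mul]

lemma geg_eval_cosh (c τ : ℝ) (N : ℕ) : exp (-(N * τ)) * (geg c N).eval (cosh τ) =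
    ∑ p ∈ HasAntidiagonal.antidiagonal N, rc c p.1 * rc c p.2 * exp (-(2 * τ)) ^ p.1 := by
  have h := geg_eval_eq_sum c (cosh τ) (z := Complex.exp (-τ)) (w := Complex.exp τ)
    (by rw [← Complex.exp_add]; simp) (by
      push_cast; rw [Complex.cosh]; ring) N
  have h2 : (geg c N).eval (cosh τ) = ∑ p ∈ HasAntidiagonal.antidiagonal N, rc c p.1 * exp (-τ) ^ p.1 * (rc c p.2 * exp τ ^ p.2) := by
    rw [← Complex.ofReal_inj, h]; push_cast; rfl
  rw [h2, Finset.mul_sum]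
  refine Finset.sum_congr rfl fun p hp => ?_
  rw [HasAntidiagonal.mem_antidiagonal] at hp
  rw [← hp, ← Real.exp_nat_mul, ← Real.exp_nat_mul, ← Real.exp_nat_mul]
  have : rexp (p.1 * -(2 * τ)) = rexp (-(((p.1 + p.2 : ℕ) : ℝ) * τ)) * rexp (p.1 * -τ) * rexp (p.2 * τ) := by
    rw [← Real.exp_add, ← Real.exp_add]; push_cast; ring_nf
  rw [this]; ring

lemma geg_eval_cosh_nonneg {c : ℝ} (hc : 0 < c) (τ : ℝ) (N : ℕ) : 0 ≤ (geg c N).eval (cosh τ) := by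
  refine nonneg_of_mul_nonneg_right ?_ (exp_pos (-(N * τ)))
  rw [geg_eval_cosh]
  exact Finset.sum_nonneg fun p _ => mul_nonneg (mul_pos (rc_pos hc _) (rc_pos hc _)).le (by positivity)

lemma bmPoly_geg_eval_cosh_nonneg {k m : ℝ} (hk : 0 < k) (hm : 0 < m) (j : ℕ) (τ : ℝ) :
    0 ≤ (bmPoly k (geg (m + k + 1) (2 * j))).eval (cosh τ) := by
  rcases j.eq_zero_or_pos with rfl | hj
  · simp only [mul_zero, geg_zero, bmPoly_eval]
    exact MeasureTheory.integral_nonneg fun t => by simp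
  · obtain ⟨c, hc, h⟩ := exists_geg_le_bmPoly hk hm
    refine le_trans ?_ (h j hj _ (one_le_cosh τ))
    exact mul_nonneg hc.le (geg_eval_cosh_nonneg (by linarith) _ _)

lemma bmPoly_cesPoly_eval_cosh_nonneg {k m δ : ℝ} (hk : 0 < k) (hm : 0 < m) (hδ : 0 < δ) (n : ℕ) (τ : ℝ) :
    0 ≤ (bmPoly k (cesPoly δ (m + k) n)).eval (cosh τ) := by
  rw [bmPoly_cesPoly_eval]
  exact Finset.sum_nonneg fun j _ => mul_nonneg (rc_pos hδ _).le (bmPoly_geg_eval_cosh_nonneg hk hm j τ)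

lemma le_geg_eval_cosh {c τ : ℝ} (hc : 0 < c) {N Q : ℕ} (hQ : Q ≤ N) (hτ : 0 ≤ τ) (hQτ : Q * τ ≤ 1) {b : ℝ}
    (hb : ∀ i ≤ Q, b ≤ rc c (N - i)) :
    b * exp (-2) * rc (c + 1) Q ≤ exp (-(N * τ)) * (geg c N).eval (cosh τ) := by
  rw [geg_eval_cosh, Finset.Nat.sum_antidiagonal_eq_sum_range_succ (fun i j => rc c i * rc c j * exp (-(2 * τ)) ^ i),
    rc_add_one_eq_sum, Finset.mul_sum]
  refine le_trans (Finset.sum_le_sum (g := fun i => rc c i * rc c (N - i) * exp (-(2 * τ)) ^ i) fun i hi => ?_)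
    (Finset.sum_le_sum_of_subset_of_nonneg (Finset.range_subset_range.2 (Nat.succ_le_succ hQ)) fun i _ _ =>
      mul_nonneg (mul_pos (rc_pos hc _) (rc_pos hc _)).le (by positivity))
  have hi' := Finset.mem_range_succ_iff.1 hi
  have h1 : exp (-2) ≤ exp (-(2 * τ)) ^ i := by
    rw [← Real.exp_nat_mul, exp_le_exp]
    have : (i : ℝ) * τ ≤ Q * τ := by gcongr
    linarith
  have := rc_pos hc i
  have := rc_pos hc (N - i)
  calc b * exp (-2) * rc c i ≤ rc c (N - i) * exp (-(2 * τ)) ^ i * rc c i := by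
        gcongr
        exact hb i hi'
    _ = _ := by ring

/-- Growth of the averaged Cesàro polynomials outside the interval of orthogonality. -/
lemma exists_le_bmPoly_cesPoly_cosh {k m : ℝ} (hk : 0 < k) (hm : 0 < m) : ∃ c, 0 < c ∧ ∀ n : ℕ, 2 ≤ n → ∀ τ : ℝ,
    2 / n ≤ τ → τ ≤ 1 → c * (n : ℝ) ^ m * (1 / τ) ^ (2 * m + 1) ≤
      exp (-(2 * n * τ)) * (bmPoly k (cesPoly m (m + k) n)).eval (cosh τ) := by
  obtain ⟨c0, hc0, h0⟩ := exists_geg_le_bmPoly hk hm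
  obtain ⟨c1, C1, hc1, hC1, h1⟩ := rc_bounds (a := m + 1) (by linarith)
  obtain ⟨c2, C2, hc2, hC2, h2⟩ := rc_bounds (a := m + 1 + 1) (by linarith)
  refine ⟨c0 * exp (-2) * exp (-2) * (c1 * (1 / 2) ^ m) * (c1 * (1 / 2) ^ m) * (c2 * (1 / 2) ^ (m + 1)), by positivity,
    fun n hn τ hτ1 hτ2 => ?_⟩
  have hn0 : (0 : ℝ) < n := by positivity
  have hτ0 : 0 < τ := lt_of_lt_of_le (by positivity) hτ1
  have hx : 1 ≤ 1 / τ := by rwa [le_div_iff₀ hτ0, one_mul]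
  set Q := ⌊1 / τ⌋₊ with hQdef
  have hQ1 : 1 ≤ Q := (Nat.one_le_floor_iff _).2 hx
  have hQle : (Q : ℝ) ≤ 1 / τ := Nat.floor_le (by positivity)
  have hQlt : 1 / τ < Q + 1 := Nat.lt_floor_add_one _
  have hQ1' : (1 : ℝ) ≤ Q := by exact_mod_cast hQ1
  have hQhalf : 1 / 2 * (1 / τ) ≤ Q := by linarith
  have hQτ : Q * τ ≤ 1 := by rwa [le_div_iff₀ hτ0] at hQle
  have hQn' : 2 * (Q : ℝ) ≤ n := by
    have : 1 / τ ≤ n / 2 := by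
      rw [div_le_div_iff₀ hτ0 two_pos]
      rw [div_le_iff₀ hn0] at hτ1
      linarith
    linarith
  have hQn : 2 * Q ≤ n := by exact_mod_cast hQn'
  have hrn : ∀ N : ℕ, n ≤ 2 * N → c1 * (1 / 2) ^ m * (n : ℝ) ^ m ≤ rc (m + 1) N := by
    intro N hN
    refine le_trans ?_ (h1 N (by omega)).1
    rw [mul_assoc, ← mul_rpow (by norm_num) hn0.le, add_sub_cancel_right]
    have : (n : ℝ) ≤ 2 * N := by exact_mod_cast hN
    gcongr
    linarith
  have hE : ∀ q ∈ range (Q + 1), rc m q * (exp (-2) * (c0 * (c1 * (1 / 2) ^ m * (n : ℝ) ^ m * exp (-2) * rc (m + 1 + 1) Q))) ≤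
      exp (-(2 * n * τ)) * (rc m (n - (n - q)) * (bmPoly k (geg (m + k + 1) (2 * (n - q)))).eval (cosh τ)) := by
    intro q hq
    have hq' := Finset.mem_range_succ_iff.1 hq
    rw [Nat.sub_sub_self (by omega)]
    have h3 := le_geg_eval_cosh (c := m + 1) (by linarith) (N := 2 * (n - q)) (Q := Q) (by omega) hτ0.le hQτ
      (b := c1 * (1 / 2) ^ m * (n : ℝ) ^ m) (fun i hi => hrn _ (by omega))
    have h4 := h0 (n - q) (by omega) (cosh τ) (one_le_cosh τ)
    have h5 : exp (-2) ≤ exp (-(2 * q * τ)) := by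
      rw [exp_le_exp]
      have : (q : ℝ) * τ ≤ Q * τ := by gcongr
      linarith
    have h6 : exp (-(2 * n * τ)) = exp (-(2 * q * τ)) * exp (-(((2 * (n - q) : ℕ) : ℝ) * τ)) := by
      rw [← Real.exp_add, Nat.cast_mul, Nat.cast_sub (by omega)]; push_cast; ring_nf
    have := rc_pos hm q
    have h7 := rc_pos (c := m + 1 + 1) (by linarith) Q
    calc _ ≤ rc m q * (exp (-(2 * q * τ)) * (c0 * (exp (-(((2 * (n - q) : ℕ) : ℝ) * τ)) * (geg (m + 1) (2 * (n - q))).eval (cosh τ)))) := by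
          gcongr
      _ = rc m q * (exp (-(2 * n * τ)) * (c0 * (geg (m + 1) (2 * (n - q))).eval (cosh τ))) := by rw [h6]; ring
      _ ≤ rc m q * (exp (-(2 * n * τ)) * (bmPoly k (geg (m + k + 1) (2 * (n - q)))).eval (cosh τ)) := by gcongr
      _ = _ := by ring
  rw [bmPoly_cesPoly_eval, ← Finset.sum_flip, Finset.mul_sum]
  refine le_trans ?_ (le_trans (Finset.sum_le_sum hE) (Finset.sum_le_sum_of_subset_of_nonneg
    (Finset.range_subset_range.2 (by omega)) fun q _ _ => mul_nonneg (exp_pos _).le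
      (mul_nonneg (rc_pos hm _).le (bmPoly_geg_eval_cosh_nonneg hk hm _ τ))))
  rw [← Finset.sum_mul, ← rc_add_one_eq_sum]
  have h8 : c1 * (1 / 2) ^ m * (1 / τ) ^ m ≤ rc (m + 1) Q := by
    refine le_trans ?_ (h1 Q hQ1).1
    rw [mul_assoc, ← mul_rpow (by norm_num) (by positivity), add_sub_cancel_right]
    gcongr
  have h9 : c2 * (1 / 2) ^ (m + 1) * (1 / τ) ^ (m + 1) ≤ rc (m + 1 + 1) Q := by
    refine le_trans ?_ (h2 Q hQ1).1
    rw [mul_assoc, ← mul_rpow (by norm_num) (by positivity), add_sub_cancel_right]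
    gcongr
  calc _ = (c1 * (1 / 2) ^ m * (1 / τ) ^ m) * (exp (-2) * (c0 * (c1 * (1 / 2) ^ m * (n : ℝ) ^ m * exp (-2) * (c2 * (1 / 2) ^ (m + 1) * (1 / τ) ^ (m + 1))))) := by
        rw [show 2 * m + 1 = m + (m + 1) by ring, rpow_add (by positivity) m (m + 1)]; ring
    _ ≤ _ := by
      have := rc_pos (c := m + 1) (by linarith) Q
      gcongr

/-- Contour shift for even polynomials: integrals over the half line outside the interval are controlled by
weighted integrals over the interval. -/
lemma exists_two_mul_integral_cosh_le (P : Polynomial ℝ) (hP : ∀ a, P.eval (-a) = P.eval a) {N : ℕ} (p : ℕ) (hN : Even N)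
    (hPN : P.natDegree ≤ N) {r : ℝ} (hr : 0 < r) : ∃ K, ∀ L : ℝ, 0 ≤ L →
    2 * ∫ x in (-L)..0, P.eval (cosh x) * cosh x ^ p * exp ((N + p + 1 : ℕ) * x) * (1 - exp (2 * x)) ^ r ≤
      (∫ θ in 0..π, |P.eval (cos θ)| * |cos θ| ^ p * (2 * sin θ) ^ r) + K * exp (-L) := by
  set Pc := P.map (algebraMap ℝ ℂ) with hPc
  have hPcr : ∀ a : ℝ, Pc.eval (a : ℂ) = (P.eval a : ℝ) := fun a => by
    rw [hPc, Polynomial.eval_map_algebraMap]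
    exact (Polynomial.aeval_algebraMap_apply_eq_algebraMap_eval a P)
  set F : ℂ → ℂ := fun w => Pc.eval (Complex.cosh w) * Complex.cosh w ^ p * Complex.exp ((N + p + 1 : ℕ) * w) with hF
  have hFd : Differentiable ℂ F := by
    intro w
    have h1 : Differentiable ℂ fun w => Pc.eval (Complex.cosh w) :=
      Pc.differentiable.comp Complex.differentiable_cosh
    have h2 : Differentiable ℂ fun w : ℂ => Complex.cosh w ^ p := Complex.differentiable_cosh.pow p
    have h3 : Differentiable ℂ fun w : ℂ => Complex.exp ((N + p + 1 : ℕ) * w) := by fun_prop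
    exact ((h1.mul h2).mul h3) w
  set H : ℂ → ℂ := fun w => F w * (1 - Complex.exp (2 * w)) ^ (r : ℂ) with hH
  have hPcneg : ∀ z : ℂ, Pc.eval (-z) = Pc.eval z := by
    have h1 : P.comp (-Polynomial.X) = P := by
      refine Polynomial.funext fun a => ?_
      rw [Polynomial.eval_comp]; simpa using hP a
    intro z
    have h2 := congrArg (fun q : Polynomial ℝ => (q.map (algebraMap ℝ ℂ)).eval z) h1
    simpa [hPc, Polynomial.map_comp, -Polynomial.eval_map_algebraMap] using h2
  have hFpi : ∀ w, F (w + π * Complex.I) = -F w := by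
    intro w
    have h1 : Complex.cosh (w + π * Complex.I) = -Complex.cosh w := by
      rw [Complex.cosh_add, Complex.cosh_mul_I, Complex.sinh_mul_I]; simp
    have h2 : Complex.exp ((N + p + 1 : ℕ) * (w + π * Complex.I)) = (-1) ^ (N + p + 1) * Complex.exp ((N + p + 1 : ℕ) * w) := by
      rw [mul_add, Complex.exp_add, Complex.exp_nat_mul (π * Complex.I), Complex.exp_pi_mul_I]; ring
    have h3 : (-1 : ℂ) ^ (N + p + 1) * (-1) ^ p = -1 := by
      rw [← pow_add]
      exact Odd.neg_one_pow (by obtain ⟨a, ha⟩ := hN; exact ⟨a + p, by omega⟩)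
    simp only [hF, h1, h2, hPcneg]
    rw [neg_pow]
    linear_combination (Pc.eval (Complex.cosh w) * Complex.cosh w ^ p * Complex.exp ((N + p + 1 : ℕ) * w)) * h3
  have hHpi : ∀ w, H (w + π * Complex.I) = -H w := by
    intro w
    simp only [hH, hFpi]
    rw [mul_add, show (2 : ℂ) * (π * Complex.I) = 2 * π * Complex.I by ring, Complex.exp_periodic]
    ring
  have hHx : ∀ x : ℝ, x ≤ 0 → H x = (P.eval (cosh x) * cosh x ^ p * exp ((N + p + 1 : ℕ) * x) * (1 - exp (2 * x)) ^ r : ℝ) := by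
    intro x hx
    have h1 : 0 ≤ 1 - exp (2 * x) := by
      have : exp (2 * x) ≤ 1 := exp_le_one_iff.2 (by linarith)
      linarith
    rw [Complex.ofReal_mul, Complex.ofReal_cpow h1]
    simp only [hH, hF]
    rw [← Complex.ofReal_cosh, hPcr]
    push_cast
    rfl
  have hre : ∀ w : ℂ, w.re ≤ 0 → 0 ≤ (1 - Complex.exp (2 * w)).re := by
    intro w hw
    have h1 := Complex.re_le_norm (Complex.exp (2 * w))
    rw [Complex.norm_exp] at h1
    have : exp (2 * w).re ≤ 1 := exp_le_one_iff.2 (by simp; linarith)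
    rw [Complex.sub_re, Complex.one_re]
    linarith
  have hre' : ∀ w : ℂ, w.re < 0 → 0 < (1 - Complex.exp (2 * w)).re := by
    intro w hw
    have h1 := Complex.re_le_norm (Complex.exp (2 * w))
    rw [Complex.norm_exp] at h1
    have : exp (2 * w).re < 1 := exp_lt_one_iff.2 (by simp; linarith)
    rw [Complex.sub_re, Complex.one_re]
    linarith
  have hcont : ∀ w : ℂ, w.re ≤ 0 → ContinuousAt H w := by
    intro w hw
    refine hFd.continuous.continuousAt.mul ?_
    have h1 := Complex.continuousAt_cpow_of_re_pos (p := (1 - Complex.exp (2 * w), (r : ℂ))) (Or.inl (hre w hw)) (by simpa using hr)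
    exact ContinuousAt.comp (f := fun w : ℂ => (1 - Complex.exp (2 * w), (r : ℂ))) h1 (by fun_prop)
  have hdiff : ∀ w : ℂ, w.re < 0 → DifferentiableAt ℂ H w := by
    intro w hw
    refine (hFd w).mul ?_
    exact DifferentiableAt.cpow (by fun_prop) (by fun_prop) (Or.inl (hre' w hw))
  have hnorm : ∀ w, ‖H w‖ = ‖F w‖ * ‖1 - Complex.exp (2 * w)‖ ^ r := fun w => by
    simp only [hH]
    rw [norm_mul, Complex.norm_cpow_real]
  set K0 := ∑ i ∈ range (N + 1), |P.coeff i| with hK0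
  have hFbound : ∀ w : ℂ, w.re ≤ 0 → ‖F w‖ ≤ K0 * exp w.re := by
    intro w hw
    have hch : ‖Complex.cosh w‖ ≤ exp (-w.re) := by
      rw [Complex.cosh, norm_div, Complex.norm_ofNat, div_le_iff₀ two_pos]
      refine (norm_add_le _ _).trans ?_
      rw [Complex.norm_exp, Complex.norm_exp, Complex.neg_re]
      have : exp w.re ≤ exp (-w.re) := exp_le_exp.2 (by linarith)
      linarith
    have he1 : 1 ≤ exp (-w.re) := one_le_exp (by linarith)
    have hPb : ‖Pc.eval (Complex.cosh w)‖ ≤ K0 * exp (-w.re) ^ N := by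
      rw [Polynomial.eval_eq_sum_range' (n := N + 1) (by rw [hPc]; exact Nat.lt_succ_of_le (Polynomial.natDegree_map_le.trans hPN)),
        hK0, Finset.sum_mul]
      refine norm_sum_le_of_le _ fun i hi => ?_
      rw [norm_mul, norm_pow, hPc, Polynomial.coeff_map, norm_algebraMap', Real.norm_eq_abs]
      refine mul_le_mul_of_nonneg_left ?_ (abs_nonneg _)
      calc _ ≤ exp (-w.re) ^ i := by gcongr
        _ ≤ _ := pow_le_pow_right₀ he1 (Finset.mem_range_succ_iff.1 hi)
    simp only [hF]
    rw [norm_mul, norm_mul, norm_pow, Complex.norm_exp]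
    have hK00 : 0 ≤ K0 := Finset.sum_nonneg fun _ _ => abs_nonneg _
    calc _ ≤ K0 * exp (-w.re) ^ N * exp (-w.re) ^ p * exp (((N + p + 1 : ℕ) * w).re) := by gcongr
      _ = _ := by
        rw [mul_assoc, mul_assoc, ← Real.exp_nat_mul, ← Real.exp_nat_mul, ← Real.exp_add, ← Real.exp_add]
        congr 2
        simp
        ring
  refine ⟨K0 * 2 ^ r * π, fun L hL => ?_⟩
  have hc := Complex.integral_boundary_rect_eq_zero_of_continuousOn_of_differentiableOn H (-L : ℝ) (π * Complex.I) ?_ ?_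
  rotate_left
  · intro w hw
    refine (hcont w ?_).continuousWithinAt
    have := hw.1
    simp [Set.uIcc_of_le (show -L ≤ 0 by linarith)] at this
    exact this.2
  · intro w hw
    refine (hdiff w ?_).differentiableWithinAt
    have := hw.1
    simp [hL] at this
    exact this.2
  simp only [Complex.ofReal_re, Complex.ofReal_im, Complex.mul_re, Complex.mul_im, Complex.I_re, Complex.I_im, mul_zero, mul_one,
    zero_mul, sub_zero, add_zero, zero_add, Complex.ofReal_zero, hHpi, intervalIntegral.integral_neg, sub_neg_eq_add] at hc
  have hI : ∫ x in (-L)..0, H x = ((∫ x in (-L)..0, P.eval (cosh x) * cosh x ^ p * exp ((N + p + 1 : ℕ) * x) * (1 - exp (2 * x)) ^ r : ℝ) : ℂ) := by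
    rw [← intervalIntegral.integral_ofReal]
    refine intervalIntegral.integral_congr fun x hx => hHx x ?_
    rw [Set.uIcc_of_le (by linarith)] at hx
    exact hx.2
  rw [hI] at hc
  set J := ∫ x in (-L)..0, P.eval (cosh x) * cosh x ^ p * exp ((N + p + 1 : ℕ) * x) * (1 - exp (2 * x)) ^ r with hJ
  have h1 : ((2 * J : ℝ) : ℂ) = Complex.I • (∫ y in 0..π, H ((-L : ℝ) + y * Complex.I)) - Complex.I • ∫ y in 0..π, H (y * Complex.I) := by
    push_cast
    push_cast at hc
    linear_combination hc
  have h2 : ‖∫ y in 0..π, H ((-L : ℝ) + y * Complex.I)‖ ≤ K0 * 2 ^ r * π * exp (-L) := by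
    refine (intervalIntegral.norm_integral_le_of_norm_le_const (C := K0 * exp (-L) * 2 ^ r) fun y _ => ?_).trans ?_
    · have hre0 : (((-L : ℝ) : ℂ) + y * Complex.I).re = -L := by simp
      rw [hnorm]
      have h3 := hFbound ((-L : ℝ) + y * Complex.I) (by rw [hre0]; linarith)
      rw [hre0] at h3
      have h4 : ‖1 - Complex.exp (2 * ((-L : ℝ) + y * Complex.I))‖ ≤ 2 := by
        refine (norm_sub_le _ _).trans ?_
        rw [Complex.norm_exp, norm_one]
        have : exp (2 * (((-L : ℝ) : ℂ) + y * Complex.I)).re ≤ 1 := exp_le_one_iff.2 (by simpa using hL)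
        linarith
      gcongr
    · rw [sub_zero, abs_of_pos pi_pos]; apply le_of_eq; ring
  have h3 : ‖∫ y in 0..π, H (y * Complex.I)‖ ≤ ∫ θ in 0..π, |P.eval (cos θ)| * |cos θ| ^ p * (2 * sin θ) ^ r := by
    refine (intervalIntegral.norm_integral_le_integral_norm pi_pos.le).trans (le_of_eq ?_)
    refine intervalIntegral.integral_congr fun θ hθ => ?_
    rw [Set.uIcc_of_le pi_pos.le] at hθ
    have hs := sin_nonneg_of_nonneg_of_le_pi hθ.1 hθ.2
    have h4 : ‖1 - Complex.exp (2 * (θ * Complex.I))‖ = 2 * sin θ := by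
      have : 1 - Complex.exp (2 * (θ * Complex.I)) = -(2 * Complex.I) * (sin θ : ℝ) * Complex.exp (θ * Complex.I) := by
        rw [two_mul, Complex.exp_add, Complex.exp_mul_I, ← Complex.ofReal_cos, ← Complex.ofReal_sin]
        have h5 : ((cos θ : ℝ) : ℂ) ^ 2 + (sin θ : ℝ) ^ 2 = 1 := by
          exact_mod_cast cos_sq_add_sin_sq θ
        linear_combination -h5 + (3 * ((sin θ : ℝ) : ℂ) ^ 2 - 2 * ((sin θ : ℝ) : ℂ) ^ 2) * Complex.I_sq
      rw [this, norm_mul, norm_mul, Complex.norm_exp_ofReal_mul_I, norm_neg, norm_mul, Complex.norm_I, Complex.norm_real,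
        Real.norm_of_nonneg hs]
      simp
    simp only [hnorm, h4, hF]
    rw [Complex.cosh_mul_I, ← Complex.ofReal_cos, hPcr, norm_mul, norm_mul, norm_pow, Complex.norm_real, Complex.norm_real,
      Complex.norm_exp]
    simp
  have h4 : 2 * J ≤ ‖((2 * J : ℝ) : ℂ)‖ := by
    rw [Complex.norm_real]; exact le_norm_self _
  refine h4.trans ?_
  rw [h1]
  refine (norm_sub_le _ _).trans ?_
  rw [norm_smul, norm_smul, Complex.norm_I, one_mul, one_mul]
  linarith

/-- The logarithmic lower bound at the critical index. -/
lemma exists_log_le_integral_bmPoly {k m : ℝ} (hk : 0 < k) (hm : 0 < m) : ∃ c, 0 < c ∧ ∀ n : ℕ, 2 ≤ n →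
    c * ((n : ℝ) ^ m * log n) ≤
      ∫ θ in 0..π, |cos θ| ^ (2 * k) * |(bmPoly k (cesPoly m (m + k) n)).eval (cos θ)| * sin θ ^ (2 * m) := by
  obtain ⟨c1, hc1, h1⟩ := exists_le_integral_bmPoly hk hm
  obtain ⟨c2, hc2, h2⟩ := exists_le_bmPoly_cesPoly_cosh hk hm
  set p := ⌈2 * k⌉₊ with hp
  set c3 := c2 * exp (-(p + 1)) * (2 / 3) ^ (2 * m) with hc3
  have hc30 : 0 < c3 := by positivity
  refine ⟨1 / (2 ^ (2 * m) / (2 * c3) + 1 / c1), by positivity, fun n hn => ?_⟩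
  have hn0 : (0 : ℝ) < n := by positivity
  have hn2 : (2 : ℝ) ≤ n := by exact_mod_cast hn
  set P := bmPoly k (cesPoly m (m + k) n) with hP
  have hPpos : ∀ x, 0 ≤ P.eval (cosh x) := bmPoly_cesPoly_eval_cosh_nonneg hk hm hm n
  set J := ∫ θ in 0..π, |cos θ| ^ (2 * k) * |P.eval (cos θ)| * sin θ ^ (2 * m) with hJ
  obtain ⟨K, hK⟩ := exists_two_mul_integral_cosh_le P (bmPoly_eval_neg k _) (N := 2 * n) p ⟨n, by ring⟩
    ((bmPoly_natDegree_le _ _).trans (cesPoly_degree_coeff m (m + k) n).1) (r := 2 * m) (by linarith)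
  set h : ℝ → ℝ := fun x => P.eval (cosh x) * cosh x ^ p * exp ((2 * n + p + 1 : ℕ) * x) * (1 - exp (2 * x)) ^ (2 * m) with hh
  have hJ' : ∫ θ in 0..π, |P.eval (cos θ)| * |cos θ| ^ p * (2 * sin θ) ^ (2 * m) ≤ 2 ^ (2 * m) * J := by
    rw [hJ, ← intervalIntegral.integral_const_mul]
    have hs : Continuous fun θ => sin θ ^ (2 * m) := continuous_sin.rpow_const fun _ => Or.inr (by linarith)
    have hs2 : Continuous fun θ => (2 * sin θ) ^ (2 * m) := (continuous_const.mul continuous_sin).rpow_const fun _ => Or.inr (by linarith)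
    have hc : Continuous fun θ => |cos θ| ^ (2 * k) := continuous_cos.abs.rpow_const fun _ => Or.inr (by linarith)
    have hPc : Continuous fun θ => |P.eval (cos θ)| := (P.continuous.comp continuous_cos).abs
    refine intervalIntegral.integral_mono_on pi_pos.le ((hPc.mul (continuous_cos.abs.pow p)).mul hs2).continuousOn.intervalIntegrable
      (continuous_const.mul ((hc.mul hPc).mul hs)).continuousOn.intervalIntegrable fun θ hθ => ?_
    have hsin := sin_nonneg_of_nonneg_of_le_pi hθ.1 hθ.2
    rw [mul_rpow two_pos.le hsin]
    have h5 : |cos θ| ^ p ≤ |cos θ| ^ (2 * k) := by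
      rw [← rpow_natCast]
      exact rpow_le_rpow_of_exponent_ge' (abs_nonneg _) (abs_cos_le_one θ) (by linarith) (Nat.le_ceil _)
    calc _ ≤ |P.eval (cos θ)| * |cos θ| ^ (2 * k) * (2 ^ (2 * m) * sin θ ^ (2 * m)) := by gcongr
      _ = _ := by ring
  have hexp : ∀ x ≤ 0, 0 ≤ 1 - exp (2 * x) := fun x hx => by
    have : exp (2 * x) ≤ 1 := exp_le_one_iff.2 (by linarith)
    linarith
  have hh0 : ∀ x ≤ 0, 0 ≤ h x := fun x hx =>
    mul_nonneg (mul_nonneg (mul_nonneg (hPpos x) (pow_nonneg (cosh_pos x).le p)) (exp_pos _).le) (rpow_nonneg (hexp x hx) _)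
  have hhc : Continuous h := by
    have h6 : Continuous fun x => (1 - exp (2 * x)) ^ (2 * m) :=
      Continuous.rpow_const (by fun_prop) fun _ => Or.inr (by linarith)
    exact (((P.continuous.comp continuous_cosh).mul (continuous_cosh.pow p)).mul (by fun_prop)).mul h6
  have h2n : 2 / (n : ℝ) ≤ 1 := by rwa [div_le_one hn0]
  have h2n0 : 0 < 2 / (n : ℝ) := by positivity
  have hlow : c3 * (n : ℝ) ^ m * log (n / 2) ≤ ∫ x in (-1)..(-(2 / n)), h x := by
    have h7 : ∫ x in (-1 : ℝ)..(-(2 / n)), c3 * (n : ℝ) ^ m * (1 / (-x)) = c3 * (n : ℝ) ^ m * log (n / 2) := by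
      rw [intervalIntegral.integral_const_mul, intervalIntegral.integral_comp_neg (fun x => 1 / x), neg_neg, neg_neg,
        integral_one_div_of_pos h2n0 one_pos, one_div_div]
    rw [← h7]
    refine intervalIntegral.integral_mono_on (by linarith) ?_ hhc.continuousOn.intervalIntegrable fun x hx => ?_
    · refine ContinuousOn.intervalIntegrable (continuousOn_const.mul (continuousOn_const.div continuousOn_neg fun x hx => ?_))
      rw [Set.uIcc_of_le (by linarith)] at hx
      have := hx.2
      exact (by linarith : 0 < -x).ne'
    · have hx1 := hx.1
      have hx2 := hx.2
      obtain ⟨τ, rfl⟩ : ∃ τ, x = -τ := ⟨-x, by ring⟩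
      have hτ1 : τ ≤ 1 := by linarith
      have hτ2 : 2 / n ≤ τ := by linarith
      have hτ0 : 0 < τ := by linarith
      have h8 := h2 n hn τ hτ2 hτ1
      rw [neg_neg]
      have h9 : 2 / 3 * τ ≤ 1 - exp (2 * -τ) := by
        have e1 : 1 + 2 * τ ≤ exp (2 * τ) := by linarith [add_one_le_exp (2 * τ)]
        have e2 : exp (2 * -τ) * exp (2 * τ) = 1 := by rw [← Real.exp_add]; simp
        have e3 := exp_pos (2 * -τ)
        have e4 : exp (2 * -τ) * (1 + 2 * τ) ≤ 1 := by
          have := mul_le_mul_of_nonneg_left e1 e3.le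
          linarith
        have e5 : exp (2 * -τ) ≤ 1 := exp_le_one_iff.2 (by linarith)
        nlinarith
      have h10 : exp ((2 * n + p + 1 : ℕ) * -τ) = exp (-(2 * n * τ)) * exp (-((p + 1) * τ)) := by
        rw [← Real.exp_add]; push_cast; ring_nf
      have h11 : exp (-(p + 1)) ≤ exp (-((p + 1) * τ)) := by
        rw [exp_le_exp]
        have : ((p : ℝ) + 1) * τ ≤ (p + 1) * 1 := by gcongr
        linarith
      have h12 : 1 ≤ cosh (-τ) ^ p := one_le_pow₀ (one_le_cosh _)
      have h13 : (2 / 3) ^ (2 * m) * τ ^ (2 * m) ≤ (1 - exp (2 * -τ)) ^ (2 * m) := by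
        rw [← mul_rpow (by norm_num) hτ0.le]
        gcongr
      have h14 : (1 / τ) ^ (2 * m + 1) * τ ^ (2 * m) = 1 / τ := by
        rw [rpow_add_one (by positivity), mul_right_comm, ← mul_rpow (by positivity) hτ0.le, one_div_mul_cancel hτ0.ne', one_rpow, one_mul]
      have hP0 : 0 ≤ exp (-(2 * n * τ)) * P.eval (cosh (-τ)) := mul_nonneg (exp_pos _).le (hPpos _)
      rw [← cosh_neg] at h8
      calc c3 * (n : ℝ) ^ m * (1 / τ)
          = (c2 * (n : ℝ) ^ m * (1 / τ) ^ (2 * m + 1)) * 1 * exp (-(p + 1)) * ((2 / 3) ^ (2 * m) * τ ^ (2 * m)) := by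
            rw [hc3]
            linear_combination (-(c2 * exp (-(p + 1)) * (2 / 3) ^ (2 * m) * (n : ℝ) ^ m)) * h14
        _ ≤ (exp (-(2 * n * τ)) * P.eval (cosh (-τ))) * cosh (-τ) ^ p * exp (-((p + 1) * τ)) * (1 - exp (2 * -τ)) ^ (2 * m) := by
            gcongr
        _ = h (-τ) := by simp only [hh]; rw [h10]; ring
  have hL : ∀ L : ℝ, 1 ≤ L → 2 * (c3 * (n : ℝ) ^ m * log (n / 2)) ≤ 2 ^ (2 * m) * J + K * exp (-L) := by
    intro L hL
    have h15 : ∫ x in (-1)..(-(2 / n)), h x ≤ ∫ x in (-L)..0, h x := by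
      refine intervalIntegral.integral_mono_interval (by linarith) (by linarith) (by linarith) ?_ hhc.continuousOn.intervalIntegrable
      refine (ae_restrict_iff' measurableSet_Ioc).2 (Filter.Eventually.of_forall fun x hx => hh0 x hx.2)
    have := hK L (by linarith)
    linarith
  have hlim : 2 * (c3 * (n : ℝ) ^ m * log (n / 2)) ≤ 2 ^ (2 * m) * J := by
    have ht : Filter.Tendsto (fun L : ℝ => 2 ^ (2 * m) * J + K * exp (-L)) Filter.atTop (nhds (2 ^ (2 * m) * J + K * 0)) :=
      (Real.tendsto_exp_neg_atTop_nhds_zero.const_mul K).const_add _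
    rw [mul_zero, add_zero] at ht
    exact ge_of_tendsto ht (Filter.eventually_atTop.2 ⟨1, hL⟩)
  have h16 := h1 m n (by omega)
  have h17 : log n = log (n / 2) + log 2 := by
    rw [← log_mul (by positivity) two_ne_zero, div_mul_cancel₀ _ two_ne_zero]
  have h18 : log 2 ≤ 1 := by linarith [log_le_sub_one_of_pos (two_pos (α := ℝ))]
  rw [div_mul_eq_mul_div, one_mul, div_le_iff₀ (by positivity), h17, mul_add, mul_comm]
  have h19 : (n : ℝ) ^ m * log (n / 2) ≤ 2 ^ (2 * m) / (2 * c3) * J := by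
    rw [div_mul_eq_mul_div, le_div_iff₀ (by positivity)]
    linarith
  have h20 : (n : ℝ) ^ m ≤ 1 / c1 * J := by
    rw [div_mul_eq_mul_div, le_div_iff₀ hc1, one_mul, mul_comm]
    exact h16
  have h21 : (n : ℝ) ^ m * log 2 ≤ (n : ℝ) ^ m := by
    have : (0 : ℝ) ≤ (n : ℝ) ^ m := by positivity
    nlinarith
  linarith

/-- The suprema of the unnormalised Lebesgue functions are comparable to the three model growth rates. -/
lemma iSup_simpL_bounds {d : ℕ} {κ : Fin (d + 1) → ℝ} (hκ : ∀ j, 0 < κ j) {k m : ℝ} {i : Fin (d + 1)} (hki : κ i = k)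
    (hkκ : ∀ j, k ≤ κ j) (hkm : k ≤ m + 1) (hm : 0 < m) (hl : m + k = ∑ j, κ j + ((d : ℝ) - 1) / 2) (δ : ℝ) :
    (δ < m → ∃ c C, 0 < c ∧ 0 < C ∧ ∀ n : ℕ, 1 ≤ n → c * (n : ℝ) ^ m ≤ ⨆ x : simplexT d, simpL d κ (cesPoly δ (m + k) n) x ∧
      ⨆ x : simplexT d, simpL d κ (cesPoly δ (m + k) n) x ≤ C * (n : ℝ) ^ m) ∧
    (δ = m → ∃ c C, 0 < c ∧ 0 < C ∧ ∀ n : ℕ, 2 ≤ n →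
      c * ((n : ℝ) ^ m * log n) ≤ ⨆ x : simplexT d, simpL d κ (cesPoly δ (m + k) n) x ∧
      ⨆ x : simplexT d, simpL d κ (cesPoly δ (m + k) n) x ≤ C * ((n : ℝ) ^ m * log n)) ∧
    (m < δ → ∃ c C, 0 < c ∧ 0 < C ∧ ∀ n : ℕ, 1 ≤ n → c * (n : ℝ) ^ δ ≤ ⨆ x : simplexT d, simpL d κ (cesPoly δ (m + k) n) x ∧
      ⨆ x : simplexT d, simpL d κ (cesPoly δ (m + k) n) x ≤ C * (n : ℝ) ^ δ) := by
  have hk : 0 < k := hki ▸ hκ i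
  obtain ⟨A, hA, x₀, hx₀, hv⟩ := simpL_vertex hκ i hki hm.le hl
  have hne : Nonempty (simplexT d) := ⟨⟨x₀, hx₀⟩⟩
  have hsup : ∀ {n : ℕ} {x : Fin d → ℝ} {B b : ℝ}, x ∈ simplexT d → (∀ x ∈ simplexT d, simpL d κ (cesPoly δ (m + k) n) x ≤ B) →
      b ≤ simpL d κ (cesPoly δ (m + k) n) x → b ≤ ⨆ x : simplexT d, simpL d κ (cesPoly δ (m + k) n) x ∧
      ⨆ x : simplexT d, simpL d κ (cesPoly δ (m + k) n) x ≤ B := fun {n x B b} hx hB hb =>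
    ⟨hb.trans (le_ciSup (f := fun x : simplexT d => simpL d κ (cesPoly δ (m + k) n) x)
      ⟨B, by rintro _ ⟨y, rfl⟩; exact hB y y.2⟩ ⟨x, hx⟩), ciSup_le fun y => hB y y.2⟩
  obtain ⟨u1, u2, u3⟩ := simpL_cesPoly_bounds hκ hk hkκ hkm hm hl δ
  refine ⟨fun h => ?_, fun h => ?_, fun h => ?_⟩
  · obtain ⟨C, hC, hu⟩ := u1 h
    obtain ⟨c, hc, hlow⟩ := exists_le_integral_bmPoly hk hm
    refine ⟨A * c, C, by positivity, hC, fun n hn => hsup hx₀ (hu n hn) ?_⟩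
    rw [hv, mul_assoc]
    exact mul_le_mul_of_nonneg_left (hlow δ n hn) hA.le
  · obtain ⟨C, hC, hu⟩ := u2 h
    obtain ⟨c, hc, hlow⟩ := exists_log_le_integral_bmPoly hk hm
    refine ⟨A * c, C, by positivity, hC, fun n hn => hsup hx₀ (hu n hn) ?_⟩
    rw [hv, mul_assoc]
    have := hlow n hn
    rw [h]
    exact mul_le_mul_of_nonneg_left this hA.le
  · obtain ⟨C, hC, hu⟩ := u3 h
    obtain ⟨c, hc, hlow⟩ := exists_simpL_ge_rc hκ (l := m + k) (by linarith) hl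
    obtain ⟨b, B, hb, hB, hrc⟩ := rc_bounds (a := δ + 1) (by linarith)
    refine ⟨c * b, C, by positivity, hC, fun n hn => hsup hx₀ (hu n hn) ?_⟩
    refine le_trans ?_ (hlow x₀ hx₀ δ (by linarith) n)
    rw [mul_assoc]
    refine mul_le_mul_of_nonneg_left ?_ hc.le
    simpa using (hrc n hn).1

/-- Theorem 2.7, operator norms on the simplex:
`Π_n^T ∼ n^{σ_κ}` for `n ≥ 1`, and for `n ≥ 2`: `Λ_n^{T,δ} ∼ 1` if `δ > σ_κ`,
`∼ log n` if `δ = σ_κ`, `∼ n^{σ_κ-δ}` if `-1 < δ < σ_κ`. -/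
theorem cesaro_and_projection_norm_simplex (d : ℕ) (hd : 1 ≤ d) (κ : Fin (d + 1) → ℝ)
    (hκ : ∀ i, 0 < κ i) (δ : ℝ) (hδ : -1 < δ) (q : ℕ → Polynomial ℝ)
    (hqdeg : ∀ k, (q k).degree = k) (hqlead : ∀ k, 0 < (q k).leadingCoeff)
    (hqorth : ∀ j k, (∫ t in (-1 : ℝ)..1,
        (q j).eval t * (q k).eval t * wJac ((∑ i, κ i) + ((d : ℝ) - 2) / 2) (-(1 / 2)) t) =
      if j = k then 1 else 0) :
    ∃ c₁ c₂ : ℝ, 0 < c₁ ∧ 0 < c₂ ∧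
      (∀ n : ℕ, 1 ≤ n →
        c₁ * (n : ℝ) ^ sigmaK d κ ≤ projNormT d κ q n ∧
          projNormT d κ q n ≤ c₂ * (n : ℝ) ^ sigmaK d κ) ∧
      (∀ n : ℕ, 2 ≤ n →
        (δ > sigmaK d κ →
          c₁ ≤ cesaroNormT d κ q δ n ∧ cesaroNormT d κ q δ n ≤ c₂) ∧
        (δ = sigmaK d κ →
          c₁ * Real.log n ≤ cesaroNormT d κ q δ n ∧
            cesaroNormT d κ q δ n ≤ c₂ * Real.log n) ∧
        (δ < sigmaK d κ →
          c₁ * (n : ℝ) ^ (sigmaK d κ - δ) ≤ cesaroNormT d κ q δ n ∧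
            cesaroNormT d κ q δ n ≤ c₂ * (n : ℝ) ^ (sigmaK d κ - δ))) := by
  obtain ⟨A, hA, hproj, hces⟩ := exists_norm_eq_iSup_simpL hd hκ hqdeg hqorth
  obtain ⟨i, -, hi⟩ := Finset.exists_mem_eq_inf' (Finset.univ_nonempty) κ
  have hkκ : ∀ j, κ i ≤ κ j := fun j => hi ▸ Finset.inf'_le κ (Finset.mem_univ j)
  have hd' : (1 : ℝ) ≤ d := by exact_mod_cast hd
  have hl : sigmaK d κ + κ i = ∑ j, κ j + ((d : ℝ) - 1) / 2 := by rw [sigmaK, hi]; ring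
  have hkm : κ i ≤ sigmaK d κ := by
    obtain ⟨j, hj⟩ : ∃ j, j ≠ i := by
      have : Nontrivial (Fin (d + 1)) := Fin.nontrivial_iff_two_le.2 (by omega)
      exact exists_ne i
    have h1 : κ j + κ i ≤ ∑ j, κ j := by
      rw [← Finset.sum_pair hj]
      exact Finset.sum_le_sum_of_subset_of_nonneg (Finset.subset_univ _) fun j _ _ => (hκ j).le
    have := hkκ j
    linarith
  have hm : 0 < sigmaK d κ := (hκ i).trans_le hkm
  generalize sigmaK d κ = m at *
  rw [← hl] at hproj hces
  have hp : ∃ c C, 0 < c ∧ 0 < C ∧ ∀ n : ℕ, 1 ≤ n → c * (n : ℝ) ^ m ≤ projNormT d κ q n ∧ projNormT d κ q n ≤ C * (n : ℝ) ^ m := by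
    obtain ⟨c, C, hc, hC, h⟩ := (iSup_simpL_bounds hκ rfl hkκ (by linarith) hm hl (-1)).1 (by linarith)
    refine ⟨A * c, A * C, by positivity, by positivity, fun n hn => ?_⟩
    obtain ⟨h1, h2⟩ := h n hn
    rw [hproj, mul_assoc, mul_assoc]
    exact ⟨by gcongr, by gcongr⟩
  obtain ⟨b, B, hb, hB, hrc⟩ := rc_bounds (a := δ + 1) (by linarith)
  -- division by the normalising coefficient
  have hdiv : ∀ {c C X Y : ℝ} {n : ℕ}, 2 ≤ n → 0 < c → 0 < C → 0 ≤ Y → X = (n : ℝ) ^ δ * Y →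
      c * X ≤ ⨆ x : simplexT d, simpL d κ (cesPoly δ (m + κ i) n) x →
      ⨆ x : simplexT d, simpL d κ (cesPoly δ (m + κ i) n) x ≤ C * X →
      A * c / B * Y ≤ cesaroNormT d κ q δ n ∧ cesaroNormT d κ q δ n ≤ A * C / b * Y := by
    intro c C X Y n hn hc hC hY hX h1 h2
    obtain ⟨r1, r2⟩ := hrc n (by omega)
    rw [add_sub_cancel_right] at r1 r2
    have hr : 0 < rc (δ + 1) n := rc_pos (by linarith) n
    rw [hces δ hδ, mul_right_comm, ← div_eq_mul_inv, le_div_iff₀ hr, div_le_iff₀ hr]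
    constructor
    · calc A * c / B * Y * rc (δ + 1) n ≤ A * c / B * Y * (B * (n : ℝ) ^ δ) := by gcongr
        _ = A * (c * X) := by rw [hX]; field_simp
        _ ≤ _ := by gcongr
    · calc _ ≤ A * (C * X) := by gcongr
        _ = A * C / b * Y * (b * (n : ℝ) ^ δ) := by rw [hX]; field_simp
        _ ≤ _ := by gcongr
  have hcomb : ∀ Y : ℕ → ℝ, (∀ n, 0 ≤ Y n) → (∃ c C, 0 < c ∧ 0 < C ∧ ∀ n : ℕ, 2 ≤ n →
      c * Y n ≤ cesaroNormT d κ q δ n ∧ cesaroNormT d κ q δ n ≤ C * Y n) →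
      ∃ c₁ c₂ : ℝ, 0 < c₁ ∧ 0 < c₂ ∧ (∀ n : ℕ, 1 ≤ n → c₁ * (n : ℝ) ^ m ≤ projNormT d κ q n ∧
        projNormT d κ q n ≤ c₂ * (n : ℝ) ^ m) ∧ ∀ n : ℕ, 2 ≤ n →
        c₁ * Y n ≤ cesaroNormT d κ q δ n ∧ cesaroNormT d κ q δ n ≤ c₂ * Y n := by
    rintro Y hY ⟨c, C, hc, hC, h⟩
    obtain ⟨c', C', hc', hC', h'⟩ := hp
    refine ⟨min c c', max C C', lt_min hc hc', lt_max_of_lt_left hC, fun n hn => ?_, fun n hn => ?_⟩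
    · have : (0 : ℝ) ≤ (n : ℝ) ^ m := by positivity
      exact ⟨(mul_le_mul_of_nonneg_right (min_le_right _ _) this).trans (h' n hn).1,
        (h' n hn).2.trans (mul_le_mul_of_nonneg_right (le_max_right _ _) this)⟩
    · exact ⟨(mul_le_mul_of_nonneg_right (min_le_left _ _) (hY n)).trans (h n hn).1,
        (h n hn).2.trans (mul_le_mul_of_nonneg_right (le_max_left _ _) (hY n))⟩
  obtain ⟨b1, b2, b3⟩ := iSup_simpL_bounds hκ (i := i) rfl hkκ (by linarith) hm hl δ
  have hpos : ∀ {n : ℕ}, 2 ≤ n → (0 : ℝ) < n := fun {n} hn => by exact_mod_cast (by omega : 0 < n)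
  rcases lt_trichotomy δ m with hlt | heq | hgt
  · obtain ⟨c, C, hc, hC, h⟩ := b1 hlt
    obtain ⟨c₁, c₂, h1, h2, h3, h4⟩ := hcomb (fun n => (n : ℝ) ^ (m - δ)) (fun n => by positivity)
      ⟨_, _, by positivity, by positivity, fun n hn => hdiv hn hc hC (by positivity)
        (by rw [← rpow_add (hpos hn), add_sub_cancel]) (h n (by omega)).1 (h n (by omega)).2⟩
    exact ⟨c₁, c₂, h1, h2, h3, fun n hn => ⟨fun h => absurd h hlt.not_gt, fun h => absurd h hlt.ne, fun _ => h4 n hn⟩⟩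
  · obtain ⟨c, C, hc, hC, h⟩ := b2 heq
    obtain ⟨c₁, c₂, h1, h2, h3, h4⟩ := hcomb (fun n => log n) (fun n => log_natCast_nonneg n)
      ⟨_, _, by positivity, by positivity, fun n hn => hdiv hn hc hC (log_natCast_nonneg n)
        (by rw [heq]) (h n hn).1 (h n hn).2⟩
    exact ⟨c₁, c₂, h1, h2, h3, fun n hn => ⟨fun h => absurd heq h.ne', fun _ => h4 n hn, fun h => absurd heq h.ne⟩⟩
  · obtain ⟨c, C, hc, hC, h⟩ := b3 hgt
    obtain ⟨c₁, c₂, h1, h2, h3, h4⟩ := hcomb (fun _ => 1) (fun n => zero_le_one)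
      ⟨_, _, by positivity, by positivity, fun n hn => hdiv hn hc hC zero_le_one
        (mul_one _).symm (h n (by omega)).1 (h n (by omega)).2⟩
    simp only [mul_one] at h4
    exact ⟨c₁, c₂, h1, h2, h3, fun n hn => ⟨fun _ => h4 n hn, fun h => absurd h hgt.ne', fun h => absurd h hgt.not_gt⟩⟩
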